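/- arXiv:1912.00309 — 2 statements merged into one kernel-verified Lean document; each statement's English description precedes it below -/
import Mathlib

section
/- Let m ≥ 4, n ≥ 2m+1, and let π = (d_1, …, d_n) be a non-increasing graphic sequence with d_{2m+2−i} ≥ i+1 for every 1 ≤ i ≤ m. Then π is potentially ₃C_{2m+1}-graphic, i.e., π has a realization containing cycles of every length r with 3 ≤ r ≤ 2m+1. -/
/-- `G` contains a cycle of length `r`. -/
def hasCycleOfLength {V : Type*} (G : SimpleGraph V) (r : ℕ) : Prop :=
  ∃ (v : V) (c : G.Walk v v), c.IsCycle ∧ c.length = r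

/-- `G` is a realization of the sequence `d`, i.e. `d` is its degree sequence. -/
def IsDegreeSeq {n : ℕ} (G : SimpleGraph (Fin n)) (d : Fin n → ℕ) : Prop :=
  ∀ i, (G.neighborSet i).ncard = d i

/-- The sequence `d` is graphic: it is the degree sequence of a simple graph. -/
def Graphic {n : ℕ} (d : Fin n → ℕ) : Prop :=
  ∃ G : SimpleGraph (Fin n), IsDegreeSeq G d

/-- `d` is potentially ₃Cℓ-graphic: some realization contains cycles of every
length `r` with `3 ≤ r ≤ ℓ`. -/
def Pot3C {n : ℕ} (ℓ : ℕ) (d : Fin n → ℕ) : Prop :=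
  ∃ G : SimpleGraph (Fin n), IsDegreeSeq G d ∧ ∀ r, 3 ≤ r → r ≤ ℓ → hasCycleOfLength G r

/-- `d` is potentially Cℓ-graphic: some realization contains a cycle of length `ℓ`. -/
def PotC {n : ℕ} (ℓ : ℕ) (d : Fin n → ℕ) : Prop :=
  ∃ G : SimpleGraph (Fin n), IsDegreeSeq G d ∧ hasCycleOfLength G ℓ

/-- `d` has a realization `G` containing cycles `C₃, …, C_ℓ` on those vertices with
degrees `d 0, …, d (ℓ-1)`: the induced subgraph on some vertex set `S`, whose multiset
of degrees is that of the first `ℓ` terms of `d`, contains cycles of all lengths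
from `3` to `ℓ`. -/
def RealizationWithCyclesOn {n : ℕ} (ℓ : ℕ) (d : Fin n → ℕ) : Prop :=
  ∃ (G : SimpleGraph (Fin n)) (S : Finset (Fin n)),
    IsDegreeSeq G d ∧ S.card = ℓ ∧
    S.val.map d = (Finset.univ.filter (fun i : Fin n => (i : ℕ) < ℓ)).val.map d ∧
    ∀ r, 3 ≤ r → r ≤ ℓ → hasCycleOfLength (G.induce (S : Set (Fin n))) r

section L29
open Finset Classical

variable {V : Type*} [Fintype V]

/-- degree as a filter cardinality -/
noncomputable def dg (G : SimpleGraph V) (x : V) : ℕ := (univ.filter (fun y => G.Adj x y)).card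

/-- neighbour finset -/
noncomputable def nb (G : SimpleGraph V) (x : V) : Finset V := univ.filter (fun y => G.Adj x y)

theorem mem_nb (G : SimpleGraph V) (x y : V) : y ∈ nb G x ↔ G.Adj x y := by simp [nb]
theorem card_nb (G : SimpleGraph V) (x : V) : (nb G x).card = dg G x := rfl

/-- add an edge -/
def addE (G : SimpleGraph V) (x y : V) : SimpleGraph V where
  Adj a b := G.Adj a b ∨ (a ≠ b ∧ ((a = x ∧ b = y) ∨ (a = y ∧ b = x)))
  symm := ⟨by
    rintro a b (h | ⟨h, h'⟩)
    · exact Or.inl h.symm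
    · refine Or.inr ⟨h.symm, ?_⟩
      tauto⟩
  loopless := ⟨by
    rintro a (h | ⟨h, _⟩)
    · exact G.loopless.irrefl a h
    · exact h rfl⟩

/-- delete an edge -/
def delE (G : SimpleGraph V) (x y : V) : SimpleGraph V where
  Adj a b := G.Adj a b ∧ ¬ ((a = x ∧ b = y) ∨ (a = y ∧ b = x))
  symm := ⟨by
    rintro a b ⟨h, h'⟩
    refine ⟨h.symm, ?_⟩
    tauto⟩
  loopless := ⟨by
    rintro a ⟨h, _⟩
    exact G.loopless.irrefl a h⟩

theorem addE_adj (G : SimpleGraph V) (x y a b : V) : (addE G x y).Adj a b ↔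
  G.Adj a b ∨ (a ≠ b ∧ ((a = x ∧ b = y) ∨ (a = y ∧ b = x))) := Iff.rfl

theorem delE_adj (G : SimpleGraph V) (x y a b : V) : (delE G x y).Adj a b ↔
  G.Adj a b ∧ ¬ ((a = x ∧ b = y) ∨ (a = y ∧ b = x)) := Iff.rfl

theorem dg_addE (G : SimpleGraph V) {x y : V} (hxy : x ≠ y) (h : ¬ G.Adj x y) (z : V) :
    dg (addE G x y) z = dg G z + if z = x ∨ z = y then 1 else 0 := by
  have h' : ¬ G.Adj y x := fun k => h k.symm
  by_cases hx : z = x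
  · subst hx
    have : univ.filter (fun w => (addE G z y).Adj z w) = insert y (univ.filter (fun w => G.Adj z w)) := by
      ext w
      simp only [mem_filter, mem_univ, true_and, mem_insert, addE_adj]
      grind
    simp only [dg, this, true_or, if_true]
    rw [card_insert_of_notMem (by simpa using h)]
  by_cases hy : z = y
  · subst hy
    have : univ.filter (fun w => (addE G x z).Adj z w) = insert x (univ.filter (fun w => G.Adj z w)) := by
      ext w
      simp only [mem_filter, mem_univ, true_and, mem_insert, addE_adj]
      grind
    simp only [dg, this, or_true, if_true]
    rw [card_insert_of_notMem (by simpa using h')]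
  · simp only [dg, addE_adj, hx, hy, false_and, or_self, and_false, or_false, if_false, add_zero]

theorem add_del (G : SimpleGraph V) {x y : V} (h : G.Adj x y) : addE (delE G x y) x y = G := by
  ext a b
  simp only [addE_adj, delE_adj]
  have := h.symm
  have := h.ne
  grind

theorem dg_delE (G : SimpleGraph V) {x y : V} (h : G.Adj x y) (z : V) :
    dg G z = dg (delE G x y) z + if z = x ∨ z = y then 1 else 0 := by
  conv_lhs => rw [← add_del G h]
  apply dg_addE _ h.ne
  simp [delE_adj]

theorem dg_eq_degree (G : SimpleGraph V) (x : V) : dg G x = G.degree x := by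
  rw [← SimpleGraph.card_neighborFinset_eq_degree]
  unfold dg
  congr 1
  ext y
  simp

theorem even_sum_dg (G : SimpleGraph V) : Even (∑ x, dg G x) := by
  simp only [dg_eq_degree]
  rw [SimpleGraph.sum_degrees_eq_twice_card_edges]
  exact even_two_mul _

theorem sum_ite_pair {x y : V} (h : x ≠ y) :
    (∑ z : V, if z = x ∨ z = y then 1 else 0) = 2 := by
  rw [Finset.sum_ite]
  simp
  have : (univ.filter (fun z => z = x ∨ z = y)) = {x, y} := by ext; simp
  rw [this, card_pair h]

theorem sum_addE (G : SimpleGraph V) {x y : V} (hxy : x ≠ y) (h : ¬ G.Adj x y) :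
    ∑ z, dg (addE G x y) z = ∑ z, dg G z + 2 := by
  simp only [dg_addE G hxy h, sum_add_distrib, sum_ite_pair hxy]

theorem sum_delE (G : SimpleGraph V) {x y : V} (h : G.Adj x y) :
    ∑ z, dg G z = ∑ z, dg (delE G x y) z + 2 := by
  simp only [dg_delE G h, sum_add_distrib, sum_ite_pair h.ne]

/-- star addition -/
theorem exists_star (G : SimpleGraph V) (v : V) (A : Finset V) (hv : v ∉ A) (h0 : dg G v = 0) :
    ∃ H : SimpleGraph V, (∀ a b, G.Adj a b → H.Adj a b) ∧ dg H v = A.card ∧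
      (∀ z, H.Adj v z ↔ z ∈ A) ∧
      ∀ z, z ≠ v → dg H z = dg G z + if z ∈ A then 1 else 0 := by
  induction A using Finset.induction_on with
  | empty =>
    refine ⟨G, fun _ _ h => h, by simpa using h0, ?_, by simp⟩
    intro z
    simp only [notMem_empty, iff_false]
    intro hz
    have : z ∈ nb G v := by rwa [mem_nb]
    rw [← card_nb, card_eq_zero] at h0
    simp [h0] at this
  | insert a A ha ih =>
    obtain ⟨H, h1, h2, h3, h4⟩ := ih (fun h => hv (mem_insert_of_mem h))
    have hva : v ≠ a := fun h => hv (by simp [h])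
    have hn : ¬ H.Adj v a := by rw [h3]; exact ha
    refine ⟨addE H v a, fun x y h => Or.inl (h1 x y h), ?_, ?_, ?_⟩
    · rw [dg_addE H hva hn, h2, card_insert_of_notMem ha]; simp
    · intro z
      rw [addE_adj, h3, mem_insert]
      grind
    · intro z hz
      rw [dg_addE H hva hn, h4 z hz]
      by_cases hza : z = a
      · subst hza; simp [ha]
      · simp [hz, hza]

/-- removing all the edges at a vertex -/
theorem exists_unstar (G : SimpleGraph V) (v : V) :
    ∃ H : SimpleGraph V, dg H v = 0 ∧
      ∀ z, z ≠ v → dg G z = dg H z + if G.Adj v z then 1 else 0 := by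
  let H : SimpleGraph V :=
    { Adj := fun a b => G.Adj a b ∧ a ≠ v ∧ b ≠ v
      symm := ⟨fun a b h => ⟨h.1.symm, h.2.2, h.2.1⟩⟩
      loopless := ⟨fun a h => G.loopless.irrefl a h.1⟩ }
  refine ⟨H, ?_, ?_⟩
  · rw [← card_nb, card_eq_zero]
    ext z
    simp [mem_nb, H]
  · intro z hz
    rw [← card_nb, ← card_nb]
    have : nb H z = (nb G z).erase v := by
      ext w
      simp only [mem_nb, mem_erase, H]
      tauto
    rw [this]
    split_ifs with h
    · have : v ∈ nb G z := by rw [mem_nb]; exact h.symm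
      rw [card_erase_add_one this]
    · have : v ∉ nb G z := by rw [mem_nb]; exact fun k => h k.symm
      rw [erase_eq_of_notMem this, add_zero]

end L29

section L29
open Finset Classical

variable {V : Type*} [Fintype V]

/-- edge-maximal subrealizations -/
def MaxSub (d : V → ℕ) (G : SimpleGraph V) : Prop :=
  (∀ v, dg G v ≤ d v) ∧ ∀ H : SimpleGraph V, (∀ v, dg H v ≤ d v) → ∑ v, dg H v ≤ ∑ v, dg G v

theorem exists_maxSub (d : V → ℕ) : ∃ G : SimpleGraph V, MaxSub d G := by
  have hf : Set.Finite {G : SimpleGraph V | ∀ v, dg G v ≤ d v} := Set.toFinite _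
  obtain ⟨G, hG, hm⟩ := Set.exists_max_image _ (fun G => ∑ v, dg G v) hf
    ⟨⊥, by intro v; simp [dg]⟩
  exact ⟨G, hG, hm⟩

variable {d : V → ℕ} {G : SimpleGraph V}

theorem F1 (hG : MaxSub d G) {u w : V} (hu : dg G u < d u) (hw : dg G w < d w) (huw : u ≠ w) :
    G.Adj u w := by
  by_contra h
  have h1 := hG.2 (addE G u w) (by
    intro v
    rw [dg_addE G huw h]
    have := hG.1 v
    split_ifs with hv
    · rcases hv with rfl | rfl <;> omega
    · omega)
  rw [sum_addE G huw h] at h1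
  omega

theorem F2 (hG : MaxSub d G) {u x y : V} (hu : dg G u + 2 ≤ d u) (hxy : G.Adj x y)
    (hxu : x ≠ u) (hyu : y ≠ u) (h1 : ¬ G.Adj u x) (h2 : ¬ G.Adj u y) : False := by
  have ha : ¬ (delE G x y).Adj u x := fun h => h1 h.1
  have hb : ¬ (addE (delE G x y) u x).Adj u y := by
    rw [addE_adj, delE_adj]
    have := hxy.ne
    grind
  have hs := hG.2 (addE (addE (delE G x y) u x) u y) (by
    intro v
    rw [dg_addE _ hyu.symm hb, dg_addE _ hxu.symm ha]
    have h3 := hG.1 v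
    have h4 := dg_delE G hxy v
    have := hxy.ne
    split_ifs at * <;> grind)
  rw [sum_addE _ hyu.symm hb, sum_addE _ hxu.symm ha] at hs
  have := sum_delE G hxy
  omega

theorem F3 (hG : MaxSub d G) {u w x y : V} (hu : dg G u < d u) (hw : dg G w < d w) (huw : u ≠ w)
    (hxy : G.Adj x y) (hxu : x ≠ u) (hyw : y ≠ w) (h1 : ¬ G.Adj u x) (h2 : ¬ G.Adj w y) :
    False := by
  have huw' := F1 hG hu hw huw
  have hxw : x ≠ w := by rintro rfl; exact h1 huw'
  have hyu : y ≠ u := by rintro rfl; exact h2 huw'.symm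
  have ha : ¬ (delE G x y).Adj u x := fun h => h1 h.1
  have hb : ¬ (addE (delE G x y) u x).Adj w y := by
    rw [addE_adj, delE_adj]
    have := hxy.ne
    grind
  have hs := hG.2 (addE (addE (delE G x y) u x) w y) (by
    intro v
    rw [dg_addE _ hyw.symm hb, dg_addE _ hxu.symm ha]
    have h3 := hG.1 v
    have h4 := dg_delE G hxy v
    have := hxy.ne
    split_ifs at * <;> grind)
  rw [sum_addE _ hyw.symm hb, sum_addE _ hxu.symm ha] at hs
  have := sum_delE G hxy
  omega

theorem M1 (hG : MaxSub d G) {w b c : V} (hw : dg G w < d w) (hbw : b ≠ w) (h1 : ¬ G.Adj w b)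
    (hbc : G.Adj b c) :
    ∃ H : SimpleGraph V, MaxSub d H ∧ dg H w = dg G w + 1 ∧ dg H c + 1 = dg G c ∧
      ∀ z, z ≠ w → z ≠ c → dg H z = dg G z := by
  have hcw : c ≠ w := by rintro rfl; exact h1 hbc.symm
  have ha : ¬ (delE G b c).Adj w b := fun h => h1 h.1
  have hdg : ∀ v, dg (addE (delE G b c) w b) v + (if v = c then 1 else 0) =
      dg G v + if v = w then 1 else 0 := by
    intro v
    have h4 := dg_delE G hbc v
    have := hbc.ne
    rw [dg_addE _ hbw.symm ha]
    split_ifs at * <;> grind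
  have hsum : ∑ v, dg (addE (delE G b c) w b) v = ∑ v, dg G v := by
    rw [sum_addE _ hbw.symm ha, ← sum_delE G hbc]
  refine ⟨addE (delE G b c) w b, ⟨?_, ?_⟩, ?_, ?_, ?_⟩
  · intro v
    have h3 := hG.1 v
    have h4 := hdg v
    split_ifs at * <;> grind
  · intro H hH
    rw [hsum]
    exact hG.2 H hH
  · have := hdg w
    simpa [hcw.symm] using this
  · have := hdg c
    simpa [hcw] using this
  · intro z hz hz'
    have := hdg z
    simpa [hz, hz'] using this

/-- closed neighbourhood -/
noncomputable def cn (G : SimpleGraph V) (x : V) : Finset V := insert x (nb G x)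

theorem card_cn (G : SimpleGraph V) (x : V) : (cn G x).card = dg G x + 1 := by
  rw [cn, card_insert_of_notMem (by simp [mem_nb]), card_nb]

theorem mem_cn (G : SimpleGraph V) (x y : V) : y ∈ cn G x ↔ y = x ∨ G.Adj x y := by
  simp [cn, mem_nb]

theorem notdef (hG : MaxSub d G) {u x : V} (hu : dg G u < d u) (hx : x ∉ cn G u) : dg G x = d x := by
  rw [mem_cn] at hx
  push Not at hx
  have := hG.1 x
  by_contra h
  exact hx.2 (F1 hG hu (by omega) hx.1.symm)

theorem C1 (hG : MaxSub d G) {q : ℕ} (h2 : q + 1 ≤ (univ.filter (fun v => q ≤ d v + 1)).card)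
    {u : V} (huq : d u ≤ q) (hu : dg G u + 2 ≤ d u) : False := by
  obtain ⟨x, hx, hxn⟩ : ∃ x ∈ univ.filter (fun v => q ≤ d v + 1), x ∉ cn G u := by
    apply exists_mem_notMem_of_card_lt_card
    rw [card_cn]; omega
  have hdx := notdef hG (by omega) hxn
  rw [mem_cn] at hxn
  push Not at hxn
  simp only [mem_filter, mem_univ, true_and] at hx
  obtain ⟨y, hy, hyn⟩ : ∃ y ∈ nb G x, y ∉ nb G u := by
    apply exists_mem_notMem_of_card_lt_card
    rw [card_nb, card_nb]; omega
  rw [mem_nb] at hy hyn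
  exact F2 hG hu hy hxn.1 (by rintro rfl; exact hxn.2 hy.symm) hxn.2 hyn

theorem C2a (hG : MaxSub d G) {u w x : V} (hu : dg G u < d u) (hw : dg G w < d w) (huw : u ≠ w)
    (hx : x ∉ cn G u) : nb G x ⊆ (cn G w).erase u := by
  intro y hy
  rw [mem_nb] at hy
  rw [mem_cn] at hx
  push Not at hx
  rw [mem_erase, mem_cn]
  refine ⟨by rintro rfl; exact hx.2 hy.symm, ?_⟩
  by_contra h
  push Not at h
  exact F3 hG hu hw huw hy hx.1 h.1 hx.2 h.2

theorem C2b (hG : MaxSub d G) {u w : V} (hu : dg G u < d u) (hw : dg G w < d w) (huw : u ≠ w)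
    {q : ℕ} (h1 : q ≤ (univ.filter (fun v => q ≤ d v)).card)
    (huq : d u ≤ q) (hwq : d w ≤ q) : cn G u = univ.filter (fun v => q ≤ d v) := by
  symm
  apply eq_of_subset_of_card_le
  · intro x hx
    simp only [mem_filter, mem_univ, true_and] at hx
    by_contra hxn
    have h3 := card_le_card (C2a hG hu hw huw hxn)
    have hm : u ∈ cn G w := by rw [mem_cn]; right; exact F1 hG hw hu huw.symm
    rw [card_erase_of_mem hm, card_cn, card_nb, notdef hG hu hxn] at h3
    omega
  · rw [card_cn]; omega

theorem C2 (hG : MaxSub d G) {u w : V} (hu : dg G u < d u) (hw : dg G w < d w) (huw : u ≠ w)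
    {q : ℕ} (h1 : q ≤ (univ.filter (fun v => q ≤ d v)).card)
    (h2 : q + 1 ≤ (univ.filter (fun v => q ≤ d v + 1)).card)
    (huq : d u ≤ q) (hwq : d w ≤ q) : False := by
  have e1 := C2b hG hu hw huw h1 huq hwq
  have e2 := C2b hG hw hu huw.symm h1 hwq huq
  obtain ⟨x, hx, hxn⟩ : ∃ x ∈ univ.filter (fun v => q ≤ d v + 1), x ∉ cn G u := by
    apply exists_mem_notMem_of_card_lt_card
    rw [card_cn]; omega
  simp only [mem_filter, mem_univ, true_and] at hx
  have hxw : x ∉ cn G w := by rw [e2, ← e1]; exact hxn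
  have h3 : nb G x ⊆ ((cn G w).erase u).erase w := by
    intro y hy
    rw [mem_erase]
    refine ⟨?_, C2a hG hu hw huw hxn hy⟩
    rintro rfl
    rw [mem_nb] at hy
    rw [mem_cn] at hxw
    exact hxw (Or.inr hy.symm)
  have hm : u ∈ cn G w := by rw [mem_cn]; right; exact F1 hG hw hu huw.symm
  have hm' : w ∈ (cn G w).erase u := by rw [mem_erase, mem_cn]; exact ⟨huw.symm, Or.inl rfl⟩
  have h4 := card_le_card h3
  have h5 := card_pos.2 ⟨_, hm'⟩
  rw [card_erase_of_mem hm] at h5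
  rw [card_erase_of_mem hm', card_erase_of_mem hm, card_nb, notdef hG hu hxn] at h4
  rw [card_cn] at h4 h5
  omega

theorem Mbig (hG : MaxSub d G) {U T : Finset V} (hUT : ∀ v ∈ U, T.card ≤ d v)
    (hT : ∀ v ∈ T, d v + 1 ≤ U.card) {w : V} (hwT : w ∈ T) (hw : dg G w < d w) :
    ∃ c, c ∉ T ∧ (∃ H : SimpleGraph V, MaxSub d H ∧ dg H w = dg G w + 1 ∧ dg H c + 1 = dg G c ∧
      ∀ z, z ≠ w → z ≠ c → dg H z = dg G z) := by
  obtain ⟨b, hb, hbn⟩ : ∃ x ∈ U, x ∉ cn G w := by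
    apply exists_mem_notMem_of_card_lt_card
    rw [card_cn]
    have := hT w hwT
    omega
  have hdb := notdef hG hw hbn
  rw [mem_cn] at hbn
  push Not at hbn
  obtain ⟨c, hc, hcn⟩ : ∃ c ∈ nb G b, c ∉ T.erase w := by
    apply exists_mem_notMem_of_card_lt_card
    rw [card_nb, hdb, card_erase_of_mem hwT]
    have := hUT b hb
    have := card_pos.2 ⟨_, hwT⟩
    omega
  rw [mem_nb] at hc
  refine ⟨c, ?_, M1 hG hw hbn.1 hbn.2 hc⟩
  intro hcT
  apply hcn
  rw [mem_erase]
  refine ⟨?_, hcT⟩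
  rintro rfl
  exact hbn.2 hc.symm

theorem graphic_of_heavy (d : V → ℕ) (U T : Finset V) (q : ℕ)
    (hUT : ∀ v ∈ U, T.card ≤ d v)
    (hT : ∀ v ∈ T, d v + 1 ≤ U.card) (hq : ∀ v, v ∉ T → d v ≤ q)
    (h1 : q ≤ (univ.filter (fun v => q ≤ d v)).card)
    (h2 : q + 1 ≤ (univ.filter (fun v => q ≤ d v + 1)).card)
    (hev : Even (∑ v, d v)) : ∃ G : SimpleGraph V, ∀ v, dg G v = d v := by
  -- claim 3
  have c3 : ∀ G : SimpleGraph V, MaxSub d G → ∀ u w, u ∉ T → w ∈ T → dg G u < d u →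
      dg G w < d w → False := by
    intro G hG u w hu hw hdu hdw
    obtain ⟨c, hc, H, hH, e1, e2, e3⟩ := Mbig hG hUT hT hw hdw
    have huw : u ≠ w := by rintro rfl; exact hu hw
    have hb := hG.1 c
    by_cases hcu : c = u
    · subst hcu
      exact C1 hH h2 (hq _ hu) (by omega)
    · exact C2 hH (u := u) (w := c) (by rw [e3 u huw (Ne.symm hcu)]; exact hdu) (by omega)
        (Ne.symm hcu) h1 h2 (hq _ hu) (hq _ hc)
  have c4 : ∀ G : SimpleGraph V, MaxSub d G → ∀ w, dg G w + 2 ≤ d w → False := by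
    intro G hG w hdw
    by_cases hw : w ∈ T
    · obtain ⟨c, hc, H, hH, e1, e2, e3⟩ := Mbig hG hUT hT hw (by omega)
      have hb := hG.1 c
      exact c3 H hH c w hc hw (by omega) (by omega)
    · exact C1 hG h2 (hq _ hw) hdw
  have c5 : ∀ G : SimpleGraph V, MaxSub d G → ∀ u w, u ≠ w → dg G u < d u →
      dg G w < d w → False := by
    intro G hG u w huw hdu hdw
    by_cases hw : w ∈ T
    · by_cases hu : u ∈ T
      · obtain ⟨c, hc, H, hH, e1, e2, e3⟩ := Mbig hG hUT hT hw (by omega)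
        have hb := hG.1 c
        refine c3 H hH c u hc hu (by omega) ?_
        rw [e3 u huw (by rintro rfl; exact hc hu)]
        exact hdu
      · exact c3 G hG u w hu hw hdu hdw
    · by_cases hu : u ∈ T
      · exact c3 G hG w u hw hu hdw hdu
      · exact C2 hG hdu hdw huw h1 h2 (hq _ hu) (hq _ hw)
  obtain ⟨G, hG⟩ := exists_maxSub d
  refine ⟨G, ?_⟩
  by_contra hne
  push Not at hne
  obtain ⟨u, hu⟩ := hne
  have hu1 : dg G u < d u := lt_of_le_of_ne (hG.1 u) hu
  have hu2 : d u = dg G u + 1 := by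
    by_contra h
    exact c4 G hG u (by omega)
  have hall : ∀ v, d v = dg G v + if v = u then 1 else 0 := by
    intro v
    split_ifs with h
    · rw [h, hu2]
    · by_contra h'
      have := hG.1 v
      exact c5 G hG v u h (by omega) hu1
  have hs : ∑ v, d v = ∑ v, dg G v + 1 := by
    rw [sum_congr rfl (fun v _ => hall v), sum_add_distrib]
    simp
  have := even_sum_dg G
  rw [hs] at hev
  exact (Nat.even_add_one.1 hev) this

end L29

section L29
open Finset Classical

variable {V : Type*}

/-- `c 0, …, c (ℓ-1)` is a cycle. -/
structure Cyc (G : SimpleGraph V) (l : ℕ) (c : ℕ → V) : Prop where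
  inj : ∀ i j, i < l → j < l → c i = c j → i = j
  adj : ∀ i, i + 1 < l → G.Adj (c i) (c (i + 1))
  last : G.Adj (c (l - 1)) (c 0)

theorem Cyc.mono {G H : SimpleGraph V} {l : ℕ} {c : ℕ → V} (h : Cyc G l c)
    (hGH : ∀ a b, G.Adj a b → H.Adj a b) : Cyc H l c :=
  ⟨h.inj, fun i hi => hGH _ _ (h.adj i hi), hGH _ _ h.last⟩

theorem Cyc.rot {G : SimpleGraph V} {l : ℕ} {c : ℕ → V} (h : Cyc G l c) (s : ℕ) (hs : s < l) :
    Cyc G l (fun i => c (if i + s < l then i + s else i + s - l)) := by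
  refine ⟨?_, ?_, ?_⟩
  · intro i j hi hj hij
    have := h.inj _ _ (by split_ifs <;> omega) (by split_ifs <;> omega) hij
    split_ifs at this <;> omega
  · intro i hi
    by_cases h1 : i + 1 + s < l
    · have := h.adj (i + s) (by omega)
      rw [if_pos (by omega), if_pos h1]
      convert this using 2 <;> omega
    · rw [if_neg h1]
      by_cases h2 : i + s < l
      · rw [if_pos h2]
        have := h.last
        convert this using 2 <;> omega
      · rw [if_neg h2]
        have := h.adj (i + s - l) (by omega)
        convert this using 2; omega
  · rw [if_pos (show 0 + s < l by omega)]
    by_cases h1 : l - 1 + s < l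
    · rw [if_pos h1]
      have : s = 0 := by omega
      subst this
      exact h.last
    · rw [if_neg h1]
      have := h.adj (s - 1) (by omega)
      convert this using 2 <;> omega

theorem Cyc.refl {G : SimpleGraph V} {l : ℕ} {c : ℕ → V} (h : Cyc G l c) (hl : 0 < l) :
    Cyc G l (fun i => c (l - 1 - i)) := by
  refine ⟨?_, ?_, ?_⟩
  · intro i j hi hj hij
    have := h.inj _ _ (by omega) (by omega) hij
    omega
  · intro i hi
    have := (h.adj (l - 1 - (i + 1)) (by omega)).symm
    convert this using 2; omega
  · have := h.last.symm
    convert this using 2 <;> omega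

/-- number of chords-or-edges from `x` to the cycle -/
noncomputable def cdeg (G : SimpleGraph V) (l : ℕ) (c : ℕ → V) (x : V) : ℕ :=
  ((range l).filter (fun j => G.Adj x (c j))).card

/-- the structure produced by the induction -/
def PP (G : SimpleGraph V) (l : ℕ) : Prop :=
  ∃ c, Cyc G l c ∧ l + 1 ≤ cdeg G l c (c 0) + cdeg G l c (c (l - 1))

theorem bondy {G : SimpleGraph V} {l : ℕ} (h : PP G l) (r : ℕ) (hr : 3 ≤ r) (hrl : r ≤ l) :
    ∃ c, Cyc G r c := by
  obtain ⟨c, hc, hd⟩ := h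
  rcases eq_or_lt_of_le hrl with rfl | hrl
  · exact ⟨c, hc⟩
  set A := ((range l).filter (fun j => G.Adj (c 0) (c j))).erase (l - 1) with hA
  set B := ((range l).filter (fun j => G.Adj (c (l - 1)) (c j))).erase 0 with hB
  have hA1 : A.card + 1 = cdeg G l c (c 0) := by
    rw [hA, card_erase_add_one]
    · rfl
    · simp only [mem_filter, mem_range]
      exact ⟨by omega, hc.last.symm⟩
  have hB1 : B.card + 1 = cdeg G l c (c (l - 1)) := by
    rw [hB, card_erase_add_one]
    · rfl
    · simp only [mem_filter, mem_range]
      exact ⟨by omega, hc.last⟩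
  have hAm : ∀ j ∈ A, 1 ≤ j ∧ j ≤ l - 2 ∧ G.Adj (c 0) (c j) := by
    intro j hj
    simp only [hA, mem_erase, mem_filter, mem_range] at hj
    have : j ≠ 0 := by rintro rfl; exact G.loopless.irrefl _ hj.2.2
    exact ⟨by omega, by omega, hj.2.2⟩
  have hBm : ∀ j ∈ B, 1 ≤ j ∧ j ≤ l - 2 ∧ G.Adj (c (l - 1)) (c j) := by
    intro j hj
    simp only [hB, mem_erase, mem_filter, mem_range] at hj
    have : j ≠ l - 1 := by rintro rfl; exact G.loopless.irrefl _ hj.2.2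
    exact ⟨by omega, by omega, hj.2.2⟩
  set f : ℕ → ℕ := fun j => if j ≤ l + 1 - r then j + r - 3 else j - (l + 1 - r) with hf
  have hfinj : Set.InjOn f A := by
    intro i hi j hj hij
    have h1 := hAm i hi
    have h2 := hAm j hj
    simp only [hf] at hij
    split_ifs at hij <;> omega
  have hnd : ¬ Disjoint (A.image f) B := by
    intro hdis
    have hsub : A.image f ∪ B ⊆ Icc 1 (l - 2) := by
      intro j hj
      rw [mem_union, mem_image] at hj
      rw [mem_Icc]
      rcases hj with ⟨i, hi, rfl⟩ | hj
      · have h1 := hAm i hi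
        simp only [hf]
        split_ifs <;> omega
      · have := hBm j hj
        omega
    have h3 := card_le_card hsub
    rw [card_union_of_disjoint hdis, card_image_of_injOn hfinj, Nat.card_Icc] at h3
    omega
  rw [not_disjoint_iff] at hnd
  obtain ⟨j', hj1, hj2⟩ := hnd
  rw [mem_image] at hj1
  obtain ⟨j, hj, hjj⟩ := hj1
  have ha := hAm j hj
  have hb := hBm j' hj2
  simp only [hf] at hjj
  split_ifs at hjj with hcase
  · refine ⟨fun i => c (if i = 0 then 0 else if i = r - 1 then l - 1 else j + i - 1), ?_, ?_, ?_⟩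
    · intro i i' hi hi' h
      have := hc.inj _ _ (by split_ifs <;> omega) (by split_ifs <;> omega) h
      split_ifs at this <;> omega
    · intro i hi
      rw [if_neg (by omega : ¬ (i + 1 = 0))]
      by_cases h0 : i = 0
      · rw [if_pos h0, if_neg (by omega)]
        convert ha.2.2 using 2
        omega
      · rw [if_neg h0, if_neg (by omega)]
        by_cases h1 : i + 1 = r - 1
        · rw [if_pos h1]
          convert hb.2.2.symm using 2
          omega
        · rw [if_neg h1]
          convert hc.adj (j + i - 1) (by omega) using 2
          omega
    · rw [if_neg (by omega), if_pos rfl, if_pos rfl]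
      exact hc.last
  · refine ⟨fun i => c (if i ≤ j' then i else l + j' - i), ?_, ?_, ?_⟩
    · intro i i' hi hi' h
      have := hc.inj _ _ (by split_ifs <;> omega) (by split_ifs <;> omega) h
      split_ifs at this <;> omega
    · intro i hi
      by_cases h0 : i + 1 ≤ j'
      · rw [if_pos h0, if_pos (by omega)]
        exact hc.adj i (by omega)
      · rw [if_neg h0]
        by_cases h1 : i ≤ j'
        · rw [if_pos h1]
          convert hb.2.2.symm using 2 <;> omega
        · rw [if_neg h1]
          convert (hc.adj (l + j' - (i + 1)) (by omega)).symm using 2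
          omega
    · rw [if_neg (by omega), if_pos (by omega)]
      convert ha.2.2.symm using 2
      omega

theorem hasCycle_of_Cyc {n : ℕ} {G : SimpleGraph (Fin n)} {r : ℕ} (hr : 3 ≤ r) {c : ℕ → Fin n}
    (hc : Cyc G r c) : ∃ (v : Fin n) (w : G.Walk v v), w.IsCycle ∧ w.length = r := by
  have key : ∀ k, k < r → ∃ p : G.Walk (c k) (c 0), p.IsPath ∧ p.length = k ∧
      ∀ x ∈ p.support, ∃ i ≤ k, x = c i := by
    intro k
    induction k with
    | zero =>
      intro _
      exact ⟨SimpleGraph.Walk.nil, by simp, rfl, by simp⟩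
    | succ k ih =>
      intro hk
      obtain ⟨p, hp, hl, hs⟩ := ih (by omega)
      refine ⟨SimpleGraph.Walk.cons (hc.adj k hk).symm p, ?_, by simp [hl], ?_⟩
      · rw [SimpleGraph.Walk.cons_isPath_iff]
        refine ⟨hp, ?_⟩
        intro h
        obtain ⟨i, hi, hh⟩ := hs _ h
        have := hc.inj _ _ hk (by omega) hh
        omega
      · intro x hx
        rw [SimpleGraph.Walk.support_cons, List.mem_cons] at hx
        rcases hx with rfl | hx
        · exact ⟨k + 1, le_rfl, rfl⟩
        · obtain ⟨i, hi, hh⟩ := hs _ hx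
          exact ⟨i, by omega, hh⟩
  obtain ⟨p, hp, hl, hs⟩ := key (r - 1) (by omega)
  refine ⟨c 0, SimpleGraph.Walk.cons hc.last.symm p, ?_, by simp [hl]; omega⟩
  rw [SimpleGraph.Walk.isCycle_iff_isPath_tail_and_le_length]
  refine ⟨by simpa using hp, by simp [hl]; omega⟩
end L29

section L29
open Finset Classical

set_option linter.unusedSectionVars false
set_option linter.unnecessarySeqFocus false
variable {V : Type*} [Fintype V]

/-- number of vertices with value at least `j` -/
noncomputable def cnt (d : V → ℕ) (j : ℕ) : ℕ := (univ.filter (fun v => j ≤ d v)).card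

/-- relaxed condition -/
def Rlx (m : ℕ) (d : V → ℕ) : Prop :=
  (∀ j, 2 ≤ j → j ≤ m → 2 * m + 3 ≤ cnt d j + j) ∧ m + 1 ≤ cnt d (m + 1)

theorem cnt_mono {d d' : V → ℕ} (h : ∀ v, d v ≤ d' v) (j : ℕ) : cnt d j ≤ cnt d' j := by
  apply card_le_card
  intro v hv
  simp only [mem_filter, mem_univ, true_and] at *
  exact hv.trans (h v)

theorem Rlx.mono {m : ℕ} {d d' : V → ℕ} (h : ∀ v, d v ≤ d' v) (hr : Rlx m d) : Rlx m d' :=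
  ⟨fun j h2 hm => (hr.1 j h2 hm).trans (by have := cnt_mono h j; omega), hr.2.trans (cnt_mono h _)⟩

theorem cnt_compl {d : V → ℕ} {U W : Finset V} {j : ℕ} (hU : ∀ v, v ∉ U → d v < j)
    (hWU : W ⊆ U) (hW : ∀ v ∈ W, d v < j) : cnt d j + W.card ≤ U.card := by
  rw [cnt, ← card_union_of_disjoint]
  · apply card_le_card
    intro v hv
    rw [mem_union] at hv
    rcases hv with hv | hv
    · simp only [mem_filter, mem_univ, true_and] at hv
      by_contra h
      have := hU v h
      omega
    · exact hWU hv
  · rw [Finset.disjoint_left]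
    intro v hv hv'
    simp only [mem_filter, mem_univ, true_and] at hv
    have := hW v hv'
    omega

/-- Hamiltonian cycle with prescribed consecutive pair at its ends. -/
theorem Cyc.cut {G : SimpleGraph V} {u v : V} {l : ℕ} (hl : 3 ≤ l) {c : ℕ → V}
    (hc : Cyc (addE G u v) l c) (hno : ¬ Cyc G l c) :
    ∃ c', Cyc (addE G u v) l c' ∧ c' 0 = u ∧ c' (l - 1) = v ∧
      (∀ i, i + 1 < l → G.Adj (c' i) (c' (i + 1))) ∧ ∀ i < l, ∃ j < l, c' i = c j := by
  have h1 : ∃ c', Cyc (addE G u v) l c' ∧ ((c' 0 = u ∧ c' (l - 1) = v) ∨ (c' 0 = v ∧ c' (l - 1) = u))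
      ∧ ∀ i < l, ∃ j < l, c' i = c j := by
    by_cases hlast : G.Adj (c (l - 1)) (c 0)
    · have : ∃ i, i + 1 < l ∧ ¬ G.Adj (c i) (c (i + 1)) := by
        by_contra h
        push Not at h
        exact hno ⟨hc.inj, h, hlast⟩
      obtain ⟨i, hi, hn⟩ := this
      refine ⟨_, hc.rot (i + 1) hi, ?_, ?_⟩
      · have h2 := hc.adj i hi
        rw [addE_adj] at h2
        rw [if_pos (by omega), if_neg (by omega)]
        have e1 : 0 + (i + 1) = i + 1 := by omega
        have e2 : l - 1 + (i + 1) - l = i := by omega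
        rw [e1, e2]
        tauto
      · intro k hk
        exact ⟨_, by split_ifs <;> omega, rfl⟩
    · refine ⟨c, hc, ?_, fun i hi => ⟨i, hi, rfl⟩⟩
      have h2 := hc.last
      rw [addE_adj] at h2
      tauto
  have h2 : ∃ c', Cyc (addE G u v) l c' ∧ (c' 0 = u ∧ c' (l - 1) = v)
      ∧ ∀ i < l, ∃ j < l, c' i = c j := by
    obtain ⟨c', hc', h | h, hr⟩ := h1
    · exact ⟨c', hc', h, hr⟩
    · refine ⟨_, hc'.refl (by omega), ⟨by simpa using h.2, by simpa using h.1⟩, ?_⟩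
      intro i hi
      exact hr _ (by omega)
  obtain ⟨c', hc', ⟨h0, hl'⟩, hr⟩ := h2
  refine ⟨c', hc', h0, hl', ?_, hr⟩
  intro i hi
  have h3 := hc'.adj i hi
  rw [addE_adj] at h3
  rcases h3 with h3 | ⟨_, ⟨ha, hb⟩ | ⟨ha, hb⟩⟩
  · exact h3
  · rw [← h0] at ha
    rw [← hl'] at hb
    have := hc'.inj _ _ (by omega) (by omega) ha
    have := hc'.inj _ _ (by omega) (by omega) hb
    omega
  · rw [← hl'] at ha
    rw [← h0] at hb
    have := hc'.inj _ _ (by omega) (by omega) ha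
    have := hc'.inj _ _ (by omega) (by omega) hb
    omega

theorem crossing {G : SimpleGraph V} {l : ℕ} {c : ℕ → V}
    (hinj : ∀ i j, i < l → j < l → c i = c j → i = j)
    (hadj : ∀ i, i + 1 < l → G.Adj (c i) (c (i + 1))) {j : ℕ} (hj : j + 1 < l)
    (h1 : G.Adj (c 0) (c (j + 1))) (h2 : G.Adj (c (l - 1)) (c j)) :
    Cyc G l (fun i => c (if i ≤ j then i else l + j - i)) := by
  refine ⟨?_, ?_, ?_⟩
  · intro i i' hi hi' h
    have := hinj _ _ (by split_ifs <;> omega) (by split_ifs <;> omega) h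
    split_ifs at this <;> omega
  · intro i hi
    by_cases h0 : i + 1 ≤ j
    · rw [if_pos h0, if_pos (by omega)]
      exact hadj i (by omega)
    · rw [if_neg h0]
      by_cases h1 : i ≤ j
      · rw [if_pos h1]
        convert h2.symm using 2 <;> omega
      · rw [if_neg h1]
        convert (hadj (l + j - (i + 1)) (by omega)).symm using 2
        omega
  · rw [if_neg (by omega), if_pos (by omega)]
    convert h1.symm using 2
    omega

theorem exists_enum (U : Finset V) (hU : U.Nonempty) : ∃ c : ℕ → V, (∀ i, i < U.card → c i ∈ U) ∧
    (∀ i j, i < U.card → j < U.card → c i = c j → i = j) := by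
  obtain ⟨x, hx⟩ := hU
  refine ⟨fun i => if h : i < U.card then (U.equivFin.symm ⟨i, h⟩ : V) else x, ?_, ?_⟩
  · intro i hi
    simp [hi]
  · intro i j hi hj h
    simp only [hi, hj, dif_pos] at h
    have := U.equivFin.symm.injective (Subtype.ext h)
    simpa using this

theorem surj_of_inj {U : Finset V} {c : ℕ → V} {l : ℕ} (hl : U.card = l) (hcU : ∀ i, i < l → c i ∈ U)
    (hinj : ∀ i j, i < l → j < l → c i = c j → i = j) : (range l).image c = U := by
  apply eq_of_subset_of_card_le
  · intro x hx
    rw [mem_image] at hx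
    obtain ⟨i, hi, rfl⟩ := hx
    exact hcU i (by simpa using hi)
  · rw [card_image_of_injOn, card_range, hl]
    intro i hi j hj h
    exact hinj i j (by simpa using hi) (by simpa using hj) h

theorem chvatal {m : ℕ} (hm : 2 ≤ m) (U : Finset V) (hU : U.card = 2 * m + 1) (G : SimpleGraph V)
    (hGU : ∀ a b, G.Adj a b → a ∈ U) (hR : Rlx m (dg G)) :
    ∃ c, Cyc G (2 * m + 1) c ∧ ∀ i < 2 * m + 1, c i ∈ U := by
  by_contra hno
  have hf : Set.Finite {H : SimpleGraph V | (∀ a b, H.Adj a b → a ∈ U) ∧ Rlx m (dg H) ∧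
    ¬ ∃ c, Cyc H (2 * m + 1) c ∧ ∀ i < 2 * m + 1, c i ∈ U} := Set.toFinite _
  obtain ⟨H, ⟨hHU, hHR, hHn⟩, hmax⟩ := Set.exists_max_image _ (fun G => ∑ v, dg G v) hf
    ⟨G, hGU, hR, hno⟩
  clear hno hf
  -- a nonadjacent pair
  have hne : ((U ×ˢ U).filter (fun p => p.1 ≠ p.2 ∧ ¬ H.Adj p.1 p.2)).Nonempty := by
    by_contra hcon
    rw [not_nonempty_iff_eq_empty, filter_eq_empty_iff] at hcon
    have hcomp : ∀ x ∈ U, ∀ y ∈ U, x ≠ y → H.Adj x y := by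
      intro x hx y hy hxy
      have := hcon (x := (x, y)) (by simp [hx, hy])
      by_contra h
      exact this ⟨hxy, h⟩
    obtain ⟨c, h1, h2⟩ := exists_enum U (card_pos.1 (by omega))
    rw [hU] at h1 h2
    refine hHn ⟨c, ⟨h2, ?_, ?_⟩, h1⟩
    · intro i hi
      refine hcomp _ (h1 _ (by omega)) _ (h1 _ hi) ?_
      intro h
      have := h2 _ _ (by omega) hi h
      omega
    · refine hcomp _ (h1 _ (by omega)) _ (h1 _ (by omega)) ?_
      intro h
      have := h2 _ _ (by omega) (by omega) h
      omega
  obtain ⟨⟨u0, v0⟩, huv0, hmx⟩ := exists_max_image _ (fun p => dg H p.1 + dg H p.2) hne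
  simp only [mem_filter, mem_product] at huv0 hmx
  have hwlog : ∃ u v, u ∈ U ∧ v ∈ U ∧ u ≠ v ∧ ¬ H.Adj u v ∧ dg H u ≤ dg H v ∧
      ∀ x y, x ∈ U → y ∈ U → x ≠ y → ¬ H.Adj x y → dg H x + dg H y ≤ dg H u + dg H v := by
    rcases le_total (dg H u0) (dg H v0) with h | h
    · exact ⟨u0, v0, huv0.1.1, huv0.1.2, huv0.2.1, huv0.2.2, h,
        fun x y hx hy hxy hn => hmx (x, y) ⟨⟨hx, hy⟩, hxy, hn⟩⟩
    · exact ⟨v0, u0, huv0.1.2, huv0.1.1, huv0.2.1.symm, fun k => huv0.2.2 k.symm, h,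
        fun x y hx hy hxy hn => by
          have := hmx (x, y) ⟨⟨hx, hy⟩, hxy, hn⟩
          dsimp only at this
          omega⟩
  obtain ⟨u, v, hu, hv, huv, hnuv, hle, hsum⟩ := hwlog
  have hham : ∃ c, Cyc (addE H u v) (2 * m + 1) c ∧ ∀ i < 2 * m + 1, c i ∈ U := by
    by_contra hcon
    have := hmax (addE H u v) ⟨?_, ?_, hcon⟩
    · have h2 := sum_addE H huv hnuv
      omega
    · intro a b hab
      rw [addE_adj] at hab
      rcases hab with hab | ⟨_, ⟨rfl, _⟩ | ⟨rfl, _⟩⟩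
      · exact hHU a b hab
      · exact hu
      · exact hv
    · refine hHR.mono ?_
      intro z
      rw [dg_addE H huv hnuv]
      omega
  obtain ⟨c0, hc0, hc0U⟩ := hham
  obtain ⟨c, hc, hcu, hcv, hpath, hcr⟩ := hc0.cut (by omega) (fun h => hHn ⟨c0, h, hc0U⟩)
  have hcU : ∀ i, i < 2 * m + 1 → c i ∈ U := by
    intro i hi
    obtain ⟨j, hj, e⟩ := hcr i hi
    rw [e]
    exact hc0U j hj
  have hcs := surj_of_inj hU hcU hc.inj
  have hnb : ∀ x, nb H x ⊆ U := by
    intro x y hy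
    rw [mem_nb] at hy
    exact hHU _ _ hy.symm
  have hcross : ∀ j, j + 1 < 2 * m + 1 → H.Adj u (c (j + 1)) → ¬ H.Adj v (c j) := by
    intro j hj h1 h2
    refine hHn ⟨_, crossing hc.inj hpath hj (by rw [hcu]; exact h1) (by rw [hcv]; exact h2), ?_⟩
    intro i hi
    exact hcU _ (by split_ifs <;> omega)
  -- predecessors of neighbours of u
  set P := (range (2 * m)).filter (fun j => H.Adj u (c (j + 1))) with hP
  have hPc : P.card = dg H u := by
    rw [← card_nb]
    apply card_bij (fun j _ => c (j + 1))
    · intro j hj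
      simp only [hP, mem_filter] at hj
      rw [mem_nb]; exact hj.2
    · intro i hi j hj h
      simp only [hP, mem_filter, mem_range] at hi hj
      have := hc.inj _ _ (by omega) (by omega) h
      omega
    · intro y hy
      have hyU := hnb _ hy
      rw [← hcs, mem_image] at hyU
      obtain ⟨i, hi, rfl⟩ := hyU
      rw [mem_nb] at hy
      rw [mem_range] at hi
      have : i ≠ 0 := by rintro rfl; rw [hcu] at hy; exact H.loopless.irrefl _ hy
      obtain ⟨k, rfl⟩ := Nat.exists_eq_succ_of_ne_zero this
      refine ⟨k, ?_, rfl⟩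
      simp only [hP, mem_filter, mem_range]
      exact ⟨by omega, hy⟩
  have hPinj : Set.InjOn c P := by
    intro i hi j hj h
    simp only [hP, coe_filter, mem_range, Set.mem_ofPred_eq] at hi hj
    exact hc.inj _ _ (by omega) (by omega) h
  have hPv : ∀ x ∈ P.image c, x ≠ v ∧ ¬ H.Adj v x ∧ x ∈ U := by
    intro x hx
    rw [mem_image] at hx
    obtain ⟨j, hj, rfl⟩ := hx
    simp only [hP, mem_filter, mem_range] at hj
    refine ⟨?_, hcross j (by omega) hj.2, hcU _ (by omega)⟩
    intro h
    rw [← hcv] at h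
    have := hc.inj _ _ (by omega) (by omega) h
    omega
  have hPcard : (P.image c).card = dg H u := by rw [card_image_of_injOn hPinj, hPc]
  -- degree sum
  have hds : dg H u + dg H v ≤ 2 * m := by
    have hsub : P.image c ∪ nb H v ⊆ U.erase v := by
      intro x hx
      rw [mem_union] at hx
      rw [mem_erase]
      rcases hx with hx | hx
      · exact ⟨(hPv x hx).1, (hPv x hx).2.2⟩
      · refine ⟨?_, hnb _ hx⟩
        rintro rfl
        rw [mem_nb] at hx
        exact H.loopless.irrefl _ hx
    have hdis : Disjoint (P.image c) (nb H v) := by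
      rw [Finset.disjoint_left]
      intro x hx hx'
      rw [mem_nb] at hx'
      exact (hPv x hx).2.1 hx'
    have := card_le_card hsub
    rw [card_union_of_disjoint hdis, hPcard, card_nb, card_erase_of_mem hv, hU] at this
    omega
  have hout : ∀ x, x ∉ U → dg H x = 0 := by
    intro x hx
    rw [← card_nb, card_eq_zero, eq_empty_iff_forall_notMem]
    intro y hy
    rw [mem_nb] at hy
    exact hx (hHU _ _ hy)
  have hu2 : 2 ≤ dg H u := by
    by_contra h
    have h1 := cnt_compl (d := dg H) (U := U) (W := {u}) (j := 2) (fun x hx => by rw [hout x hx]; omega)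
      (by simpa using hu) (by intro x hx; rw [mem_singleton] at hx; subst hx; omega)
    have h2 := hHR.1 2 le_rfl hm
    rw [card_singleton] at h1
    omega
  by_cases hi : dg H u + 1 ≤ m
  · have h1 := cnt_compl (d := dg H) (U := U) (W := P.image c) (j := dg H u + 1)
      (fun x hx => by rw [hout x hx]; omega) (fun x hx => (hPv x hx).2.2) (by
        intro x hx
        have h3 := hPv x hx
        have := hsum v x hv h3.2.2 h3.1.symm h3.2.1
        omega)
    have h2 := hHR.1 (dg H u + 1) (by omega) hi
    omega
  · have hum : dg H u = m := by omega
    have h1 := cnt_compl (d := dg H) (U := U) (W := U \ nb H u) (j := m + 1)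
      (fun x hx => by rw [hout x hx]; omega) sdiff_subset (by
        intro x hx
        rw [mem_sdiff, mem_nb] at hx
        by_cases hxu : x = u
        · subst hxu; omega
        · have := hsum u x hu hx.1 (Ne.symm hxu) hx.2
          omega)
    rw [card_sdiff_of_subset (hnb u), card_nb] at h1
    have := hHR.2
    omega

theorem cdeg_eq {G : SimpleGraph V} {l : ℕ} {c : ℕ → V}
    (hinj : ∀ i j, i < l → j < l → c i = c j → i = j) (x : V)
    (hx : ∀ y, G.Adj x y → ∃ i < l, c i = y) : cdeg G l c x = dg G x := by
  rw [← card_nb]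
  apply card_bij (fun j _ => c j)
  · intro j hj
    simp only [mem_filter] at hj
    rw [mem_nb]; exact hj.2
  · intro i hi j hj h
    simp only [mem_filter, mem_range] at hi hj
    exact hinj _ _ (by omega) (by omega) h
  · intro y hy
    rw [mem_nb] at hy
    obtain ⟨i, hi, rfl⟩ := hx y hy
    exact ⟨i, by simp only [mem_filter, mem_range]; exact ⟨hi, hy⟩, rfl⟩

theorem base {m : ℕ} (hm : 2 ≤ m) (U : Finset V) (hU : U.card = 2 * m + 1) (G : SimpleGraph V)
    (hGU : ∀ v, v ∉ U → dg G v = 0) (hR : Rlx m (dg G)) : PP G (2 * m + 1) := by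
  have hGU' : ∀ a b, G.Adj a b → a ∈ U := by
    intro a b hab
    by_contra h
    have := hGU a h
    rw [← card_nb, card_eq_zero, eq_empty_iff_forall_notMem] at this
    exact this b (by rwa [mem_nb])
  obtain ⟨c, hc, hcU⟩ := chvatal hm U hU G hGU' hR
  have hcs := surj_of_inj hU hcU hc.inj
  set I := (range (2 * m + 1)).filter (fun i => m + 1 ≤ dg G (c i)) with hI
  have hIc : m + 1 ≤ I.card := by
    refine hR.2.trans ?_
    have : univ.filter (fun v => m + 1 ≤ dg G v) ⊆ I.image c := by
      intro x hx
      simp only [mem_filter, mem_univ, true_and] at hx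
      have hxU : x ∈ U := by
        by_contra h
        have := hGU x h
        omega
      rw [← hcs, mem_image] at hxU
      obtain ⟨i, hi, rfl⟩ := hxU
      exact mem_image_of_mem _ (by simp only [hI, mem_filter]; exact ⟨hi, hx⟩)
    exact (card_le_card this).trans card_image_le
  set f : ℕ → ℕ := fun i => if i + 1 < 2 * m + 1 then i + 1 else 0 with hfdef
  have hfi : Set.InjOn f I := by
    intro i hi j hj h
    simp only [hI, coe_filter, mem_range, Set.mem_ofPred_eq] at hi hj
    simp only [hfdef] at h
    split_ifs at h <;> omega
  have hnd : ¬ Disjoint I (I.image f) := by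
    intro hd
    have hsub : I ∪ I.image f ⊆ range (2 * m + 1) := by
      intro x hx
      rw [mem_union, mem_image] at hx
      rcases hx with hx | ⟨i, hi, rfl⟩
      · exact (mem_filter.1 hx).1
      · rw [mem_range]
        simp only [hfdef]
        split_ifs <;> omega
    have := card_le_card hsub
    rw [card_union_of_disjoint hd, card_image_of_injOn hfi, card_range] at this
    omega
  rw [not_disjoint_iff] at hnd
  obtain ⟨j, hj, hj'⟩ := hnd
  rw [mem_image] at hj'
  obtain ⟨i, hi, hij⟩ := hj'
  simp only [hI, mem_filter, mem_range] at hi hj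
  have hc' := hc.rot j hj.1
  refine ⟨_, hc', ?_⟩
  have hcr' := surj_of_inj (c := fun i => c (if i + j < 2 * m + 1 then i + j else i + j - (2 * m + 1)))
    hU (fun i hi => hcU _ (by split_ifs <;> omega)) hc'.inj
  have hall : ∀ x y, G.Adj x y → ∃ i < 2 * m + 1, 
      c (if i + j < 2 * m + 1 then i + j else i + j - (2 * m + 1)) = y := by
    intro x y hxy
    have hy := hGU' _ _ hxy.symm
    rw [← hcr', mem_image] at hy
    obtain ⟨i, hi, e⟩ := hy
    exact ⟨i, by simpa using hi, e⟩
  rw [cdeg_eq hc'.inj _ (hall _), cdeg_eq hc'.inj _ (hall _)]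
  have e1 : (if 0 + j < 2 * m + 1 then 0 + j else 0 + j - (2 * m + 1)) = j := by
    rw [if_pos (by omega)]; omega
  have e2 : (if 2 * m + 1 - 1 + j < 2 * m + 1 then 2 * m + 1 - 1 + j else
      2 * m + 1 - 1 + j - (2 * m + 1)) = i := by
    simp only [hfdef] at hij
    split_ifs at hij ⊢ <;> omega
  rw [e1, e2]
  omega

end L29

section L29
open Finset Classical
set_option linter.unusedSectionVars false
set_option linter.unnecessarySeqFocus false

variable {V : Type*} [Fintype V]

/-- strict condition -/
def Stc (m : ℕ) (d : V → ℕ) : Prop :=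
  ∀ j, 2 ≤ j → j ≤ m + 1 → 2 * m + 3 ≤ cnt d j + j

/-- support -/
noncomputable def spp (d : V → ℕ) : Finset V := univ.filter (fun v => 0 < d v)

/-- vertices of value at least `m+2` -/
noncomputable def TT (m : ℕ) (d : V → ℕ) : Finset V := univ.filter (fun v => m + 2 ≤ d v)

theorem mem_spp (d : V → ℕ) (x : V) : x ∈ spp d ↔ 0 < d x := by simp [spp]
theorem mem_TT (m : ℕ) (d : V → ℕ) (x : V) : x ∈ TT m d ↔ m + 2 ≤ d x := by simp [TT]

theorem Stc.rlx {m : ℕ} {d : V → ℕ} (h : Stc m d) (hm : 1 ≤ m) : Rlx m d :=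
  ⟨fun j h2 hj => h j h2 (by omega), by have := h (m + 1) (by omega) le_rfl; omega⟩

theorem Stc.card {m : ℕ} {d : V → ℕ} (h : Stc m d) (hm : 1 ≤ m) : 2 * m + 1 ≤ (spp d).card := by
  have h2 := h 2 le_rfl (by omega)
  have : cnt d 2 ≤ (spp d).card := by
    apply card_le_card
    intro x hx
    simp only [mem_filter, mem_univ, true_and] at hx
    rw [mem_spp]; omega
  omega

theorem PP.mono {G H : SimpleGraph V} {l : ℕ} (h : PP G l)
    (hGH : ∀ a b, G.Adj a b → H.Adj a b) : PP H l := by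
  obtain ⟨c, hc, hd⟩ := h
  have hcd : ∀ x, cdeg G l c x ≤ cdeg H l c x := by
    intro x
    apply card_le_card
    intro j hj
    simp only [mem_filter] at *
    exact ⟨hj.1, hGH _ _ hj.2⟩
  refine ⟨c, hc.mono hGH, ?_⟩
  have h1 := hcd (c 0)
  have h2 := hcd (c (l - 1))
  omega

theorem step {d d' : V → ℕ} {v : V} {A : Finset V} {l : ℕ} (hvA : v ∉ A) (hA : A.card = d v)
    (h0 : d' v = 0) (hd : ∀ z, z ≠ v → d z = d' z + if z ∈ A then 1 else 0)
    {G : SimpleGraph V} (hG : ∀ z, dg G z = d' z) (hP : PP G l) :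
    ∃ G : SimpleGraph V, (∀ z, dg G z = d z) ∧ PP G l := by
  obtain ⟨H, h1, h2, h3, h4⟩ := exists_star G v A hvA (by rw [hG, h0])
  refine ⟨H, ?_, hP.mono h1⟩
  intro z
  by_cases hz : z = v
  · subst hz; rw [h2, hA]
  · rw [h4 z hz, hd z hz, hG]

theorem sum_star {d d' : V → ℕ} {v : V} {A : Finset V} (hvA : v ∉ A)
    (h0 : d' v = 0) (hd : ∀ z, z ≠ v → d z = d' z + if z ∈ A then 1 else 0) :
    ∑ z, d z = ∑ z, d' z + (d v + A.card) := by
  have : ∀ z, d z = d' z + ((if z = v then d v else 0) + if z ∈ A then 1 else 0) := by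
    intro z
    by_cases hz : z = v
    · subst hz; simp [h0, hvA]
    · rw [hd z hz]; simp [hz]
  rw [sum_congr rfl (fun z _ => this z), sum_add_distrib, sum_add_distrib]
  simp

theorem lowest (d : V → ℕ) (S : Finset V) (a : ℕ) (ha : a ≤ S.card) :
    ∃ L ⊆ S, L.card = a ∧ ∀ l ∈ L, ∀ x ∈ S, x ∉ L → d l ≤ d x := by
  induction a with
  | zero => exact ⟨∅, by simp, by simp, by simp⟩
  | succ a ih =>
    obtain ⟨L, hL, hc, hlow⟩ := ih (by omega)
    have hne : (S \ L).Nonempty := by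
      rw [← card_pos, card_sdiff_of_subset hL]; omega
    obtain ⟨y, hy, hmin⟩ := exists_min_image (S \ L) d hne
    rw [mem_sdiff] at hy
    refine ⟨insert y L, ?_, ?_, ?_⟩
    · intro z hz
      rw [mem_insert] at hz
      rcases hz with rfl | hz
      · exact hy.1
      · exact hL hz
    · rw [card_insert_of_notMem hy.2, hc]
    · intro l hl x hx hxn
      rw [mem_insert, not_or] at hxn
      rw [mem_insert] at hl
      rcases hl with rfl | hl
      · exact hmin x (by rw [mem_sdiff]; exact ⟨hx, hxn.2⟩)
      · exact hlow l hl x hx hxn.2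

theorem persist {m : ℕ} {d d' : V → ℕ} {v : V} {L : Finset V} (hS : Stc m d)
    (hpos : 0 < d v) (hmin : ∀ x, 0 < d x → d v ≤ d x)
    (h1 : ∀ x, x ≠ v → d x ≤ d' x + 1)
    (h2 : ∀ x, x ≠ v → x ∉ L → d x ≤ m + 1 → d' x = d x)
    (hlow : ∀ l ∈ L, ∀ x ∈ spp d, x ≠ v → x ∉ L → d l ≤ d x)
    (hN : 2 * m + 2 ≤ (spp d).card)
    (hc : 2 * m + 3 + L.card + 1 ≤ (spp d).card + max (d v) 2) : Stc m d' := by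
  intro j hj2 hjm
  have key : ∀ x, x ≠ v → x ∉ L → j ≤ d x → j ≤ d' x := by
    intro x hx hxL hj
    by_cases h : d x ≤ m + 1
    · rw [h2 x hx hxL h]; exact hj
    · have := h1 x hx
      omega
  have hvS : v ∈ spp d := by rw [mem_spp]; exact hpos
  have hcv : ((spp d).erase v).card = (spp d).card - 1 := card_erase_of_mem hvS
  have hbig : (∀ x ∈ spp d, x ≠ v → x ∉ L → j ≤ d x) → (spp d).card ≤ cnt d' j + L.card + 1 := by
    intro hall
    have : ((spp d).erase v) \ L ⊆ univ.filter (fun x => j ≤ d' x) := by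
      intro x hx
      rw [mem_sdiff, mem_erase] at hx
      simp only [mem_filter, mem_univ, true_and]
      exact key x hx.1.1 hx.2 (hall x hx.1.2 hx.1.1 hx.2)
    have h3 := card_le_card this
    have h4 := le_card_sdiff L ((spp d).erase v)
    rw [cnt]
    omega
  rcases lt_trichotomy j (d v) with h | h | h
  · have : ((spp d).erase v) ⊆ univ.filter (fun x => j ≤ d' x) := by
      intro x hx
      rw [mem_erase, mem_spp] at hx
      simp only [mem_filter, mem_univ, true_and]
      have h3 := hmin x hx.2
      have h4 := h1 x hx.1
      omega
    have h3 := card_le_card this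
    rw [cnt]
    omega
  · have := hbig (by
      intro x hx _ _
      rw [mem_spp] at hx
      have := hmin x hx
      omega)
    omega
  · by_cases hex : ∃ l ∈ L, j ≤ d l
    · obtain ⟨l, hl, hjl⟩ := hex
      have := hbig (by
        intro x hx hxv hxL
        exact hjl.trans (hlow l hl x hx hxv hxL))
      omega
    · push Not at hex
      have h5 := hS j hj2 hjm
      have : cnt d j ≤ cnt d' j := by
        apply card_le_card
        intro x hx
        simp only [mem_filter, mem_univ, true_and] at hx ⊢
        refine key x ?_ ?_ hx
        · rintro rfl; omega
        · intro hxL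
          have := hex x hxL
          omega
      omega

theorem dg_lt_spp {G : SimpleGraph V} {d : V → ℕ} (hG : ∀ v, dg G v = d v) (x : V) (hx : 0 < d x) :
    d x + 1 ≤ (spp d).card := by
  have : cn G x ⊆ spp d := by
    intro y hy
    rw [mem_cn] at hy
    rw [mem_spp]
    rcases hy with rfl | hy
    · exact hx
    · rw [← hG, ← card_nb]
      exact card_pos.2 ⟨x, by rw [mem_nb]; exact hy.symm⟩
  have := card_le_card this
  rw [card_cn, hG] at this
  exact this

theorem graphic_red {m : ℕ} (hm : 2 ≤ m) {d d' : V → ℕ} {v : V} (hR : Rlx m d')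
    (hpos : 0 < d v) (hmin : ∀ x, 0 < d x → d v ≤ d x)
    (h0 : d' v = 0) (hle : ∀ x, d' x ≤ d x) (h1 : ∀ x, x ≠ v → d x ≤ d' x + 1)
    (ht : (TT m d).card < d v) (hkm : d v ≤ m + 1)
    (hT : ∀ x ∈ TT m d, d' x + 1 = d x)
    (hN : ∀ x, 0 < d x → d x + 1 ≤ (spp d).card)
    (hev : Even (∑ x, d' x)) : ∃ G : SimpleGraph V, ∀ x, dg G x = d' x := by
  have hvS : v ∈ spp d := by rw [mem_spp]; exact hpos
  refine graphic_of_heavy d' ((spp d).erase v) (TT m d) (m + 1) ?_ ?_ ?_ hR.2 ?_ hev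
  · intro x hx
    rw [mem_erase, mem_spp] at hx
    have h3 := hmin x hx.2
    have h4 := h1 x hx.1
    omega
  · intro x hx
    rw [hT x hx, card_erase_of_mem hvS]
    rw [mem_TT] at hx
    have := hN x (by omega)
    omega
  · intro x hx
    rw [mem_TT] at hx
    have := hle x
    omega
  · have h3 := hR.1 m hm le_rfl
    have : cnt d' m ≤ (univ.filter (fun v => m + 1 ≤ d' v + 1)).card := by
      apply card_le_card
      intro x hx
      simp only [mem_filter, mem_univ, true_and] at hx ⊢
      omega
    omega

theorem swap_case {m : ℕ} {d : V → ℕ} {v : V} (hkm : d v ≤ m + 1) (hpos : 0 < d v)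
    (hg : ∃ G : SimpleGraph V, ∀ x, dg G x = d x) (ht : d v ≤ (TT m d).card) :
    ∃ G : SimpleGraph V, (∀ x, dg G x = d x) ∧ nb G v ⊆ TT m d := by
  have hf : Set.Finite {H : SimpleGraph V | ∀ x, dg H x = d x} := Set.toFinite _
  obtain ⟨G, hG, hmax⟩ := Set.exists_max_image _ (fun G => (nb G v ∩ TT m d).card) hf hg
  have hG' : ∀ x, dg G x = d x := hG
  refine ⟨G, hG', ?_⟩
  by_contra hns
  rw [not_subset] at hns
  obtain ⟨x, hx, hxT⟩ := hns
  have hlt : (nb G v ∩ TT m d).card < d v := by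
    rw [← hG', ← card_nb]
    apply card_lt_card
    refine ⟨inter_subset_left, ?_⟩
    intro h
    exact hxT (mem_inter.1 (h hx)).2
  have : ∃ y ∈ TT m d, y ∉ nb G v := by
    by_contra h
    push Not at h
    have : TT m d ⊆ nb G v ∩ TT m d := fun y hy => mem_inter.2 ⟨h y hy, hy⟩
    have := card_le_card this
    omega
  obtain ⟨y, hyT, hyn⟩ := this
  rw [mem_TT] at hyT hxT
  rw [mem_nb] at hx hyn
  have hyv : y ≠ v := by rintro rfl; omega
  have hyx : y ≠ x := by rintro rfl; omega
  have : ∃ z, G.Adj y z ∧ z ≠ x ∧ ¬ G.Adj x z := by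
    by_contra h
    push Not at h
    have hsub : insert v (nb G y) ⊆ cn G x := by
      intro z hz
      rw [mem_insert, mem_nb] at hz
      rw [mem_cn]
      rcases hz with rfl | hz
      · exact Or.inr hx.symm
      · by_cases hzx : z = x
        · exact Or.inl hzx
        · exact Or.inr (h z hz hzx)
    have h3 := card_le_card hsub
    rw [card_insert_of_notMem (by rw [mem_nb]; exact fun h => hyn h.symm), card_cn, card_nb, hG', hG'] at h3
    omega
  obtain ⟨z, hyz, hzx, hxz⟩ := this
  have hzv : z ≠ v := by rintro rfl; exact hyn hyz.symm
  have hzy : z ≠ y := fun h => G.loopless.irrefl y (h ▸ hyz)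
  have hxv : x ≠ v := fun h => G.loopless.irrefl v (h ▸ hx)
  set G1 := delE G v x with hG1
  have a2 : G1.Adj y z := by rw [hG1, delE_adj]; exact ⟨hyz, by tauto⟩
  set G2 := delE G1 y z with hG2
  have a3 : ¬ G2.Adj v y := by rw [hG2, delE_adj, hG1, delE_adj]; tauto
  set G3 := addE G2 v y with hG3
  have a4 : ¬ G3.Adj x z := by
    rw [hG3, addE_adj, hG2, delE_adj, hG1, delE_adj]
    tauto
  have := hmax (addE G3 x z) (by
    show ∀ w, _
    intro w
    rw [← hG' w, dg_addE G3 hzx.symm a4, dg_addE G2 hyv.symm a3]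
    have e1 := dg_delE G hx w
    have e2 := dg_delE G1 a2 w
    rw [← hG1] at e1
    rw [← hG2] at e2
    split_ifs at * <;> first | omega | (exfalso; grind))
  have hlt2 : (nb G v ∩ TT m d).card < (nb (addE G3 x z) v ∩ TT m d).card := by
    apply card_lt_card
    refine ⟨?_, ?_⟩
    · intro w hw
      rw [mem_inter, mem_nb, mem_TT] at hw
      rw [mem_inter, mem_nb, mem_TT, addE_adj, hG3, addE_adj, hG2, delE_adj, hG1, delE_adj]
      have : w ≠ x := by rintro rfl; exact hxT hw.2
      refine ⟨Or.inl (Or.inl ⟨⟨hw.1, by tauto⟩, by tauto⟩), hw.2⟩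
    · intro h
      have : y ∈ nb G v ∩ TT m d := h (by
        rw [mem_inter, mem_nb, mem_TT, addE_adj, hG3, addE_adj]
        exact ⟨Or.inl (Or.inr ⟨hyv.symm, Or.inl ⟨rfl, rfl⟩⟩), hyT⟩)
      rw [mem_inter, mem_nb] at this
      exact hyn this.1
  omega
end L29

section L29
open Finset Classical
set_option linter.unusedSectionVars false
set_option linter.unnecessarySeqFocus false

variable {V : Type*} [Fintype V]

/-- the induction hypothesis for sequences of smaller support -/
def IHyp (m : ℕ) (d : V → ℕ) : Prop :=
  ∀ d' : V → ℕ, (spp d').card < (spp d).card → (∃ G : SimpleGraph V, ∀ x, dg G x = d' x) →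
    Stc m d' → ∃ G : SimpleGraph V, (∀ x, dg G x = d' x) ∧ PP G (2 * m + 1)

theorem spp_lt {d d' : V → ℕ} {v : V} (hpos : 0 < d v) (h0 : d' v = 0) (hle : ∀ x, d' x ≤ d x) :
    (spp d').card < (spp d).card := by
  apply card_lt_card
  refine ⟨?_, ?_⟩
  · intro x hx
    rw [mem_spp] at *
    exact hx.trans_le (hle x)
  · intro h
    have := h (show v ∈ spp d by rw [mem_spp]; exact hpos)
    rw [mem_spp] at this
    omega

theorem case1 {m : ℕ} {d : V → ℕ} {v : V} (hIH : IHyp m d) (hS : Stc m d)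
    (hpos : 0 < d v) (hmin : ∀ x, 0 < d x → d v ≤ d x)
    (hg : ∃ G : SimpleGraph V, ∀ x, dg G x = d x) (hN : 2 * m + 2 ≤ (spp d).card)
    (hk : m + 2 ≤ d v ∨ d v ≤ (TT m d).card) :
    ∃ G : SimpleGraph V, (∀ x, dg G x = d x) ∧ PP G (2 * m + 1) := by
  have h1 : ∃ G : SimpleGraph V, (∀ x, dg G x = d x) ∧ nb G v ⊆ TT m d := by
    by_cases hkm : d v ≤ m + 1
    · exact swap_case hkm hpos hg (by omega)
    · obtain ⟨G, hG⟩ := hg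
      refine ⟨G, hG, ?_⟩
      intro x hx
      rw [mem_nb] at hx
      rw [mem_TT]
      have : 0 < d x := by
        rw [← hG, ← card_nb]
        exact card_pos.2 ⟨v, by rw [mem_nb]; exact hx.symm⟩
      have := hmin x this
      omega
  obtain ⟨G, hG, hGT⟩ := h1
  obtain ⟨H, hH0, hH⟩ := exists_unstar G v
  have hle : ∀ x, dg H x ≤ d x := by
    intro x
    by_cases hx : x = v
    · subst hx; omega
    · have := hH x hx
      rw [hG] at this
      omega
  have hst : Stc m (dg H) := by
    refine persist (L := ∅) hS hpos hmin ?_ ?_ (by simp) hN (by simp; omega)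
    · intro x hx
      have := hH x hx
      rw [hG] at this
      split_ifs at this <;> omega
    · intro x hx _ hxm
      have := hH x hx
      rw [hG, if_neg] at this
      · omega
      · intro h
        have := hGT (by rw [mem_nb]; exact h)
        rw [mem_TT] at this
        omega
  obtain ⟨G', hG', hP⟩ := hIH (dg H) (spp_lt hpos hH0 hle) ⟨H, fun _ => rfl⟩ hst
  refine step (A := nb G v) (v := v) (by rw [mem_nb]; exact G.loopless.irrefl v)
    (by rw [card_nb, hG]) hH0 ?_ hG' hP
  intro z hz
  rw [← hG, hH z hz]
  simp only [mem_nb]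

theorem case2 {m : ℕ} (hm : 2 ≤ m) {d : V → ℕ} {v : V} (hIH : IHyp m d) (hS : Stc m d)
    (hpos : 0 < d v) (hmin : ∀ x, 0 < d x → d v ≤ d x)
    (hg : ∃ G : SimpleGraph V, ∀ x, dg G x = d x) (hN : 2 * m + 2 ≤ (spp d).card)
    (hkm : d v ≤ m + 1) (ht : (TT m d).card < d v)
    (hc : 2 * m + 3 + (d v - (TT m d).card) + 1 ≤ (spp d).card + max (d v) 2) :
    ∃ G : SimpleGraph V, (∀ x, dg G x = d x) ∧ PP G (2 * m + 1) := by
  obtain ⟨G0, hG0⟩ := hg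
  have hvS : v ∈ spp d := by rw [mem_spp]; exact hpos
  have hvT : v ∉ TT m d := by rw [mem_TT]; omega
  obtain ⟨L, hLS, hLc, hLl⟩ := lowest d ((spp d).erase v \ TT m d) (d v - (TT m d).card) (by
    have := le_card_sdiff (TT m d) ((spp d).erase v)
    rw [card_erase_of_mem hvS] at this
    omega)
  have hLm : ∀ l ∈ L, l ≠ v ∧ 0 < d l ∧ d l ≤ m + 1 := by
    intro l hl
    have := hLS hl
    rw [mem_sdiff, mem_erase, mem_spp, mem_TT] at this
    exact ⟨this.1.1, this.1.2, by omega⟩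
  have hdis : Disjoint (TT m d) L := by
    rw [Finset.disjoint_left]
    intro x hx hxL
    rw [mem_TT] at hx
    have := hLm x hxL
    omega
  set A := TT m d ∪ L with hA
  have hAc : A.card = d v := by
    rw [hA, card_union_of_disjoint hdis, hLc]; omega
  have hvA : v ∉ A := by
    rw [hA, mem_union, not_or]
    exact ⟨hvT, fun h => (hLm v h).1 rfl⟩
  set d' : V → ℕ := fun x => if x = v then 0 else d x - if x ∈ A then 1 else 0 with hd'
  have h0 : d' v = 0 := by simp [hd']
  have hd : ∀ z, z ≠ v → d z = d' z + if z ∈ A then 1 else 0 := by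
    intro z hz
    simp only [hd', if_neg hz]
    by_cases hzA : z ∈ A
    · have : 0 < d z := by
        rw [hA, mem_union, mem_TT] at hzA
        rcases hzA with h | h
        · omega
        · exact (hLm z h).2.1
      rw [if_pos hzA]; omega
    · rw [if_neg hzA]; omega
  have hle : ∀ x, d' x ≤ d x := by
    intro x
    by_cases hx : x = v
    · subst hx; omega
    · have := hd x hx; omega
  have hle1 : ∀ x, x ≠ v → d x ≤ d' x + 1 := by
    intro x hx
    have := hd x hx
    split_ifs at this <;> omega
  have hst : Stc m d' := by
    refine persist (L := L) hS hpos hmin hle1 ?_ ?_ hN (by rw [hLc]; exact hc)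
    · intro x hx hxL hxm
      have := hd x hx
      rw [if_neg] at this
      · omega
      · rw [hA, mem_union, not_or, mem_TT]
        exact ⟨by omega, hxL⟩
    · intro l hl x hx hxv hxL
      by_cases hxT : x ∈ TT m d
      · rw [mem_TT] at hxT
        have := hLm l hl
        omega
      · exact hLl l hl x (by rw [mem_sdiff, mem_erase]; exact ⟨⟨hxv, hx⟩, hxT⟩) hxL
  have hg' := graphic_red hm (hst.rlx (by omega)) hpos hmin h0 hle hle1 ht hkm (by
    intro x hx
    have := hd x (by rintro rfl; exact hvT hx)
    rw [if_pos (by rw [hA, mem_union]; exact Or.inl hx)] at this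
    omega) (dg_lt_spp hG0) (by
    have h1 := even_sum_dg G0
    simp only [hG0] at h1
    rw [sum_star hvA h0 hd, hAc] at h1
    rw [Nat.even_iff] at *
    omega)
  obtain ⟨G', hG', hP⟩ := hIH d' (spp_lt hpos h0 hle) hg' hst
  exact step hvA hAc h0 hd hG' hP

theorem case34 {m : ℕ} (hm : 2 ≤ m) {d : V → ℕ} {v : V} (hS : Stc m d)
    (hpos : 0 < d v) (hmin : ∀ x, 0 < d x → d v ≤ d x)
    (hg : ∃ G : SimpleGraph V, ∀ x, dg G x = d x) (hN : (spp d).card = 2 * m + 2)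
    (hkm : d v ≤ m + 1) (ht : (TT m d).card < d v)
    (hc : (TT m d).card = 1 ∨ ((TT m d).card = 0 ∧ d v = 1)) :
    ∃ G : SimpleGraph V, (∀ x, dg G x = d x) ∧ PP G (2 * m + 1) := by
  obtain ⟨G0, hG0⟩ := hg
  have hvS : v ∈ spp d := by rw [mem_spp]; exact hpos
  have hvT : v ∉ TT m d := by rw [mem_TT]; omega
  obtain ⟨L, hLS, hLc, hLl⟩ := lowest d ((spp d).erase v \ TT m d) (d v - 1 - (TT m d).card) (by
    have := le_card_sdiff (TT m d) ((spp d).erase v)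
    rw [card_erase_of_mem hvS] at this
    omega)
  have hLm : ∀ l ∈ L, l ≠ v ∧ 0 < d l ∧ d l ≤ m + 1 := by
    intro l hl
    have := hLS hl
    rw [mem_sdiff, mem_erase, mem_spp, mem_TT] at this
    exact ⟨this.1.1, this.1.2, by omega⟩
  have hdis : Disjoint (TT m d) L := by
    rw [Finset.disjoint_left]
    intro x hx hxL
    rw [mem_TT] at hx
    have := hLm x hxL
    omega
  set A := TT m d ∪ L with hA
  have hAc : A.card = d v - 1 := by
    rw [hA, card_union_of_disjoint hdis, hLc]; omega
  have hvA : v ∉ A := by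
    rw [hA, mem_union, not_or]
    exact ⟨hvT, fun h => (hLm v h).1 rfl⟩
  have hex : ∃ h, d h = m + 1 ∧ h ∉ insert v A := by
    by_contra hcon
    push Not at hcon
    have : univ.filter (fun x => m + 1 ≤ d x) ⊆ insert v A := by
      intro x hx
      simp only [mem_filter, mem_univ, true_and] at hx
      by_cases hxT : x ∈ TT m d
      · exact mem_insert_of_mem (mem_union_left _ hxT)
      · rw [mem_TT] at hxT
        exact hcon x (by omega)
    have h1 := card_le_card this
    rw [card_insert_of_notMem hvA] at h1
    have h2 := hS (m + 1) (by omega) le_rfl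
    rw [cnt] at h2
    omega
  obtain ⟨h, hh, hhA⟩ := hex
  rw [mem_insert, not_or] at hhA
  set d2 : V → ℕ := fun x => if x = v then 0 else d x - if x ∈ A then 1 else 0 with hd2
  have hdd : ∀ z, z ≠ v → d z = d2 z + if z ∈ A then 1 else 0 := by
    intro z hz
    simp only [hd2, if_neg hz]
    by_cases hzA : z ∈ A
    · have : 0 < d z := by
        rw [hA, mem_union, mem_TT] at hzA
        rcases hzA with h | h
        · omega
        · exact (hLm z h).2.1
      rw [if_pos hzA]; omega
    · rw [if_neg hzA]; omega
  have hst : Stc m d2 := by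
    refine persist (L := L) hS hpos hmin ?_ ?_ ?_ (by omega) (by rw [hLc]; omega)
    · intro x hx
      have := hdd x hx
      split_ifs at this <;> omega
    · intro x hx hxL hxm
      have := hdd x hx
      rw [if_neg] at this
      · omega
      · rw [hA, mem_union, not_or, mem_TT]
        exact ⟨by omega, hxL⟩
    · intro l hl x hx hxv hxL
      by_cases hxT : x ∈ TT m d
      · rw [mem_TT] at hxT
        have := hLm l hl
        omega
      · exact hLl l hl x (by rw [mem_sdiff, mem_erase]; exact ⟨⟨hxv, hx⟩, hxT⟩) hxL
  have hd2h : d2 h = m + 1 := by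
    have := hdd h hhA.1
    rw [if_neg hhA.2] at this
    omega
  set d' : V → ℕ := fun x => if x = h then m else d2 x with hd'
  have h0 : d' v = 0 := by simp [hd', hd2, Ne.symm hhA.1]
  set B := insert h A with hB
  have hBc : B.card = d v := by
    rw [hB, card_insert_of_notMem hhA.2, hAc]; omega
  have hvB : v ∉ B := by
    rw [hB, mem_insert, not_or]
    exact ⟨Ne.symm hhA.1, hvA⟩
  have hd : ∀ z, z ≠ v → d z = d' z + if z ∈ B then 1 else 0 := by
    intro z hz
    by_cases hzh : z = h
    · subst hzh
      simp [hd', hB, hh]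
    · rw [hdd z hz]
      simp [hd', hB, hzh]
  have hR : Rlx m d' := by
    refine ⟨?_, ?_⟩
    · intro j hj2 hjm
      have h1 := hst j hj2 (by omega)
      have : cnt d2 j ≤ cnt d' j := by
        apply card_le_card
        intro x hx
        simp only [mem_filter, mem_univ, true_and, hd'] at hx ⊢
        split_ifs <;> omega
      omega
    · have h1 := hst (m + 1) (by omega) le_rfl
      have : (univ.filter (fun x => m + 1 ≤ d2 x)).erase h ⊆ univ.filter (fun x => m + 1 ≤ d' x) := by
        intro x hx
        simp only [mem_erase, mem_filter, mem_univ, true_and, hd'] at hx ⊢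
        rw [if_neg hx.1]
        exact hx.2
      have h2 := card_le_card this
      have h3 := pred_card_le_card_erase (s := univ.filter (fun x => m + 1 ≤ d2 x)) (a := h)
      rw [cnt] at *
      omega
  have hle : ∀ x, d' x ≤ d x := by
    intro x
    by_cases hx : x = v
    · subst hx; omega
    · have := hd x hx; omega
  have hle1 : ∀ x, x ≠ v → d x ≤ d' x + 1 := by
    intro x hx
    have := hd x hx
    split_ifs at this <;> omega
  obtain ⟨G', hG'⟩ := graphic_red hm hR hpos hmin h0 hle hle1 ht hkm (by
    intro x hx
    have := hd x (by rintro rfl; exact hvT hx)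
    rw [if_pos (by rw [hB, hA, mem_insert, mem_union]; exact Or.inr (Or.inl hx))] at this
    omega) (dg_lt_spp hG0) (by
    have h1 := even_sum_dg G0
    simp only [hG0] at h1
    rw [sum_star hvB h0 hd, hBc] at h1
    rw [Nat.even_iff] at *
    omega)
  refine step hvB hBc h0 hd hG' ?_
  refine base hm ((spp d).erase v) (by rw [card_erase_of_mem hvS]; omega) G' ?_ ?_
  · intro x hx
    rw [hG']
    by_cases hxv : x = v
    · rw [hxv, h0]
    · rw [mem_erase, mem_spp] at hx
      have := hle x
      by_contra
      exact hx ⟨hxv, by omega⟩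
  · rw [show dg G' = d' from funext hG']
    exact hR
end L29

section L29
open Finset Classical
set_option linter.unusedSectionVars false
set_option linter.unnecessarySeqFocus false

variable {V : Type*} [Fintype V]

/-- consecutive vertices of the closed sequence `c` of length `l` -/
def CE (l : ℕ) (c : ℕ → V) (x y : V) : Prop :=
  ∃ i < l, ∃ j < l, x = c i ∧ y = c j ∧
    (i + 1 = j ∨ j + 1 = i ∨ (i = 0 ∧ j + 1 = l) ∨ (j = 0 ∧ i + 1 = l))

theorem CE.symm {l : ℕ} {c : ℕ → V} {x y : V} (h : CE l c x y) : CE l c y x := by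
  obtain ⟨i, hi, j, hj, hx, hy, h⟩ := h
  exact ⟨j, hj, i, hi, hy, hx, by tauto⟩

theorem CE.adj {G : SimpleGraph V} {l : ℕ} {c : ℕ → V} (hc : Cyc G l c) {x y : V}
    (h : CE l c x y) : G.Adj x y := by
  obtain ⟨i, hi, j, hj, rfl, rfl, h | h | h | h⟩ := h
  · subst h; exact hc.adj i hj
  · subst h; exact (hc.adj j hi).symm
  · obtain ⟨rfl, h⟩ := h
    have : j = l - 1 := by omega
    subst this
    exact hc.last.symm
  · obtain ⟨rfl, h⟩ := h
    have : i = l - 1 := by omega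
    subst this
    exact hc.last

/-- degree off the cycle edges -/
noncomputable def fd (G : SimpleGraph V) (l : ℕ) (c : ℕ → V) (x : V) : ℕ :=
  (univ.filter (fun y => G.Adj x y ∧ ¬ CE l c x y)).card

theorem fd_add {G : SimpleGraph V} {l : ℕ} {c : ℕ → V} (hc : Cyc G l c) (x : V) :
    fd G l c x + (univ.filter (fun y => CE l c x y)).card = dg G x := by
  rw [fd, dg, ← card_union_of_disjoint]
  · congr 1
    ext y
    simp only [mem_union, mem_filter, mem_univ, true_and]
    constructor
    · rintro (h | h)
      · exact h.1
      · exact h.adj hc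
    · intro h
      by_cases h' : CE l c x y
      · exact Or.inr h'
      · exact Or.inl ⟨h, h'⟩
  · rw [Finset.disjoint_left]
    intro y hy hy'
    simp only [mem_filter, mem_univ, true_and] at hy hy'
    exact hy.2 hy'

theorem fd_on {G : SimpleGraph V} {l : ℕ} (hl : 3 ≤ l) {c : ℕ → V} (hc : Cyc G l c) {i : ℕ}
    (hi : i < l) : fd G l c (c i) + 2 = dg G (c i) := by
  rw [← fd_add hc]
  congr 1
  set s := if i + 1 < l then i + 1 else 0 with hs
  set p := if i = 0 then l - 1 else i - 1 with hp
  have hsl : s < l := by rw [hs]; split_ifs <;> omega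
  have hpl : p < l := by rw [hp]; split_ifs <;> omega
  have hsp : s ≠ p := by rw [hs, hp]; split_ifs <;> omega
  have : univ.filter (fun y => CE l c (c i) y) = {c s, c p} := by
    ext y
    simp only [mem_filter, mem_univ, true_and, mem_insert, mem_singleton]
    constructor
    · rintro ⟨i', hi', j, hj, hx, rfl, h⟩
      have := hc.inj _ _ hi hi' hx
      subst this
      have : j = s ∨ j = p := by
        rw [hs, hp]
        split_ifs <;> omega
      rcases this with h | h
      · left; rw [h]
      · right; rw [h]
    · rintro (rfl | rfl)
      · refine ⟨i, hi, s, hsl, rfl, rfl, ?_⟩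
        rw [hs]; split_ifs <;> omega
      · refine ⟨i, hi, p, hpl, rfl, rfl, ?_⟩
        rw [hp]; split_ifs <;> omega
  rw [this, card_pair]
  intro h
  exact hsp (hc.inj _ _ hsl hpl h)

theorem fd_le {G : SimpleGraph V} {l : ℕ} {c : ℕ → V} (hc : Cyc G l c) (x : V) :
    fd G l c x ≤ dg G x := by
  have := fd_add hc x
  omega

theorem fd_ge {G : SimpleGraph V} {l : ℕ} (hl : 3 ≤ l) {c : ℕ → V} (hc : Cyc G l c) (x : V) :
    dg G x ≤ fd G l c x + 2 := by
  by_cases h : ∃ i < l, x = c i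
  · obtain ⟨i, hi, rfl⟩ := h
    rw [fd_on hl hc hi]
  · rw [← fd_add hc x]
    have : univ.filter (fun y => CE l c x y) = ∅ := by
      rw [filter_eq_empty_iff]
      rintro y - ⟨i, hi, j, hj, hx, _⟩
      exact h ⟨i, hi, hx⟩
    rw [this, card_empty]
    omega

theorem find_edge {G : SimpleGraph V} {l : ℕ} {c : ℕ → V} {X Z : Finset V}
    (hdis : ∀ z ∈ Z, z ∉ X) (hlt : ∑ x ∈ X, fd G l c x < ∑ z ∈ Z, fd G l c z) :
    ∃ x y, x ∉ X ∧ y ∉ X ∧ G.Adj x y ∧ ¬ CE l c x y := by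
  by_contra hcon
  push Not at hcon
  have h1 : ∀ z ∈ Z, fd G l c z ≤ ∑ x ∈ X, if G.Adj z x ∧ ¬ CE l c z x then 1 else 0 := by
    intro z hz
    rw [← card_filter]
    apply card_le_card
    intro y hy
    simp only [mem_filter, mem_univ, true_and] at hy ⊢
    refine ⟨?_, hy⟩
    by_contra hyX
    exact hy.2 (hcon z y (hdis z hz) hyX hy.1)
  have h2 : ∀ x ∈ X, (∑ z ∈ Z, if G.Adj z x ∧ ¬ CE l c z x then 1 else 0) ≤ fd G l c x := by
    intro x hx
    rw [← card_filter]
    apply card_le_card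
    intro y hy
    simp only [mem_filter, mem_univ, true_and] at hy ⊢
    exact ⟨hy.2.1.symm, fun h => hy.2.2 h.symm⟩
  have h3 := sum_le_sum h1
  rw [sum_comm] at h3
  have h4 := sum_le_sum h2
  omega

theorem cnt5 (m k s z W B : ℕ) (hm : 4 ≤ m) (hk : 2 ≤ k) (hkm : k ≤ m) (hs : s ≤ 1) (hz : m ≤ z)
    (hB : B + 2 * (k - 2) ≤ (k - 2) * (m - 1) + 2 * s) (hW : z * (m + 1) ≤ W + 2 * z) :
    (m - 1) + (m - 1) + B < W := by
  obtain ⟨q, rfl⟩ := Nat.exists_eq_add_of_le hm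
  obtain ⟨p, rfl⟩ := Nat.exists_eq_add_of_le hk
  have e1 : 2 + p - 2 = p := by omega
  have e2 : 4 + q - 1 = 3 + q := by omega
  rw [e1, e2] at hB
  rw [e2]
  have h1 : z * (q + 3) ≤ W := by nlinarith
  have h2 : (4 + q) * (q + 3) ≤ z * (q + 3) := Nat.mul_le_mul_right _ hz
  have h3 : p * (q + 1) ≤ (q + 2) * (q + 1) := Nat.mul_le_mul_right _ (by omega)
  nlinarith

theorem cnt5b (m k s z W B : ℕ) (hm : 4 ≤ m) (hk : 2 ≤ k) (hkm : k ≤ m + s) (hs : s ≤ 1)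
    (hk2 : k ≤ m + 1)
    (hz : 2 * m + 1 + s ≤ z + k)
    (hB : B + 2 * (k - 2) ≤ (k - 2) * m + 2 * s) (hW : z * (m + 1) ≤ W + 2 * z) :
    (m - 1) + (m - 1) + B < W := by
  obtain ⟨q, rfl⟩ := Nat.exists_eq_add_of_le hm
  obtain ⟨p, rfl⟩ := Nat.exists_eq_add_of_le hk
  have e1 : 2 + p - 2 = p := by omega
  have e2 : 4 + q - 1 = 3 + q := by omega
  rw [e1] at hB
  rw [e2]
  have h1 : z * (q + 3) ≤ W := by nlinarith
  have h4 : (q + 5) ≤ z := by omega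
  have h2 : (q + 5) * (q + 3) ≤ z * (q + 3) := Nat.mul_le_mul_right _ h4
  have h3 : p * (q + 2) ≤ (q + 2 + s) * (q + 2) := Nat.mul_le_mul_right _ (by omega)
  interval_cases s <;> nlinarith

theorem case5 {m : ℕ} (hm : 4 ≤ m) {d : V → ℕ} {v : V} (hIH : IHyp m d) (hS : Stc m d)
    (hpos : 0 < d v) (hmin : ∀ x, 0 < d x → d v ≤ d x)
    (hg : ∃ G : SimpleGraph V, ∀ x, dg G x = d x) {s : ℕ} (hs : s ≤ 1)
    (hN : (spp d).card = 2 * m + 2 + s)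
    (hk2 : 2 ≤ d v) (hkm : d v ≤ m + 1) (ht : (TT m d).card = 0) (hks : d v ≤ m + s) :
    ∃ G : SimpleGraph V, (∀ x, dg G x = d x) ∧ PP G (2 * m + 1) := by
  obtain ⟨G0, hG0⟩ := hg
  have hvS : v ∈ spp d := by rw [mem_spp]; exact hpos
  have hT : ∀ x, d x ≤ m + 1 := by
    intro x
    by_contra h
    have : x ∈ TT m d := by rw [mem_TT]; omega
    rw [card_eq_zero] at ht
    rw [ht] at this
    simp at this
  have hcS : ((spp d).erase v).card = 2 * m + 1 + s := by
    rw [card_erase_of_mem hvS]; omega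
  obtain ⟨L, hLS, hLc, hLl⟩ := lowest d ((spp d).erase v) (d v - 2) (by omega)
  have hLm : ∀ l ∈ L, l ≠ v ∧ 0 < d l := by
    intro l hl
    have := hLS hl
    rwa [mem_erase, mem_spp] at this
  have hvL : v ∉ L := fun h => (hLm v h).1 rfl
  set d' : V → ℕ := fun x => if x = v then 0 else d x - if x ∈ L then 1 else 0 with hd'
  have h0 : d' v = 0 := by simp [hd']
  have hd : ∀ z, z ≠ v → d z = d' z + if z ∈ L then 1 else 0 := by
    intro z hz
    simp only [hd', if_neg hz]
    by_cases hzA : z ∈ L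
    · have := (hLm z hzA).2
      rw [if_pos hzA]; omega
    · rw [if_neg hzA]; omega
  have hle : ∀ x, d' x ≤ d x := by
    intro x
    by_cases hx : x = v
    · subst hx; omega
    · have := hd x hx; omega
  have hle1 : ∀ x, x ≠ v → d x ≤ d' x + 1 := by
    intro x hx
    have := hd x hx
    split_ifs at this <;> omega
  have hst : Stc m d' := by
    refine persist (L := L) hS hpos hmin hle1 ?_ ?_ (by omega) (by rw [hLc]; omega)
    · intro x hx hxL hxm
      have := hd x hx
      rw [if_neg hxL] at this
      omega
    · intro l hl x hx hxv hxL
      exact hLl l hl x (by rw [mem_erase]; exact ⟨hxv, hx⟩) hxL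
  have hg' := graphic_red (by omega) (hst.rlx (by omega)) hpos hmin h0 hle hle1 (by omega) hkm (by
    intro x hx
    rw [mem_TT] at hx
    have := hT x
    omega) (dg_lt_spp hG0) (by
    have h1 := even_sum_dg G0
    simp only [hG0] at h1
    rw [sum_star hvL h0 hd, hLc] at h1
    rw [Nat.even_iff] at *
    omega)
  obtain ⟨G', hG', c, hc, hcd⟩ := hIH d' (spp_lt hpos h0 hle) hg' hst
  set X := insert (c 0) (insert (c (2 * m)) L) with hX
  have hcS' : ∀ i < 2 * m + 1, c i ∈ (spp d).erase v := by
    intro i hi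
    have h1 := fd_on (by omega) hc hi
    rw [hG'] at h1
    rw [mem_erase, mem_spp]
    have := hle (c i)
    refine ⟨?_, by omega⟩
    intro h
    rw [h, h0] at h1
    omega
  set O := (spp d).erase v \ (range (2 * m + 1)).image c with hO
  have hOc : O.card = s := by
    have hsub : (range (2 * m + 1)).image c ⊆ (spp d).erase v := by
      intro x hx
      rw [mem_image] at hx
      obtain ⟨i, hi, rfl⟩ := hx
      exact hcS' i (by simpa using hi)
    rw [hO, card_sdiff_of_subset hsub, hcS, card_image_of_injOn, card_range]
    · omega
    · intro i hi j hj h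
      exact hc.inj i j (by simpa using hi) (by simpa using hj) h
  have hfL : ∀ M, (∀ l ∈ L, d' l ≤ M) → ∑ l ∈ L, fd G' (2 * m + 1) c l + 2 * (d v - 2)
      ≤ (d v - 2) * M + 2 * s := by
    intro M hM
    have h1 : ∀ l ∈ L, fd G' (2 * m + 1) c l + 2 ≤ M + 2 * (if l ∈ O then 1 else 0) := by
      intro l hl
      have h2 := hM l hl
      by_cases h : l ∈ O
      · rw [if_pos h]
        have := fd_le hc l
        rw [hG'] at this
        omega
      · rw [if_neg h]
        rw [hO, mem_sdiff, not_and, not_not, mem_image] at h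
        obtain ⟨i, hi, rfl⟩ := h (hLS hl)
        rw [fd_on (by omega) hc (by simpa using hi), hG']
        omega
    have h2 := sum_le_sum h1
    rw [sum_add_distrib, sum_add_distrib, ← mul_sum, ← card_filter] at h2
    simp only [sum_const, hLc, smul_eq_mul] at h2
    have h3 : (L.filter (fun l => l ∈ O)).card ≤ O.card := by
      apply card_le_card
      intro x hx
      exact (mem_filter.1 hx).2
    rw [hOc] at h3
    omega
  have hfa : fd G' (2 * m + 1) c (c 0) ≤ m - 1 := by
    have h1 := fd_on (by omega) hc (show 0 < 2 * m + 1 by omega)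
    have h2 := hle (c 0)
    have h3 := hT (c 0)
    rw [hG'] at h1
    omega
  have hfb : fd G' (2 * m + 1) c (c (2 * m)) ≤ m - 1 := by
    have h1 := fd_on (by omega) hc (show 2 * m < 2 * m + 1 by omega)
    have h2 := hle (c (2 * m))
    have h3 := hT (c (2 * m))
    rw [hG'] at h1
    omega
  have hsumX : ∑ x ∈ X, fd G' (2 * m + 1) c x ≤ (m - 1) + (m - 1) + ∑ l ∈ L, fd G' (2 * m + 1) c l := by
    have e1 : ∀ (a : V) (Y : Finset V) (f : V → ℕ), ∑ x ∈ insert a Y, f x ≤ f a + ∑ x ∈ Y, f x := by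
      intro a Y f
      by_cases h : a ∈ Y
      · rw [insert_eq_of_mem h]; omega
      · rw [sum_insert h]
    have h1 := e1 (c 0) (insert (c (2 * m)) L) (fd G' (2 * m + 1) c)
    have h2 := e1 (c (2 * m)) L (fd G' (2 * m + 1) c)
    rw [← hX] at h1
    omega
  set Z := (univ.filter (fun x => d x = m + 1 ∧ x ≠ v)) \ X with hZ
  have hZX : ∀ z ∈ Z, z ∉ X := fun z hz => (mem_sdiff.1 hz).2
  have hfZ : Z.card * (m + 1) ≤ ∑ z ∈ Z, fd G' (2 * m + 1) c z + 2 * Z.card := by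
    have : ∀ z ∈ Z, m + 1 ≤ fd G' (2 * m + 1) c z + 2 := by
      intro z hz
      rw [hZ, mem_sdiff, mem_filter] at hz
      have h1 := fd_ge (show 3 ≤ 2 * m + 1 by omega) hc z
      rw [hG'] at h1
      have h2 := hd z hz.1.2.2
      rw [if_neg (fun h => hz.2 (by rw [hX]; exact mem_insert_of_mem (mem_insert_of_mem h)))] at h2
      omega
    have h1 := sum_le_sum this
    rw [sum_const, sum_add_distrib, sum_const, smul_eq_mul, smul_eq_mul] at h1
    omega
  have hlt : ∑ x ∈ X, fd G' (2 * m + 1) c x < ∑ z ∈ Z, fd G' (2 * m + 1) c z := by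
    refine hsumX.trans_lt ?_
    by_cases hcase : ∃ l ∈ L, d l = m + 1
    · obtain ⟨l0, hl0, hl0m⟩ := hcase
      refine cnt5b m (d v) s Z.card _ _ hm hk2 hks hs hkm ?_ (hfL m ?_) hfZ
      · have : (spp d).erase v \ X ⊆ Z := by
          intro x hx
          rw [mem_sdiff] at hx
          rw [hZ, mem_sdiff, mem_filter]
          refine ⟨⟨mem_univ _, ?_, (mem_erase.1 hx.1).1⟩, hx.2⟩
          have h1 := hLl l0 hl0 x hx.1 (fun h => hx.2 (by
            rw [hX]; exact mem_insert_of_mem (mem_insert_of_mem h)))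
          have := hT x
          omega
        have h1 := card_le_card this
        have h2 := le_card_sdiff X ((spp d).erase v)
        have h3 : X.card ≤ L.card + 1 + 1 :=
          (card_insert_le _ _).trans (Nat.add_le_add_right (card_insert_le _ _) 1)
        omega
      · intro l hl
        have h1 := hd l (hLm l hl).1
        rw [if_pos hl] at h1
        have := hT l
        omega
    · push Not at hcase
      have hkm' : d v ≤ m := by
        by_contra h
        have : L.Nonempty := by rw [← card_pos]; omega
        obtain ⟨l, hl⟩ := this
        have h1 := hmin l (hLm l hl).2
        have h2 := hT l
        exact hcase l hl (by omega)
      refine cnt5 m (d v) s Z.card _ _ hm hk2 hkm' hs ?_ (hfL (m - 1) ?_) hfZ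
      · have : ((univ.filter (fun x => m + 1 ≤ d x)).erase (c 0)).erase (c (2 * m)) ⊆ Z := by
          intro x hx
          rw [mem_erase, mem_erase, mem_filter] at hx
          have h1 := hT x
          rw [hZ, mem_sdiff, mem_filter, hX, mem_insert, mem_insert]
          refine ⟨⟨mem_univ _, by omega, ?_⟩, ?_⟩
          · rintro rfl; omega
          · rintro (h | h | h)
            · exact hx.2.1 h
            · exact hx.1 h
            · exact hcase x h (by omega)
        have h1 := card_le_card this
        have h2 := pred_card_le_card_erase (s := univ.filter (fun x => m + 1 ≤ d x)) (a := c 0)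
        have h3 := pred_card_le_card_erase (s := (univ.filter (fun x => m + 1 ≤ d x)).erase (c 0))
          (a := c (2 * m))
        have h4 := hS (m + 1) (by omega) le_rfl
        rw [cnt] at h4
        omega
      · intro l hl
        have h1 := hd l (hLm l hl).1
        rw [if_pos hl] at h1
        have := hT l
        have := hcase l hl
        omega
  obtain ⟨x, y, hxX, hyX, hxy, hnce⟩ := find_edge hZX hlt
  rw [hX, mem_insert, mem_insert, not_or, not_or] at hxX hyX
  have hposG : ∀ a b, G'.Adj a b → a ≠ v := by
    rintro a b hab rfl
    have h1 := hG' a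
    rw [h0, ← card_nb, card_eq_zero, eq_empty_iff_forall_notMem] at h1
    exact h1 b (by rw [mem_nb]; exact hab)
  have hxv := hposG x y hxy
  have hyv := hposG y x hxy.symm
  have hxney : x ≠ y := fun h => G'.loopless.irrefl y (h ▸ hxy)
  refine step (d' := dg (delE G' x y)) (v := v) (A := insert x (insert y L)) ?_ ?_ ?_ ?_
    (G := delE G' x y) (fun _ => rfl) ⟨c, ?_, ?_⟩
  · simp only [mem_insert, not_or]
    exact ⟨hxv.symm, hyv.symm, hvL⟩
  · rw [card_insert_of_notMem, card_insert_of_notMem hyX.2.2, hLc]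
    · omega
    · rw [mem_insert, not_or]
      exact ⟨hxney, hxX.2.2⟩
  · have := dg_delE G' hxy v
    rw [hG', h0] at this
    omega
  · intro z hz
    have h1 := dg_delE G' hxy z
    rw [hG'] at h1
    rw [hd z hz, h1]
    simp only [mem_insert]
    have hxL := hxX.2.2
    have hyL := hyX.2.2
    by_cases hzx : z = x
    · subst hzx; simp [hxL]
    · by_cases hzy : z = y
      · subst hzy; simp [hyL]
      · simp [hzx, hzy]
  · have key : ∀ a b, CE (2 * m + 1) c a b → (delE G' x y).Adj a b := by
      intro a b hab
      rw [delE_adj]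
      refine ⟨hab.adj hc, ?_⟩
      rintro (⟨rfl, rfl⟩ | ⟨rfl, rfl⟩)
      · exact hnce hab
      · exact hnce hab.symm
    refine ⟨hc.inj, ?_, ?_⟩
    · intro i hi
      exact key _ _ ⟨i, by omega, i + 1, hi, rfl, rfl, Or.inl rfl⟩
    · exact key _ _ ⟨2 * m + 1 - 1, by omega, 0, by omega, rfl, rfl, by omega⟩
  · have key : ∀ a, a ≠ x → a ≠ y → cdeg (delE G' x y) (2 * m + 1) c a = cdeg G' (2 * m + 1) c a := by
      intro a hax hay
      rw [cdeg, cdeg]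
      congr 1
      apply filter_congr
      intro j _
      rw [delE_adj]
      tauto
    have e : 2 * m + 1 - 1 = 2 * m := by omega
    rw [e] at hcd ⊢
    rw [key _ (Ne.symm hxX.1) (Ne.symm hyX.1), key _ (Ne.symm hxX.2.1) (Ne.symm hyX.2.1)]
    exact hcd
end L29

section L29
open Finset Classical
set_option linter.unusedSectionVars false
set_option linter.unnecessarySeqFocus false

variable {V : Type*} [Fintype V]

/-- adjacency of the prism over a complete graph, on the numbers below `2m+2` -/
def PR (m i j : ℕ) : Prop :=
  ¬ (i = j) ∧ ((i < m + 1 ∧ j < m + 1) ∨ (m + 1 ≤ i ∧ m + 1 ≤ j) ∨ i + (m + 1) = j ∨ j + (m + 1) = i)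

theorem PR_card (m i : ℕ) (hi : i < 2 * m + 2) :
    ((range (2 * m + 2)).filter (fun j => PR m i j)).card = m + 1 := by
  by_cases h : i < m + 1
  · have : (range (2 * m + 2)).filter (fun j => PR m i j) =
        insert (i + (m + 1)) ((range (m + 1)).erase i) := by
      ext j
      rw [mem_filter]
      unfold PR
      simp only [mem_range, mem_insert, mem_erase, ne_eq]
      omega
    rw [this, card_insert_of_notMem, card_erase_of_mem, card_range]
    · omega
    · simpa using h
    · rw [mem_erase, mem_range]; omega
  · have : (range (2 * m + 2)).filter (fun j => PR m i j) =
        insert (i - (m + 1)) ((Ico (m + 1) (2 * m + 2)).erase i) := by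
      ext j
      rw [mem_filter]
      unfold PR
      simp only [mem_range, mem_insert, mem_erase, mem_Ico, ne_eq]
      omega
    rw [this, card_insert_of_notMem, card_erase_of_mem, Nat.card_Ico]
    · omega
    · rw [mem_Ico]; omega
    · rw [mem_erase, mem_Ico]; omega

/-- the prism transported along an enumeration -/
def PG (m : ℕ) (e : ℕ → V) (he : ∀ i j, i < 2 * m + 2 → j < 2 * m + 2 → e i = e j → i = j) :
    SimpleGraph V where
  Adj a b := ∃ i < 2 * m + 2, ∃ j < 2 * m + 2, a = e i ∧ b = e j ∧ PR m i j
  symm := ⟨by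
    rintro a b ⟨i, hi, j, hj, ha, hb, h⟩
    refine ⟨j, hj, i, hi, hb, ha, ?_⟩
    unfold PR at *
    omega⟩
  loopless := ⟨by
    rintro a ⟨i, hi, j, hj, ha, hb, h⟩
    exact h.1 (he i j hi hj (ha ▸ hb))⟩

theorem PG_adj {m : ℕ} {e : ℕ → V} (he : ∀ i j, i < 2 * m + 2 → j < 2 * m + 2 → e i = e j → i = j)
    (a b : V) : (PG m e he).Adj a b ↔
      ∃ i < 2 * m + 2, ∃ j < 2 * m + 2, a = e i ∧ b = e j ∧ PR m i j := Iff.rfl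

theorem PG_dg {m : ℕ} {e : ℕ → V} (he : ∀ i j, i < 2 * m + 2 → j < 2 * m + 2 → e i = e j → i = j)
    (i : ℕ) (hi : i < 2 * m + 2) : dg (PG m e he) (e i) = m + 1 := by
  rw [← PR_card m i hi, ← card_nb]
  symm
  apply card_bij (fun j _ => e j)
  · intro j hj
    rw [mem_filter, mem_range] at hj
    rw [mem_nb, PG_adj]
    exact ⟨i, hi, j, hj.1, rfl, rfl, hj.2⟩
  · intro j hj k hk h
    rw [mem_filter, mem_range] at hj hk
    exact he j k hj.1 hk.1 h
  · intro y hy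
    rw [mem_nb, PG_adj] at hy
    obtain ⟨i', hi', j, hj, ha, rfl, h⟩ := hy
    have := he _ _ hi hi' ha
    subst this
    exact ⟨j, by rw [mem_filter, mem_range]; exact ⟨hj, h⟩, rfl⟩

/-- order of the vertices along the cycle -/
def sg (m j : ℕ) : ℕ :=
  if j = 0 then 1 else if j = 1 then m else if j < m then j else if j < 2 * m then 3 * m - j else 0

theorem case6 {m : ℕ} (hm : 4 ≤ m) {d : V → ℕ} (hN : (spp d).card = 2 * m + 2)
    (hd : ∀ x, 0 < d x → d x = m + 1) :
    ∃ G : SimpleGraph V, (∀ x, dg G x = d x) ∧ PP G (2 * m + 1) := by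
  obtain ⟨e, he1, he⟩ := exists_enum (spp d) (card_pos.1 (by omega))
  rw [hN] at he1 he
  have hsurj := surj_of_inj hN he1 he
  refine ⟨PG m e he, ?_, fun j => e (sg m j), ?_, ?_⟩
  · intro x
    by_cases hx : x ∈ spp d
    · have hx' := hx
      rw [← hsurj, mem_image] at hx
      obtain ⟨i, hi, rfl⟩ := hx
      rw [PG_dg he i (by simpa using hi)]
      rw [mem_spp] at hx'
      exact (hd _ hx').symm
    · have h0 : d x = 0 := by rw [mem_spp] at hx; omega
      rw [h0, ← card_nb, card_eq_zero, eq_empty_iff_forall_notMem]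
      intro y hy
      rw [mem_nb, PG_adj] at hy
      obtain ⟨i, hi, j, hj, ha, _⟩ := hy
      exact hx (by rw [ha]; exact he1 i hi)
  · refine ⟨?_, ?_, ?_⟩
    · intro i j hi hj h
      have := he _ _ (by unfold sg; split_ifs <;> omega) (by unfold sg; split_ifs <;> omega) h
      unfold sg at this
      split_ifs at this <;> omega
    · intro i hi
      refine ⟨sg m i, by unfold sg; split_ifs <;> omega, sg m (i + 1),
        by unfold sg; split_ifs <;> omega, rfl, rfl, ?_⟩
      unfold PR sg
      split_ifs <;> try omega
      all_goals first | contradiction | (simp; omega)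
    · refine ⟨sg m (2 * m + 1 - 1), by unfold sg; split_ifs <;> omega, sg m 0,
        by unfold sg; split_ifs <;> omega, rfl, rfl, ?_⟩
      unfold PR sg
      split_ifs <;> try omega
      all_goals first | contradiction | (simp; omega)
  · have hinj : ∀ i j, i < 2 * m + 1 → j < 2 * m + 1 → e (sg m i) = e (sg m j) → i = j := by
      intro i j hi hj h
      have := he _ _ (by unfold sg; split_ifs <;> omega) (by unfold sg; split_ifs <;> omega) h
      unfold sg at this
      split_ifs at this <;> omega
    have key : ∀ a ≤ 1, cdeg (PG m e he) (2 * m + 1) (fun j => e (sg m j)) (e a) = m + 1 := by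
      intro a ha
      rw [cdeg_eq hinj, PG_dg he a (by omega)]
      intro y hy
      obtain ⟨i, hi, j, hj, hai, rfl, h⟩ := hy
      have := he _ _ (by omega) hi hai
      subst this
      refine ⟨if j = 0 then 2 * m else if j = 1 then 0 else if j < m then j else if j = m then 1
        else 3 * m - j, ?_, ?_⟩
      · unfold PR at h
        split_ifs <;> omega
      · congr 1
        unfold PR at h
        unfold sg
        split_ifs <;> try omega
        all_goals first | contradiction | (simp; omega)
    have e1 : sg m 0 = 1 := by simp [sg]
    have e2 : sg m (2 * m + 1 - 1) = 0 := by unfold sg; split_ifs <;> omega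
    beta_reduce
    rw [e1, e2, key 1 le_rfl, key 0 (by omega)]
    omega

theorem main29 {m : ℕ} (hm : 4 ≤ m) (N : ℕ) : ∀ d : V → ℕ, (spp d).card = N →
    (∃ G : SimpleGraph V, ∀ x, dg G x = d x) → Stc m d →
    ∃ G : SimpleGraph V, (∀ x, dg G x = d x) ∧ PP G (2 * m + 1) := by
  induction N using Nat.strong_induction_on with
  | _ N ih =>
  intro d hN hg hS
  have hIH : IHyp m d := fun d' hlt hg' hS' => ih _ (hN ▸ hlt) d' rfl hg' hS'
  have hcard := hS.card (by omega)
  by_cases hNm : (spp d).card = 2 * m + 1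
  · obtain ⟨G, hG⟩ := hg
    refine ⟨G, hG, base (by omega) (spp d) hNm G ?_ ?_⟩
    · intro x hx
      rw [mem_spp] at hx
      rw [hG]; omega
    · rw [show dg G = d from funext hG]
      exact hS.rlx (by omega)
  obtain ⟨v, hv, hmin'⟩ := exists_min_image (spp d) d (card_pos.1 (by omega))
  have hpos : 0 < d v := by rwa [mem_spp] at hv
  have hmin : ∀ x, 0 < d x → d v ≤ d x := fun x hx => hmin' x (by rwa [mem_spp])
  by_cases h1 : m + 2 ≤ d v ∨ d v ≤ (TT m d).card
  · exact case1 hIH hS hpos hmin hg (by omega) h1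
  push Not at h1
  by_cases h2 : 2 * m + 3 + (d v - (TT m d).card) + 1 ≤ (spp d).card + max (d v) 2
  · exact case2 (by omega) hIH hS hpos hmin hg (by omega) (by omega) h1.2 h2
  by_cases h3 : (spp d).card = 2 * m + 2 ∧ ((TT m d).card = 1 ∨ ((TT m d).card = 0 ∧ d v = 1))
  · exact case34 (by omega) hS hpos hmin hg h3.1 (by omega) h1.2 h3.2
  by_cases h4 : (spp d).card = 2 * m + 2 ∧ d v = m + 1
  · refine case6 hm h4.1 ?_
    have ht : (TT m d).card = 0 := by omega
    intro x hx
    have h5 := hmin x hx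
    by_contra h
    have : x ∈ TT m d := by rw [mem_TT]; omega
    rw [card_eq_zero] at ht
    rw [ht] at this
    simp at this
  · exact case5 hm hIH hS hpos hmin hg (s := (spp d).card - (2 * m + 2)) (by omega) (by omega)
      (by omega) (by omega) (by omega) (by omega)

theorem ncard_nb (G : SimpleGraph V) (x : V) : (G.neighborSet x).ncard = dg G x := by
  rw [← card_nb, ← Set.ncard_coe_finset]
  congr 1
  ext y
  simp [mem_nb]

theorem stc_of_seq {m n : ℕ} (hn : 2 * m + 1 ≤ n) (d : Fin n → ℕ) (hanti : Antitone d)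
    (h : ∀ i : ℕ, ∀ _ : 1 ≤ i, ∀ _ : i ≤ m, ∀ hlt : 2 * m + 1 - i < n,
      i + 1 ≤ d ⟨2 * m + 1 - i, hlt⟩) : Stc m d := by
  intro j hj2 hjm
  have h1 := h (j - 1) (by omega) (by omega) (by omega)
  have hsub : (univ : Finset (Fin (2 * m + 3 - j))).image
      (fun i => (⟨i.1, by omega⟩ : Fin n)) ⊆ univ.filter (fun x => j ≤ d x) := by
    intro x hx
    simp only [mem_image, mem_univ, true_and] at hx
    obtain ⟨i, rfl⟩ := hx
    simp only [mem_filter, mem_univ, true_and]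
    have h2 : d ⟨2 * m + 1 - (j - 1), by omega⟩ ≤ d ⟨i.1, by omega⟩ := by
      apply hanti
      rw [Fin.le_def]
      dsimp only
      omega
    omega
  have h3 := card_le_card hsub
  rw [card_image_of_injective, card_univ, Fintype.card_fin] at h3
  · rw [cnt]
    omega
  · intro a b hab
    simp only [Fin.mk.injEq] at hab
    exact Fin.ext hab
end L29

/-- **Lemma 2.9.** If `m ≥ 4`, `n ≥ 2m+1` and `π = (d₁,…,dₙ)` is a non-increasing
graphic sequence with `d_{2m+2-i} ≥ i+1` for `1 ≤ i ≤ m`, then `π` is potentially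
₃C_{2m+1}-graphic. -/
theorem lemma29 (m n : ℕ) (hm : 4 ≤ m) (hn : 2 * m + 1 ≤ n) (d : Fin n → ℕ)
    (hanti : Antitone d) (hgr : Graphic d)
    (hposa : ∀ i : ℕ, ∀ _ : 1 ≤ i, ∀ _ : i ≤ m, i + 1 ≤ d ⟨2 * m + 1 - i, by omega⟩) :
    Pot3C (2 * m + 1) d := by
  obtain ⟨G0, hG0⟩ := hgr
  obtain ⟨G, hG, hP⟩ := main29 hm _ d rfl ⟨G0, fun x => by rw [← ncard_nb, hG0 x]⟩
    (stc_of_seq hn d hanti (fun i h1 h2 _ => hposa i h1 h2))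
  refine ⟨G, fun x => by rw [ncard_nb, hG], ?_⟩
  intro r hr hrl
  obtain ⟨c, hc⟩ := bondy hP r hr hrl
  exact hasCycle_of_Cyc hr hc
end

section
/- Let ℓ ∈ {7, 8}, n ≥ ℓ, and let π = (d_1, …, d_n) be a non-increasing graphic sequence with d_{ℓ−2} ≥ 4, d_{ℓ−1} ≥ 3 and d_ℓ ≥ 2. Then π has a realization G containing cycles C_3, …, C_ℓ all lying on the ℓ vertices of G whose degrees are d_1, …, d_ℓ. -/
/-! ### Finite verification -/

namespace L27

/-- number of entries that exceed `t` by at least two -/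
def cg (L : List ℕ) (t : ℕ) : ℕ := L.countP (fun b => Nat.ble (t + 2) b)

def k4 (L Us : List ℕ) (x y : ℕ) : Bool :=
  Nat.ble y (x + 1) && Nat.ble (y + 1) (1 + cg L x) &&
    (if Nat.beq x y then Nat.ble 2 (Us.count x)
     else Nat.ble 1 (Us.count x) && Nat.ble 1 (Us.count y))

def kill (L : List ℕ) (a b : ℕ) (Us As : List ℕ) : Bool :=
  Nat.ble 3 (As.countP (fun x => Nat.ble (x + 1) 4)) ||
  Nat.ble 2 (As.countP (fun x => Nat.ble (x + 1) 3)) ||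
  Nat.ble 1 (As.countP (fun x => Nat.ble (x + 1) 2)) ||
  Us.any (fun u => Nat.ble (u + 1) (cg L u) ||
    As.any (fun x => Nat.ble (x + 1) (1 + cg L u) || Nat.ble (u + 2) x)) ||
  k4 L Us a b || k4 L Us b a ||
  (Nat.beq a b && ((Nat.ble 3 (Us.count a) && Nat.ble (a + 1) (2 + cg L a)) ||
    (Nat.ble 4 (Us.count a) && Nat.ble a 2)))

def search (L : List ℕ) (a b : ℕ) : List ℕ → List ℕ → List ℕ → Bool
  | [], Us, As => kill L a b Us As
  | v :: r, Us, As => kill L a b Us As || (search L a b r (v :: Us) As && search L a b r Us (v :: As))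

def adjB (c i j : ℕ) : Bool :=
  (Nat.ble (i + 1) j && Nat.testBit c (8 * i + j)) ||
    (Nat.ble (j + 1) i && Nat.testBit c (8 * j + i))

def degB (l c i : ℕ) : ℕ := (List.range l).countP (adjB c i)

def isCyc (l c r : ℕ) (p : List ℕ) : Bool :=
  Nat.beq p.length r && decide p.Nodup && p.all (fun x => Nat.ble (x + 1) l) &&
    (List.range r).all (fun k => adjB c (p.getD k 0) (p.getD ((k + 1) % r) 0))

def hasCyc (l c r : ℕ) : Bool :=
  (List.range l).any (fun i => isCyc l c r ((List.range r).map (fun k => (i + k) % l))) ||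
    isCyc l c r [2, 3, 6, 7, 0]

def good (l c : ℕ) : Bool :=
  (List.range (l + 1)).all (fun r => Nat.ble r 2 || hasCyc l c r)

def egB (L : List ℕ) : Bool :=
  (List.range L.length).all (fun k => Nat.ble (L.drop k).sum
    ((L.length - k) * (L.length - k - 1) + ((L.take k).map (fun x => min x (L.length - k))).sum))

def pre (L : List ℕ) : Bool :=
  Nat.beq (L.sum % 2) 1 || search L 100 100 L [] [] || !(egB L)

def okc (l : ℕ) (L : List ℕ) (c : ℕ × ℕ × ℕ) : Bool :=
  List.isPerm ((List.range l).map (degB l c.1)) L &&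
    (good l c.1 ||
      (Nat.ble (c.2.1 + 1) l && Nat.ble (c.2.2 + 1) l && !(Nat.beq c.2.1 c.2.2) &&
        !(adjB c.1 c.2.1 c.2.2) &&
        search L (degB l c.1 c.2.1) (degB l c.1 c.2.2) L [] []))

def go (l : ℕ) : List (List ℕ) → List (ℕ × ℕ × ℕ) → Bool
  | [], _ => true
  | L :: Ls, [] => pre L && go l Ls []
  | L :: Ls, c :: cs => if pre L then go l Ls (c :: cs) else okc l L c && go l Ls cs

def asc (l : ℕ) : ℕ → ℕ → List (List ℕ)
  | 0, _ => [[]]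
  | k + 1, lo => (List.range' lo (l - lo)).flatMap (fun v => (asc l k v).map (fun t => v :: t))

def certs7 : List (ℕ × ℕ × ℕ) := [
  (0,0,6), (70368744177664,0,4), (70369012613120,0,2), (275414778880,0,6),
  (138516889602,0,5), (275953762368,0,5), (70644700037184,0,5), (70369282113600,0,4),
  (70644700028992,0,4), (70506184181824,0,3), (413392715840,0,3), (70782138990656,0,3),
  (70507257413648,0,2), (70644431601728,0,2), (70644160005128,2,6), (70782138975240,0,1),
  (70645237956672,0,1), (412857928768,1,5), (70644698468416,0,5), (70369818456084,0,6),
  (70781065758786,0,5), (70644970569794,0,5), (139050632288,0,4), (70782141087754,0,4),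
  (70781065781288,0,4), (70644970578016,0,4), (70782673765472,0,4), (70782677966944,0,4),
  (70506991060034,0,0), (70782407427168,0,3), (70644433707088,0,3), (70782409531488,0,3),
  (70781330007106,0,0), (70506452114498,0,0), (70508062712898,0,0), (70782676394064,0,2),
  (70645507448880,0,2), (70782946402400,0,2), (70506457334858,0,0), (70506452122690,0,0),
  (70506458383438,0,0), (70645508497504,0,1), (70506988979282,0,0), (70782403757154,0,0),
  (70508063753286,0,0), (70781331051610,0,0), (70782404805714,0,0), (70782678495328,0,4),
  (70507527949386,0,0), (70506453146730,0,0), (70781335245938,0,0), (70781336302674,0,0),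
  (70781337338990,0,0), (70506454203502,0,0), (70782409014338,0,0), (70782411080798,0,0),
  (70508070071362,0,0), (70781332120662,0,0), (70508066909262,0,0), (70782942708830,0,0),
  (70782409004122,0,0), (70506459456630,0,0), (70507531099222,0,0), (70782409004126,0,0),
  (70781333173366,0,0), (70507532151918,0,0), (70782947951742,0,0), (70507527933010,0,0),
  (70506459434054,0,0), (70506988985414,0,0), (70506453171282,0,0), (70781336292450,0,0),
  (70782407955554,0,0), (70508062727238,0,0), (70782411097158,0,0), (70506459440238,0,0),
  (70782947455088,0,3), (70508067949650,0,0), (70782407963718,0,0), (70506453163130,0,0),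
  (70506996311150,0,0), (70506457353322,0,0), (70782406892626,0,0), (70782941684818,0,0),
  (70781874218086,0,0), (70781336321094,0,0), (70782411101270,0,0), (70508065854558,0,0),
  (70508064828538,0,0), (70782411082846,0,0), (70781336308842,0,0), (70781872116858,0,0),
  (70507530054774,0,0), (70782946921550,0,0), (70781874230374,0,0), (70508062735486,0,0),
  (70508065864790,0,0), (70782942723194,0,0), (70781874240586,0,0), (70782945877086,0,0),
  (70781871074390,0,0), (70506996321366,0,0), (70781873173582,0,0), (70508063771774,0,0),
  (70781333163134,0,0), (70781337345150,0,0), (70781873175630,0,0), (70782406892670,0,0),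
  (70781874222206,0,0), (70781874234490,0,0), (70782942735486,0,0), (70782406915182,0,0),
  (70782947961978,0,0), (70782409014398,0,0), (70782411095150,0,0), (70782947966074,0,0),
  (70782945885310,0,0), (70782947982462,0,0)
  ]

def certs8 : List (ℕ × ℕ × ℕ) := [
  (0,0,7), (36028797018963968,0,5), (141012366262272,0,3), (275423166464,0,1),
  (70369021001730,0,7), (36028799174844432,0,6), (70920655896704,0,6), (36170086419038336,0,6),
  (36099167910629380,0,5), (36028936613822528,0,5), (36170086414844032,0,5), (36099166039974016,0,4),
  (36239903528353920,0,4), (36240455163216000,0,4), (141563195819040,0,3), (36169673028435984,0,3),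
  (211933022158976,0,3), (70919850565760,0,2), (36169675175919632,0,2), (36170361833816192,0,2),
  (36169809654187040,2,7), (36170222776385540,0,1), (36170087487537280,0,1), (36029347586408450,1,6),
  (211657071038592,0,6), (36170086689587328,0,6), (36029347313751112,0,7), (36029350006493218,0,6),
  (36170085615829122,0,6), (70508343246872,0,5), (141427908591748,0,5), (36240456236958864,0,5),
  (141564275900488,0,5), (36170085617934528,0,5), (36240730033243328,0,5), (36170362372800704,0,5),
  (36240731110671552,0,5), (36240731119075520,0,5), (36029212024407200,0,4), (36240043921145986,0,4),
  (36170359682678944,0,4), (36240730043222208,0,4), (211934098014400,0,4), (36240730582204608,0,4),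
  (36099304544797830,0,0), (36099992545960096,0,3), (36170224399061184,0,3), (36099305618572426,0,0),
  (36170224935907520,0,3), (211796661129408,0,3), (36240730582204560,0,3), (36240866410531008,0,3),
  (36240868558028992,0,3), (36099303475287170,0,0), (36099303471056118,0,0), (36099578355254466,0,0),
  (36170224667508928,0,2), (36170499276949696,0,2), (36240593948557504,0,2), (36240040959427730,0,0),
  (36099305622736010,0,0), (36099579426915522,0,0), (36099855375402178,0,0), (36099855384872066,0,0),
  (36099855375434898,0,0), (36240731116445888,0,1), (36240044193792192,0,1), (36240731389608128,0,1),
  (36099303479452882,0,0), (36099578887939234,0,0), (36240591256290466,0,0), (36240040959411454,0,0),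
  (36099306155410654,0,0), (36240731121162432,0,5), (36099306692293826,0,0), (36099581576479938,0,0),
  (36099855379598474,0,0), (36099305618603170,0,0), (36099303483645082,0,0), (36099305619635334,0,0),
  (36240043109041294,0,0), (36099303486809238,0,0), (36099856989160622,0,0), (36099303486817526,0,0),
  (36099579962746002,0,0), (36100130257540246,0,0), (36240044728026314,0,0), (36240044719615150,0,0),
  (36099307231259886,0,0), (36240040966796466,0,0), (36240318521736330,0,0), (36240594474425474,0,0),
  (36240594481773698,0,0), (36240593408015530,0,0), (36099578363671730,0,0), (36240042582607102,0,0),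
  (36100131878601866,0,0), (36240044719631594,0,0), (36240590730994870,0,0), (36240043655335086,0,0),
  (36240044195359938,0,0), (36240869366989954,0,0), (36099306170133678,0,0), (36100128120558806,0,0),
  (36240869355486338,0,0), (36240865608922306,0,0), (36240044185879730,0,0), (36099853231119502,0,0),
  (36099581033374930,0,0), (36099304556395650,0,0), (36100129184869506,0,0), (36099579426923774,0,0),
  (36099855385898126,0,0), (36240591254240422,0,0), (36240592874249366,0,0), (36099579963788542,0,0),
  (36099304552150234,0,0), (36100131331251350,0,0), (36099306692343034,0,0), (36240865608873110,0,0),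
  (36240594473331962,0,0), (36240865608901810,0,0), (36240044728052906,0,0), (36240592865864886,0,0),
  (36099306171202690,0,0), (36240043117427894,0,0), (36240044717571258,0,0), (36099307235503338,0,0),
  (36240042574277870,0,0), (36100131337563266,0,0), (36099307241778350,0,0), (36240044730115246,0,0),
  (36240593948048514,0,0), (36100128114275574,0,0), (36240043658489038,0,0), (36240594473385146,0,0),
  (36240868277550266,0,0), (36240044732247238,0,0), (36240868277515482,0,0), (36100131331284126,0,0),
  (36099579966930106,0,0), (36099579429027070,0,0), (36240593409055934,0,0), (36240865600529654,0,0),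
  (36100129192205534,0,0), (36240869351288058,0,0), (36099855922805950,0,0), (36100131339689182,0,0),
  (36099304546927762,0,0), (36099853226896518,0,0), (36100128642700434,0,0), (36099853227943050,0,0),
  (36099307230203014,0,0), (36099303471113374,0,0), (36240867741668498,0,0), (36099855389066374,0,0),
  (36240731656995010,0,5), (36099303480501482,0,0), (36099303479508106,0,0), (36099306155427006,0,0),
  (36240041503630502,0,0), (36240041500490890,0,0), (36240592876373138,0,0), (36240592877397126,0,0),
  (36240868558561504,0,4), (36170500352827616,0,4), (36240869097005280,0,4), (36099578894238874,0,0),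
  (36240317986923682,0,0), (36099305619598570,0,0), (36240316376300706,0,0), (36099304549053642,0,0),
  (36099307229154558,0,0), (36099855919615210,0,0), (36100129178522878,0,0), (36099579438437586,0,0),
  (36240869095956704,0,3), (36240044189029526,0,0), (36100130255410386,0,0), (36099855911228654,0,0),
  (36240040961520894,0,0), (36099303485762738,0,0), (36099303474265254,0,0), (36240866671072498,0,0),
  (36240867750098066,0,0), (36240867749065874,0,0), (36240869365440736,0,2), (36099305623803050,0,0),
  (36240044718574738,0,0), (36240592869018762,0,0), (36099306708034694,0,0), (36099853236337874,0,0),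
  (36240867750089906,0,0), (36099304560579746,0,0), (36099579431113982,0,0), (36099854841695454,0,0),
  (36099582111284426,0,0), (36099581583852714,0,0), (36099304009039090,0,0), (36240315838422230,0,0),
  (36240866682606742,0,0), (36240319597520122,0,0), (36100128120509694,0,0), (36240044721732834,0,0),
  (36240594475482250,0,0), (36100131326031006,0,0), (36100129722746074,0,0), (36240043643821246,0,0),
  (36240593415351430,0,0), (36240044723815678,0,0), (36240591267871890,0,0), (36240319067985102,0,0),
  (36099305634319566,0,0), (36099582114407606,0,0), (36099307243895946,0,0), (36240044195380386,0,0),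
  (36100129194300630,0,0), (36240317455301778,0,0), (36099582107090174,0,0), (36240316918428918,0,0),
  (36100131341786250,0,0), (36099306698613914,0,0), (36100130792281298,0,0), (36240592868000970,0,0),
  (36240319600659658,0,0), (36099305086962866,0,0), (36240044180649214,0,0), (36099581582789818,0,0),
  (36240319608016074,0,0), (36099304549055734,0,0), (36100129183825106,0,0), (36100129717499038,0,0),
  (36240868821714130,0,0), (36240594483817670,0,0), (36099582113414282,0,0), (36240593402786994,0,0),
  (36100129194263806,0,0), (36099306160682218,0,0), (36240316921609362,0,0), (36100130791242934,0,0),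
  (36240041506831542,0,0), (36099581585951950,0,0), (36240866682623190,0,0), (36099304019520750,0,0),
  (36240593415351466,0,0), (36240869353385186,0,0), (36240319072208058,0,0), (36240592338484358,0,0),
  (36099856459644062,0,0), (36100129191165142,0,0), (36240869362777234,0,0), (36240594484898990,0,0),
  (36099579969068254,0,0), (36099582113381626,0,0), (36240868293217470,0,0), (36099854840657102,0,0),
  (36099307240725690,0,0), (36240319597550834,0,0), (36240593950145698,0,0), (36099306167008438,0,0),
  (36099582113373438,0,0), (36240593944870138,0,0), (36100131338648790,0,0), (36240319599656186,0,0),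
  (36240594473385214,0,0), (36240865608920306,0,0), (36240316389979382,0,0), (36240869366990074,0,0),
  (36099579966979326,0,0), (36099306160702642,0,0), (36099580498605198,0,0), (36099855379623090,0,0),
  (36100129181709466,0,0), (36099855925953686,0,0), (36240592871161030,0,0), (36099855386981610,0,0),
  (36240316376343742,0,0), (36240593943825550,0,0), (36100128646954194,0,0), (36240590720519354,0,0),
  (36099579438476438,0,0), (36099853777433754,0,0), (36240319598587050,0,0), (36240592874292446,0,0),
  (36100129720696018,0,0), (36240593410096330,0,0), (36240867753262290,0,0), (36100129194267902,0,0),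
  (36099306705958070,0,0), (36099856995470558,0,0), (36099579434296542,0,0), (36240867753262306,0,0),
  (36240319608046814,0,0), (36240042585763070,0,0), (36100131866049762,0,0), (36240044733271230,0,0),
  (36240868283796630,0,0), (36099853776377086,0,0), (36099582111300790,0,0), (36100129194298598,0,0),
  (36099856449207542,0,0), (36240044728007934,0,0), (36240043122685162,0,0), (36240868819653878,0,0),
  (36240868830139606,0,0), (36240592330091774,0,0), (36099582122794238,0,0), (36099855918595262,0,0),
  (36100130265955574,0,0), (36100130266983666,0,0), (36240869352303790,0,0), (36100130796498106,0,0),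
  (36240869357546738,0,0), (36240868287999166,0,0), (36240594483870962,0,0), (36100131870239926,0,0),
  (36240867756387574,0,0), (36240319610121470,0,0), (36240868284865726,0,0), (36100131878640862,0,0),
  (36240593943837886,0,0), (36240593406983358,0,0), (36240319610154238,0,0), (36240319061734606,0,0),
  (36240591792176334,0,0), (36240044188024050,0,0), (36100131341757670,0,0), (36099580512238826,0,0),
  (36240594489089230,0,0), (36240866144734458,0,0), (36240866682617054,0,0), (36240867756407966,0,0),
  (36240317462658294,0,0), (36240868828017918,0,0), (36240594489093374,0,0), (36099582122835186,0,0),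
  (36240869365937390,0,0), (36240043659558142,0,0), (36240317461626046,0,0), (36100130804923582,0,0),
  (36240869366979838,0,0), (36240594486983926,0,0), (36240869362822366,0,0), (36240868291181822,0,0),
  (36240867219537150,0,0), (36240869367020798,0,0)
  ]

theorem check7 : go 7 (asc 7 7 0) certs7 = true := by decide +kernel

theorem check8 : go 8 (asc 8 8 0) certs8 = true := by decide +kernel

theorem go_sound (l : ℕ) : ∀ (Ls : List (List ℕ)) (cs : List (ℕ × ℕ × ℕ)), go l Ls cs = true →
    ∀ L ∈ Ls, pre L = true ∨ ∃ c, okc l L c = true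
  | [], _, _, L, h => by simp at h
  | L :: Ls, [], h, M, hM => by
    simp only [go, Bool.and_eq_true] at h
    rcases List.mem_cons.1 hM with rfl | hM
    · exact Or.inl h.1
    · exact go_sound l Ls [] h.2 M hM
  | L :: Ls, c :: cs, h, M, hM => by
    simp only [go] at h
    by_cases hp : pre L = true
    · rw [if_pos hp] at h
      rcases List.mem_cons.1 hM with rfl | hM
      · exact Or.inl hp
      · exact go_sound l Ls (c :: cs) h M hM
    · rw [if_neg hp, Bool.and_eq_true] at h
      rcases List.mem_cons.1 hM with rfl | hM
      · exact Or.inr ⟨c, h.1⟩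
      · exact go_sound l Ls cs h.2 M hM

theorem asc_mem (l : ℕ) : ∀ (k lo : ℕ) (L : List ℕ), L.length = k → L.Pairwise (· ≤ ·) →
    (∀ x ∈ L, lo ≤ x ∧ x < l) → L ∈ asc l k lo
  | 0, lo, L, hl, _, _ => by
    have : L = [] := List.length_eq_zero_iff.1 hl
    simp [asc, this]
  | k + 1, lo, [], hl, _, _ => by simp at hl
  | k + 1, lo, v :: t, hl, hs, hb => by
    simp only [asc, List.mem_flatMap, List.mem_map]
    have hv := hb v (by simp)
    refine ⟨v, ?_, t, ?_, rfl⟩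
    · rw [List.mem_range'_1]; omega
    · apply asc_mem l k v t (by simpa using hl) (List.pairwise_cons.1 hs).2
      intro x hx
      exact ⟨(List.pairwise_cons.1 hs).1 x hx, (hb x (by simp [hx])).2⟩

/-- the label search is sound -/
theorem search_sound {V : Type*} (f : V → ℕ) (U A : V → Prop) (L : List ℕ) (a b : ℕ)
    (hk : ∀ us as : List V, us.Nodup → as.Nodup → (∀ u ∈ us, U u) → (∀ u ∈ as, A u) →
      kill L a b (us.map f) (as.map f) = false) :
    ∀ (rest us as : List V), (∀ v ∈ rest, U v ∨ A v) → (rest ++ us).Nodup → (rest ++ as).Nodup →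
      (∀ u ∈ us, U u) → (∀ u ∈ as, A u) →
      search L a b (rest.map f) (us.map f) (as.map f) = false
  | [], us, as, _, h1, h2, h3, h4 => by
    simp only [List.map_nil, search]
    exact hk us as (by simpa using h1) (by simpa using h2) h3 h4
  | v :: r, us, as, h0, h1, h2, h3, h4 => by
    simp only [List.map_cons, search]
    have hk0 := hk us as (List.Nodup.of_append_right h1) (List.Nodup.of_append_right h2) h3 h4
    rw [hk0, Bool.false_or]
    have e1 : (r ++ v :: us).Nodup := (List.perm_middle.nodup_iff).2 (by simpa using h1)
    have e2 : (r ++ v :: as).Nodup := (List.perm_middle.nodup_iff).2 (by simpa using h2)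
    have h0' : ∀ v ∈ r, U v ∨ A v := fun w hw => h0 w (List.mem_cons_of_mem _ hw)
    rcases h0 v (by simp) with hv | hv
    · have := search_sound f U A L a b hk r (v :: us) as h0' e1 (List.nodup_cons.1 h2).2
        (by simpa using ⟨hv, h3⟩) h4
      simp only [List.map_cons] at this
      rw [this, Bool.false_and]
    · have := search_sound f U A L a b hk r us (v :: as) h0' (List.nodup_cons.1 h1).2 e2 h3
        (by simpa using ⟨hv, h4⟩)
      simp only [List.map_cons] at this
      rw [this, Bool.and_false]

/-- rearranging a list to match a permuted list of values -/
theorem perm_lift {V : Type*} (f : V → ℕ) {l m : List ℕ} (h : l.Perm m) :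
    ∀ vs : List V, vs.map f = m → ∃ ws : List V, ws.Perm vs ∧ ws.map f = l := by
  induction h with
  | nil => intro vs hv; exact ⟨vs, List.Perm.refl _, hv⟩
  | cons x _ ih =>
    intro vs hv
    rcases vs with _ | ⟨v, vs⟩
    · simp at hv
    · simp only [List.map_cons, List.cons.injEq] at hv
      obtain ⟨ws, h1, h2⟩ := ih vs hv.2
      exact ⟨v :: ws, h1.cons v, by simp [h2, hv.1]⟩
  | swap x y l =>
    intro vs hv
    rcases vs with _ | ⟨v, _ | ⟨w, vs⟩⟩
    · simp at hv
    · simp at hv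
    · simp only [List.map_cons, List.cons.injEq] at hv
      exact ⟨w :: v :: vs, List.Perm.swap _ _ _, by simp [hv]⟩
  | trans _ _ ih1 ih2 =>
    intro vs hv
    obtain ⟨ws, h1, h2⟩ := ih2 vs hv
    obtain ⟨xs, h3, h4⟩ := ih1 ws h2
    exact ⟨xs, h3.trans h1, h4⟩

/-- the certificate graph -/
def cgraph (l c : ℕ) : SimpleGraph (Fin l) where
  Adj i j := adjB c i j = true
  symm := ⟨fun i j h => by
    simp only [adjB, Bool.or_eq_true] at h ⊢
    exact h.symm⟩
  loopless := ⟨fun i h => by simp [adjB] at h⟩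

theorem degB_eq (l c : ℕ) (i : Fin l) [DecidablePred fun j : Fin l => (cgraph l c).Adj i j] :
    (Finset.univ.filter (fun j => (cgraph l c).Adj i j)).card = degB l c i := by
  unfold degB
  rw [← List.map_coe_finRange_eq_range, List.countP_map, List.countP_eq_length_filter]
  rw [← List.toFinset_card_of_nodup ((List.nodup_finRange l).filter _)]
  congr 1
  ext j
  rw [Finset.mem_filter]
  simp [cgraph]

theorem isCyc_sound {l c r : ℕ} (hr : 3 ≤ r) {p : List ℕ} (h : isCyc l c r p = true) :
    (SimpleGraph.cycleGraph r).IsContained (cgraph l c) := by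
  simp only [isCyc, Bool.and_eq_true, decide_eq_true_eq, List.all_eq_true, Nat.ble_eq,
    List.mem_range] at h
  obtain ⟨⟨⟨h1, h2⟩, h3⟩, h4⟩ := h
  replace h1 : p.length = r := Nat.eq_of_beq_eq_true h1
  have hlt : ∀ k : Fin r, p.getD k 0 < l := by
    intro k
    have hk : (k : ℕ) < p.length := by rw [h1]; exact k.2
    rw [List.getD_eq_getElem _ _ hk]
    exact h3 _ (List.getElem_mem _)
  obtain ⟨m, rfl⟩ : ∃ m, r = m + 2 := ⟨r - 2, by omega⟩
  refine ⟨⟨⟨fun k => ⟨p.getD k 0, hlt k⟩, ?_⟩, ?_⟩⟩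
  · have key : ∀ i j : Fin (m + 2), j = i + 1 →
        (cgraph l c).Adj ⟨p.getD i 0, hlt i⟩ ⟨p.getD j 0, hlt j⟩ := by
      intro i j hij
      have := h4 i i.2
      subst hij
      simpa [cgraph, Fin.val_add] using this
    intro i j hij
    rw [SimpleGraph.cycleGraph_adj] at hij
    rcases hij with hij | hij
    · exact (key j i (by rw [← hij, add_sub_cancel])).symm
    · exact key i j (by rw [← hij, add_sub_cancel])
  · intro i j hij
    have hi : (i : ℕ) < p.length := by rw [h1]; exact i.2
    have hj : (j : ℕ) < p.length := by rw [h1]; exact j.2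
    have hij' : p.getD i 0 = p.getD j 0 := by simpa using hij
    rw [List.getD_eq_getElem _ _ hi, List.getD_eq_getElem _ _ hj] at hij'
    exact Fin.ext ((h2.getElem_inj_iff).1 hij')

theorem good_sound {l c r : ℕ} (h : good l c = true) (hr : 3 ≤ r) (hrl : r ≤ l) :
    (SimpleGraph.cycleGraph r).IsContained (cgraph l c) := by
  simp only [good, List.all_eq_true, List.mem_range, Bool.or_eq_true, Nat.ble_eq] at h
  rcases h r (by omega) with h | h
  · omega
  · simp only [hasCyc, Bool.or_eq_true, List.any_eq_true] at h
    rcases h with ⟨i, _, h⟩ | h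
    · exact isCyc_sound hr h
    · exact isCyc_sound hr h

section graph

open Classical

set_option linter.unusedSectionVars false

variable {V : Type*} [Fintype V]

/-- degree inside `T` -/
noncomputable def fdeg (G : SimpleGraph V) (T : Finset V) (t : V) : ℕ :=
  (T.filter (fun x => G.Adj t x)).card

/-- neighbours outside `T` -/
noncomputable def Qs (G : SimpleGraph V) (T : Finset V) (t : V) : Finset V :=
  Finset.univ.filter (fun x => x ∉ T ∧ G.Adj t x)

noncomputable def dg (G : SimpleGraph V) (v : V) : ℕ :=
  (Finset.univ.filter (fun x => G.Adj v x)).card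

theorem mem_Qs {G : SimpleGraph V} {T : Finset V} {t x : V} :
    x ∈ Qs G T t ↔ x ∉ T ∧ G.Adj t x := by simp [Qs]

theorem dg_eq (G : SimpleGraph V) (T : Finset V) (t : V) :
    dg G t = fdeg G T t + (Qs G T t).card := by
  unfold dg fdeg Qs
  rw [← Finset.card_union_of_disjoint]
  · congr 1; ext x; simp; tauto
  · rw [Finset.disjoint_left]; intro x; simp; tauto

noncomputable def Phi (G : SimpleGraph V) (T : Finset V) : ℤ :=
  ∑ t ∈ T, (fdeg G T t : ℤ) * (2 * T.card - fdeg G T t)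

/-- extremal realizations -/
def Ext (G : SimpleGraph V) (T : Finset V) (d : V → ℕ) : Prop :=
  (∀ v, dg G v = d v) ∧ ∀ G' : SimpleGraph V, (∀ v, dg G' v = d v) → Phi G' T ≤ Phi G T

theorem exists_ext (T : Finset V) (d : V → ℕ) (G : SimpleGraph V) (hG : ∀ v, dg G v = d v) :
    ∃ G, Ext G T d := by
  obtain ⟨G', hG', hmax⟩ := Set.exists_max_image {G : SimpleGraph V | ∀ v, dg G v = d v}
    (fun G => Phi G T) (Set.toFinite _) ⟨G, hG⟩
  exact ⟨G', hG', fun G'' h => hmax G'' h⟩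

def swp (G : SimpleGraph V) (p q r s : V) (hpr : p ≠ r) (hqs : q ≠ s) : SimpleGraph V where
  Adj x y := (G.Adj x y ∧ s(x, y) ≠ s(p, q) ∧ s(x, y) ≠ s(r, s)) ∨ s(x, y) = s(p, r) ∨
    s(x, y) = s(q, s)
  symm := ⟨fun x y h => by rw [Sym2.eq_swap, G.adj_comm]; exact h⟩
  loopless := ⟨fun x h => by
    rcases h with h | h | h
    · exact G.loopless.irrefl x h.1
    · rw [Sym2.eq_iff] at h; exact hpr (by grind)
    · rw [Sym2.eq_iff] at h; exact hqs (by grind)⟩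

section swap
variable {G : SimpleGraph V} {p q r s : V} (hpr : p ≠ r) (hqs : q ≠ s)

theorem swp_p (h1 : G.Adj p q) (h2 : G.Adj r s) (hps : p ≠ s) (x : V) :
    (swp G p q r s hpr hqs).Adj p x ↔ (G.Adj p x ∧ x ≠ q) ∨ x = r := by
  have := h1.ne; have := h2.ne
  simp only [swp, ne_eq, Sym2.eq_iff]
  grind

theorem swp_symm1 : swp G p q r s hpr hqs = swp G q p s r hqs hpr := by
  ext x y
  simp only [swp, ne_eq, Sym2.eq_iff]
  grind

theorem swp_symm2 : swp G p q r s hpr hqs = swp G r s p q hpr.symm hqs.symm := by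
  ext x y
  simp only [swp, ne_eq, Sym2.eq_iff]
  grind

theorem swp_other {v : V} (h1 : v ≠ p) (h2 : v ≠ q) (h3 : v ≠ r) (h4 : v ≠ s) (x : V) :
    (swp G p q r s hpr hqs).Adj v x ↔ G.Adj v x := by
  simp only [swp, ne_eq, Sym2.eq_iff]
  grind

/-- effect on the number of neighbours in `S` -/
theorem cnt_change {S : Finset V} {N N' : V → Prop} {q r : V} (hr : ¬ N r) (hq : N q)
    (h : ∀ x, N' x ↔ (N x ∧ x ≠ q) ∨ x = r) :
    ((S.filter N').card + (if q ∈ S then 1 else 0) = (S.filter N).card + (if r ∈ S then 1 else 0)) := by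
  have hqr : q ≠ r := by rintro rfl; exact hr hq
  have e1 : (S.filter N').card = ((S.filter N).erase q).card + (if r ∈ S then 1 else 0) := by
    split_ifs with hrS
    · rw [← Finset.card_insert_of_notMem (a := r)]
      · congr 1; ext x; simp only [Finset.mem_filter, Finset.mem_insert, Finset.mem_erase, h]
        grind
      · simp [hr]
    · rw [add_zero]; congr 1; ext x; simp only [Finset.mem_filter, Finset.mem_erase, h]
      grind
  rw [e1]
  have e2 : ((S.filter N).erase q).card + (if q ∈ S then 1 else 0) = (S.filter N).card := by
    split_ifs with hqS
    · exact Finset.card_erase_add_one (by simp [hqS, hq])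
    · rw [Finset.erase_eq_of_notMem (by simp [hqS]), add_zero]
  omega

theorem swp_cnt (h1 : G.Adj p q) (h2 : G.Adj r s) (h3 : ¬ G.Adj p r) (h4 : ¬ G.Adj q s)
    (hps : p ≠ s) (hqr : q ≠ r) (S : Finset V) :
    ((fdeg (swp G p q r s hpr hqs) S p + (if q ∈ S then 1 else 0) = fdeg G S p + (if r ∈ S then 1 else 0)) ∧
    (fdeg (swp G p q r s hpr hqs) S q + (if p ∈ S then 1 else 0) = fdeg G S q + (if s ∈ S then 1 else 0)) ∧
    (fdeg (swp G p q r s hpr hqs) S r + (if s ∈ S then 1 else 0) = fdeg G S r + (if p ∈ S then 1 else 0)) ∧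
    (fdeg (swp G p q r s hpr hqs) S s + (if r ∈ S then 1 else 0) = fdeg G S s + (if q ∈ S then 1 else 0))) ∧
    ∀ v, v ≠ p → v ≠ q → v ≠ r → v ≠ s → fdeg (swp G p q r s hpr hqs) S v = fdeg G S v := by
  unfold fdeg
  refine ⟨⟨?_, ?_, ?_, ?_⟩, ?_⟩
  · exact cnt_change h3 h1 (swp_p hpr hqs h1 h2 hps)
  · rw [swp_symm1]
    exact cnt_change h4 h1.symm (swp_p hqs hpr h1.symm h2.symm hqr)
  · rw [swp_symm2]
    exact cnt_change (fun h => h3 h.symm) h2 (swp_p hpr.symm hqs.symm h2 h1 hqr.symm)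
  · rw [swp_symm1, swp_symm2]
    exact cnt_change (fun h => h4 h.symm) h2.symm
      (swp_p hqs.symm hpr.symm h2.symm h1.symm hps.symm)
  · intro v e1 e2 e3 e4
    congr 1
    ext x
    simp only [Finset.mem_filter, swp_other hpr hqs e1 e2 e3 e4]

theorem swp_dg (h1 : G.Adj p q) (h2 : G.Adj r s) (h3 : ¬ G.Adj p r) (h4 : ¬ G.Adj q s)
    (hps : p ≠ s) (hqr : q ≠ r) (v : V) : dg (swp G p q r s hpr hqs) v = dg G v := by
  have h := swp_cnt hpr hqs h1 h2 h3 h4 hps hqr Finset.univ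
  simp only [Finset.mem_univ, if_true] at h
  obtain ⟨⟨a, b, c, e⟩, k⟩ := h
  change fdeg _ Finset.univ v = fdeg _ Finset.univ v
  by_cases e1 : v = p
  · subst e1; omega
  by_cases e2 : v = q
  · subst e2; omega
  by_cases e3 : v = r
  · subst e3; omega
  by_cases e4 : v = s
  · subst e4; omega
  exact k v e1 e2 e3 e4

end swap

theorem fdeg_lt (G : SimpleGraph V) {T : Finset V} {t : V} (ht : t ∈ T) :
    fdeg G T t < T.card := by
  apply Finset.card_lt_card
  refine ⟨Finset.filter_subset _ _, fun h => ?_⟩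
  have := h ht
  simp at this

variable {G : SimpleGraph V} {T : Finset V} {d : V → ℕ}

theorem M1 (hE : Ext G T d) {u v x y : V} (hu : u ∈ T) (hv : v ∈ T) (huv : u ≠ v)
    (hadj : ¬ G.Adj u v) (hx : x ∈ Qs G T u) (hy : y ∈ Qs G T v) (hxy : x ≠ y) : G.Adj x y := by
  by_contra hn
  rw [mem_Qs] at hx hy
  have huy : u ≠ y := by rintro rfl; exact hy.1 hu
  have hxv : x ≠ v := by rintro rfl; exact hx.1 hv
  have hd := swp_dg huv hxy hx.2 hy.2 hadj hn huy hxv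
  have hle := hE.2 (swp G u x v y huv hxy) (fun w => (hd w).trans (hE.1 w))
  obtain ⟨⟨c1, _, c3, _⟩, c5⟩ := swp_cnt huv hxy hx.2 hy.2 hadj hn huy hxv T
  simp only [hx.1, hy.1, hu, hv, if_true, if_false, add_zero] at c1 c3
  have key : ∀ w : V, w ∈ T → fdeg (swp G u x v y huv hxy) T w = fdeg G T w + 1 →
      (fdeg G T w : ℤ) * (2 * T.card - fdeg G T w) <
      (fdeg (swp G u x v y huv hxy) T w : ℤ) * (2 * T.card - fdeg (swp G u x v y huv hxy) T w) := by
    intro w hw e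
    rw [e]
    have := fdeg_lt G hw
    push_cast
    zify at this
    nlinarith
  refine absurd hle (not_le.2 ?_)
  apply Finset.sum_lt_sum
  · intro w hw
    by_cases e1 : w = u
    · subst e1; exact (key w hw c1).le
    by_cases e2 : w = v
    · subst e2; exact (key w hw c3).le
    rw [c5 w e1 (by rintro rfl; exact hx.1 hw) e2 (by rintro rfl; exact hy.1 hw)]
  · exact ⟨u, hu, key u hu c1⟩

theorem star (hE : Ext G T d) {u b x : V} (hu : u ∈ T) (hb : b ∈ T)
    (hf : fdeg G T u + 2 ≤ fdeg G T b) (hx : x ∈ Qs G T u) : x ∈ Qs G T b := by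
  by_contra hn
  rw [mem_Qs] at hx hn
  have hn' : ¬ G.Adj b x := fun h => hn ⟨hx.1, h⟩
  have hub : u ≠ b := by rintro rfl; omega
  obtain ⟨a, ha, ha'⟩ : ∃ a ∈ T.filter (fun x => G.Adj b x),
      a ∉ insert u (T.filter (fun x => G.Adj u x)) := by
    by_contra hcon
    push Not at hcon
    have := Finset.card_le_card (s := T.filter (fun x => G.Adj b x)) hcon
    have h2 := Finset.card_insert_le u (T.filter (fun x => G.Adj u x))
    unfold fdeg at hf
    omega
  simp only [Finset.mem_filter, Finset.mem_insert, not_or, not_and] at ha ha'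
  have hua : ¬ G.Adj u a := ha'.2 ha.1
  have hau : u ≠ a := fun h => ha'.1 h.symm
  have hxb : x ≠ b := by rintro rfl; exact hx.1 hb
  have hxa : x ≠ a := by rintro rfl; exact hx.1 ha.1
  have hxb' : ¬ G.Adj x b := fun h => hn' h.symm
  have hd := swp_dg hau hxb hx.2 ha.2.symm hua hxb' hub hxa
  have hle := hE.2 (swp G u x a b hau hxb) (fun w => (hd w).trans (hE.1 w))
  obtain ⟨⟨c1, _, c3, c4⟩, c5⟩ := swp_cnt hau hxb hx.2 ha.2.symm hua hxb' hub hxa T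
  simp only [hx.1, hb, hu, ha.1, if_true, if_false, add_zero] at c1 c3 c4
  refine absurd hle (not_le.2 ?_)
  unfold Phi
  have hbT : b ∈ T.erase u := Finset.mem_erase.2 ⟨hub.symm, hb⟩
  rw [← Finset.add_sum_erase _ _ hu, ← Finset.add_sum_erase _ _ hbT]
  rw [← Finset.add_sum_erase T _ hu, ← Finset.add_sum_erase (T.erase u) _ hbT]
  have hrest : ∑ w ∈ (T.erase u).erase b, (fdeg G T w : ℤ) * (2 * T.card - fdeg G T w) =
      ∑ w ∈ (T.erase u).erase b, (fdeg (swp G u x a b hau hxb) T w : ℤ) *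
        (2 * T.card - fdeg (swp G u x a b hau hxb) T w) := by
    apply Finset.sum_congr rfl
    intro w hw
    simp only [Finset.mem_erase] at hw
    have : fdeg (swp G u x a b hau hxb) T w = fdeg G T w := by
      by_cases e : w = a
      · subst e; omega
      · exact c5 w hw.2.1 (by rintro rfl; exact hx.1 hw.2.2) e hw.1
    rw [this]
  rw [hrest]
  have c4' : (fdeg G T b : ℤ) = fdeg (swp G u x a b hau hxb) T b + 1 := by exact_mod_cast c4.symm
  have c1' : (fdeg (swp G u x a b hau hxb) T u : ℤ) = fdeg G T u + 1 := by exact_mod_cast c1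
  zify at hf
  rw [c1', c4']
  rw [c4'] at hf
  nlinarith

/-- replace the graph inside `T` -/
def repl (G : SimpleGraph V) (T : Finset V) (H : SimpleGraph V) : SimpleGraph V where
  Adj x y := (x ∈ T ∧ y ∈ T ∧ H.Adj x y) ∨ (¬ (x ∈ T ∧ y ∈ T) ∧ G.Adj x y)
  symm := ⟨fun x y h => by
    rw [G.adj_comm, H.adj_comm]; tauto⟩
  loopless := ⟨fun x h => by
    rcases h with h | h
    · exact H.loopless.irrefl x h.2.2
    · exact G.loopless.irrefl x h.2⟩

theorem repl_Qs (H : SimpleGraph V) (t : V) : Qs (repl G T H) T t = Qs G T t := by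
  ext x
  simp only [mem_Qs, repl]
  tauto

theorem repl_fdeg (H : SimpleGraph V) {t : V} (ht : t ∈ T) :
    fdeg (repl G T H) T t = fdeg H T t := by
  unfold fdeg
  congr 1
  ext x
  rw [Finset.mem_filter, Finset.mem_filter]
  simp only [repl]
  tauto

theorem repl_ext (hE : Ext G T d) (H : SimpleGraph V) (hH : ∀ t ∈ T, fdeg H T t = fdeg G T t) :
    Ext (repl G T H) T d := by
  constructor
  · intro v
    rw [← hE.1 v]
    by_cases hv : v ∈ T
    · rw [dg_eq _ T, dg_eq G T, repl_Qs, repl_fdeg H hv, hH v hv]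
    · unfold dg
      congr 1
      ext x
      simp [repl, hv]
  · have : Phi (repl G T H) T = Phi G T := by
      apply Finset.sum_congr rfl
      intro t ht
      rw [repl_fdeg H ht, hH t ht]
    rw [this]
    exact hE.2

def J (G : SimpleGraph V) (T : Finset V) (u v : V) : Prop :=
  ∀ x ∈ Qs G T u, ∀ y ∈ Qs G T v, x ≠ y → G.Adj x y

noncomputable def Bs (G : SimpleGraph V) (T : Finset V) (t : ℕ) : Finset V :=
  T.filter (fun b => t + 2 ≤ fdeg G T b)

theorem J.symm {u v : V} (h : J G T u v) : J G T v u :=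
  fun x hx y hy hxy => (h y hy x hx hxy.symm).symm

theorem GI0 (hE : Ext G T d) (hO : ∀ x, x ∉ T → ∀ t ∈ T, d x ≤ d t) {u x v : V}
    (hx : x ∈ Qs G T u) (W : Finset V) (hW : ∀ w ∈ W, J G T u w) (hv : v ∈ T) (S : Finset V)
    (hST : S ⊆ T) (hS : ∀ i ∈ S, x ∈ Qs G T i) :
    ((W.biUnion (Qs G T)).erase x).card + S.card ≤ fdeg G T v + (Qs G T v).card := by
  rw [← dg_eq, hE.1 v]
  refine le_trans ?_ (hO x (mem_Qs.1 hx).1 v hv)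
  rw [← hE.1 x, ← Finset.card_union_of_disjoint]
  · apply Finset.card_le_card
    intro y hy
    simp only [Finset.mem_union, Finset.mem_erase, Finset.mem_biUnion] at hy
    simp only [Finset.mem_filter, Finset.mem_univ, true_and]
    rcases hy with ⟨h1, w, hw, h2⟩ | hy
    · exact hW w hw x hx y h2 h1.symm
    · exact (mem_Qs.1 (hS y hy)).2.symm
  · rw [Finset.disjoint_left]
    intro y hy hyS
    simp only [Finset.mem_erase, Finset.mem_biUnion] at hy
    obtain ⟨_, w, _, h2⟩ := hy
    exact (mem_Qs.1 h2).1 (hST hyS)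

theorem GI (hE : Ext G T d) (hO : ∀ x, x ∉ T → ∀ t ∈ T, d x ≤ d t) {u x v : V} (hu : u ∈ T)
    (hx : x ∈ Qs G T u) (W : Finset V) (hW : ∀ w ∈ W, J G T u w) (hv : v ∈ T) (S : Finset V)
    (hST : S ⊆ T) (hS : ∀ i ∈ S, x ∈ Qs G T i) (hSf : ∀ i ∈ S, fdeg G T i ≤ fdeg G T u + 1) :
    ((W.biUnion (Qs G T)).erase x).card + (S.card + (Bs G T (fdeg G T u)).card)
      ≤ fdeg G T v + (Qs G T v).card := by
  have h := GI0 hE hO hx W hW hv (S ∪ Bs G T (fdeg G T u))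
    (Finset.union_subset hST (Finset.filter_subset _ _)) (by
      intro i hi
      rcases Finset.mem_union.1 hi with hi | hi
      · exact hS i hi
      · rw [Bs, Finset.mem_filter] at hi
        exact star hE hu hi.1 hi.2 hx)
  rwa [Finset.card_union_of_disjoint] at h
  rw [Finset.disjoint_left]
  intro i hi hi'
  rw [Bs, Finset.mem_filter] at hi'
  have := hSf i hi
  omega

theorem K1 (hE : Ext G T d) {u a : V} (hu : u ∈ T) (ha : a ∈ T) (hU : (Qs G T u).Nonempty)
    (hA : Qs G T a = ∅) : fdeg G T a ≤ fdeg G T u + 1 := by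
  by_contra hcon
  obtain ⟨x, hx⟩ := hU
  have := star hE hu ha (by omega) hx
  simp [hA] at this

theorem K6 (hE : Ext G T d) (hO : ∀ x, x ∉ T → ∀ t ∈ T, d x ≤ d t) {u a : V} (hu : u ∈ T)
    (ha : a ∈ T) (hU : (Qs G T u).Nonempty) (hA : Qs G T a = ∅) :
    1 + (Bs G T (fdeg G T u)).card ≤ fdeg G T a := by
  obtain ⟨x, hx⟩ := hU
  have := GI hE hO hu hx ∅ (by simp) ha {u} (by simpa using hu) (by simpa using hx) (by simp)
  simpa [hA] using this

theorem K2 (hE : Ext G T d) (hO : ∀ x, x ∉ T → ∀ t ∈ T, d x ≤ d t) {u : V} (hu : u ∈ T)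
    (hU : (Qs G T u).Nonempty) : (Bs G T (fdeg G T u)).card ≤ fdeg G T u := by
  by_cases hall : ∀ b ∈ Bs G T (fdeg G T u), G.Adj u b
  · apply Finset.card_le_card
    intro b hb
    rw [Finset.mem_filter]
    exact ⟨(Finset.mem_filter.1 hb).1, hall b hb⟩
  · push Not at hall
    obtain ⟨b, hb, hub⟩ := hall
    rw [Bs, Finset.mem_filter] at hb
    have hne : u ≠ b := by rintro rfl; omega
    obtain ⟨x, hx⟩ := hU
    have hJ : J G T u b := fun x hx y hy hxy => M1 hE hu hb.1 hne hub hx hy hxy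
    have h := GI hE hO hu hx {b} (by simpa using hJ) hu {u} (by simpa using hu)
      (by simpa using hx) (by simp)
    rw [Finset.singleton_biUnion, Finset.card_singleton] at h
    have hxb := star hE hu hb.1 hb.2 hx
    have h2 : (Qs G T u).card ≤ (Qs G T b).card :=
      Finset.card_le_card (fun y hy => star hE hu hb.1 hb.2 hy)
    rw [Finset.card_erase_of_mem hxb] at h
    have : 0 < (Qs G T b).card := Finset.card_pos.2 ⟨x, hxb⟩
    omega

theorem K4 (hE : Ext G T d) (hO : ∀ x, x ∉ T → ∀ t ∈ T, d x ≤ d t) {u v : V} (hu : u ∈ T)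
    (hv : v ∈ T) (huv : u ≠ v)
    (hU : (Qs G T u).Nonempty) (hJ : J G T u v) (hf : fdeg G T v ≤ fdeg G T u + 1) :
    1 + (Bs G T (fdeg G T u)).card ≤ fdeg G T v := by
  obtain ⟨x, hx⟩ := hU
  by_cases hxv : x ∈ Qs G T v
  · have h := GI hE hO hu hx {v} (by simpa using hJ) hv {u, v} (by grind)
      (by grind) (by grind)
    rw [Finset.singleton_biUnion, Finset.card_pair huv, Finset.card_erase_of_mem hxv] at h
    have : 0 < (Qs G T v).card := Finset.card_pos.2 ⟨x, hxv⟩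
    omega
  · have h := GI hE hO hu hx {v} (by simpa using hJ) hv {u} (by grind)
      (by grind) (by grind)
    rw [Finset.singleton_biUnion, Finset.card_singleton, Finset.erase_eq_of_notMem hxv] at h
    omega

/-- combinatorial core of `K5` -/
theorem three_sets (I : Finset V) (hI : I.card = 3) (Q : V → Finset V)
    (hne : ∀ i ∈ I, (Q i).Nonempty)
    (H : ∀ u ∈ I, ∀ x ∈ Q u, ∀ z ∈ I, (((I.erase u).biUnion Q).erase x).card +
      (I.filter (fun i => x ∈ Q i)).card ≤ 1 + (Q z).card) : False := by
  have hsub : ∀ u ∈ I, ∀ z ∈ I, z ≠ u → Q z ⊆ (I.erase u).biUnion Q := by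
    intro u _ z hz hzu
    exact Finset.subset_biUnion_of_mem Q (Finset.mem_erase.2 ⟨hzu, hz⟩)
  -- the sets are pairwise disjoint
  have hdis : ∀ u ∈ I, ∀ v ∈ I, u ≠ v → ∀ x, x ∈ Q u → x ∉ Q v := by
    intro u hu v hv huv x hxu hxv
    have hmem := hsub u hu v hv huv.symm hxv
    have hpos : 0 < ((I.erase u).biUnion Q).card := Finset.card_pos.2 ⟨x, hmem⟩
    have h2 : ({u, v} : Finset V).card ≤ (I.filter (fun i => x ∈ Q i)).card := by
      apply Finset.card_le_card
      intro i; simp only [Finset.mem_insert, Finset.mem_singleton, Finset.mem_filter]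
      rintro (rfl | rfl) <;> simp [*]
    rw [Finset.card_pair huv] at h2
    have heq : ∀ z ∈ I, z ≠ u → Q z = (I.erase u).biUnion Q := by
      intro z hz hzu
      apply Finset.eq_of_subset_of_card_le (hsub u hu z hz hzu)
      have := H u hu x hxu z hz
      rw [Finset.card_erase_of_mem hmem] at this
      omega
    have hall : I.filter (fun i => x ∈ Q i) = I := by
      apply Finset.filter_true_of_mem
      intro i hi
      by_cases hiu : i = u
      · rw [hiu]; exact hxu
      · rw [heq i hi hiu]; exact hmem
    have h3 := H u hu x hxu v hv
    rw [hall, hI, Finset.card_erase_of_mem hmem, heq v hv huv.symm] at h3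
    omega
  obtain ⟨u, v, w, huv, huw, hvw, rfl⟩ := Finset.card_eq_three.1 hI
  obtain ⟨x, hx⟩ := hne u (by simp)
  obtain ⟨y, hy⟩ := hne w (by simp)
  have h := H u (by simp) x hx v (by simp)
  have hxv := hdis u (by simp) v (by simp) huv x hx
  have hxw := hdis u (by simp) w (by simp) huw x hx
  have hyv := hdis w (by simp) v (by simp) hvw.symm y hy
  have h1 : 1 ≤ (({u, v, w} : Finset V).filter (fun i => x ∈ Q i)).card :=
    Finset.card_pos.2 ⟨u, by simp [hx]⟩
  have h4 : (insert y (Q v)).card ≤ (((({u, v, w} : Finset V).erase u).biUnion Q).erase x).card := by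
    apply Finset.card_le_card
    intro z hz
    simp only [Finset.mem_erase, Finset.mem_biUnion]
    rcases Finset.mem_insert.1 hz with rfl | hz
    · exact ⟨by rintro rfl; exact hxw hy, w, by grind, hy⟩
    · exact ⟨by rintro rfl; exact hxv hz, v, by grind, hz⟩
  rw [Finset.card_insert_of_notMem hyv] at h4
  omega

theorem K5 (hE : Ext G T d) (hO : ∀ x, x ∉ T → ∀ t ∈ T, d x ≤ d t) (I : Finset V) (hIT : I ⊆ T)
    (hI : I.card = 3) (a : ℕ) (ha : ∀ i ∈ I, fdeg G T i = a) (hU : ∀ i ∈ I, (Qs G T i).Nonempty)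
    (hJ : ∀ i ∈ I, ∀ j ∈ I, i ≠ j → J G T i j) : 2 + (Bs G T a).card ≤ a := by
  by_contra hcon
  apply three_sets I hI (Qs G T) hU
  intro u hu x hx z hz
  have h := GI hE hO (hIT hu) hx (I.erase u) (by
    intro w hw
    rw [Finset.mem_erase] at hw
    exact hJ u hu w hw.2 hw.1.symm) (hIT hz) (I.filter (fun i => x ∈ Qs G T i))
    ((Finset.filter_subset _ _).trans hIT) (by intro i hi; exact (Finset.mem_filter.1 hi).2)
    (by intro i hi; rw [ha i (Finset.mem_filter.1 hi).1, ha u hu]; omega)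
  rw [ha u hu, ha z hz] at h
  omega

/-- combinatorial core of `K7` -/
theorem four_sets (I : Finset V) (hI : I.card = 4) (Q : V → Finset V)
    (hne : ∀ i ∈ I, (Q i).Nonempty) (hbig : ∃ i ∈ I, 2 ≤ (Q i).card)
    (H : ∀ u ∈ I, ∀ x ∈ Q u, ∀ z ∈ I, (((I.erase u).biUnion Q).erase x).card +
      (I.filter (fun i => x ∈ Q i)).card ≤ 2 + (Q z).card) : False := by
  have hsub : ∀ u ∈ I, ∀ z ∈ I, z ≠ u → Q z ⊆ (I.erase u).biUnion Q := by
    intro u _ z hz hzu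
    exact Finset.subset_biUnion_of_mem Q (Finset.mem_erase.2 ⟨hzu, hz⟩)
  -- no element in three of the sets
  have hthree : ∀ x, ∀ u ∈ I, x ∈ Q u → (I.filter (fun i => x ∈ Q i)).card ≤ 2 := by
    intro x u hu hxu
    by_contra hcon
    obtain ⟨v, hv, hvu⟩ := Finset.exists_mem_ne (s := I.filter (fun i => x ∈ Q i)) (by omega) u
    rw [Finset.mem_filter] at hv
    have hmem := hsub u hu v hv.1 hvu hv.2
    have hpos : 0 < ((I.erase u).biUnion Q).card := Finset.card_pos.2 ⟨x, hmem⟩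
    have heq : ∀ z ∈ I, z ≠ u → Q z = (I.erase u).biUnion Q := by
      intro z hz hzu
      apply Finset.eq_of_subset_of_card_le (hsub u hu z hz hzu)
      have := H u hu x hxu z hz
      rw [Finset.card_erase_of_mem hmem] at this
      omega
    have hall : I.filter (fun i => x ∈ Q i) = I := by
      apply Finset.filter_true_of_mem
      intro i hi
      by_cases hiu : i = u
      · rw [hiu]; exact hxu
      · rw [heq i hi hiu]; exact hmem
    have h3 := H u hu x hxu v hv.1
    rw [hall, hI, Finset.card_erase_of_mem hmem, heq v hv.1 hvu] at h3
    omega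
  have hdis : ∀ u ∈ I, ∀ v ∈ I, u ≠ v → ∀ x, x ∈ Q u → x ∉ Q v := by
    intro u hu v hv huv x hxu hxv
    have hm2 : I.filter (fun i => x ∈ Q i) = {u, v} := by
      symm
      apply Finset.eq_of_subset_of_card_le
      · intro i; simp only [Finset.mem_insert, Finset.mem_singleton, Finset.mem_filter]
        rintro (rfl | rfl) <;> simp [*]
      · rw [Finset.card_pair huv]; exact hthree x u hu hxu
    have hmu := hsub u hu v hv huv.symm hxv
    have hmv := hsub v hv u hu huv hxu
    have Hu : ∀ z ∈ I, ((I.erase u).biUnion Q).card ≤ 1 + (Q z).card := by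
      intro z hz
      have h := H u hu x hxu z hz
      rw [hm2, Finset.card_pair huv, Finset.card_erase_of_mem hmu] at h
      omega
    have Hv : ∀ z ∈ I, ((I.erase v).biUnion Q).card ≤ 1 + (Q z).card := by
      intro z hz
      have h := H v hv x hxv z hz
      rw [hm2, Finset.card_pair huv, Finset.card_erase_of_mem hmv] at h
      omega
    have hnx : ∀ z ∈ I, z ≠ u → z ≠ v → x ∉ Q z := by
      intro z hz h1 h2 hxz
      have : z ∈ I.filter (fun i => x ∈ Q i) := Finset.mem_filter.2 ⟨hz, hxz⟩
      rw [hm2] at this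
      simp [h1, h2] at this
    have heu : ∀ z ∈ I, z ≠ u → z ≠ v → insert x (Q z) = (I.erase u).biUnion Q := by
      intro z hz h1 h2
      apply Finset.eq_of_subset_of_card_le
      · exact Finset.insert_subset hmu (hsub u hu z hz h1)
      · rw [Finset.card_insert_of_notMem (hnx z hz h1 h2)]
        have := Hu z hz; omega
    have hev : ∀ z ∈ I, z ≠ u → z ≠ v → insert x (Q z) = (I.erase v).biUnion Q := by
      intro z hz h1 h2
      apply Finset.eq_of_subset_of_card_le
      · exact Finset.insert_subset hmv (hsub v hv z hz h2)
      · rw [Finset.card_insert_of_notMem (hnx z hz h1 h2)]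
        have := Hv z hz; omega
    obtain ⟨w, z, hwz, hwz'⟩ := Finset.card_eq_two.1 (show ((I.erase u).erase v).card = 2 by
      rw [Finset.card_erase_of_mem (by simp [hv, huv.symm]), Finset.card_erase_of_mem hu, hI])
    have hw : w ∈ (I.erase u).erase v := by rw [hwz']; simp
    have hz : z ∈ (I.erase u).erase v := by rw [hwz']; simp
    simp only [Finset.mem_erase] at hw hz
    have hsame : ∀ t ∈ I, t ≠ u → t ≠ v → ∀ y, y ≠ x → (y ∈ (I.erase u).biUnion Q) → y ∈ Q t := by
      intro t ht h1 h2 y hy hyP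
      rw [← heu t ht h1 h2] at hyP
      exact (Finset.mem_insert.1 hyP).resolve_left hy
    have hsame' : ∀ t ∈ I, t ≠ u → t ≠ v → ∀ y, y ≠ x → (y ∈ (I.erase v).biUnion Q) → y ∈ Q t := by
      intro t ht h1 h2 y hy hyP
      rw [← hev t ht h1 h2] at hyP
      exact (Finset.mem_insert.1 hyP).resolve_left hy
    have hthr : ∀ t ∈ I, t ≠ w → t ≠ z → ∀ y, y ∈ Q t → y ∈ Q w → y ∈ Q z → False := by
      intro t ht h1 h2 y e1 e2 e3
      have h := hthree y t ht e1
      have : ({t, w, z} : Finset V).card ≤ (I.filter (fun i => y ∈ Q i)).card := by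
        apply Finset.card_le_card
        intro i; simp only [Finset.mem_insert, Finset.mem_singleton, Finset.mem_filter]
        rintro (rfl | rfl | rfl) <;> simp [*]
      rw [Finset.card_eq_three.2 ⟨t, w, z, h1, h2, hwz, rfl⟩] at this
      omega
    have hv1 : Q v ⊆ {x} := by
      intro y hy
      by_contra hyx
      rw [Finset.mem_singleton] at hyx
      have hyP := hsub u hu v hv huv.symm hy
      exact hthr v hv hw.1.symm hz.1.symm y hy (hsame w hw.2.2 hw.2.1 hw.1 y hyx hyP)
        (hsame z hz.2.2 hz.2.1 hz.1 y hyx hyP)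
    have hu1 : Q u ⊆ {x} := by
      intro y hy
      by_contra hyx
      rw [Finset.mem_singleton] at hyx
      have hyP := hsub v hv u hu huv hy
      exact hthr u hu hw.2.1.symm hz.2.1.symm y hy (hsame' w hw.2.2 hw.2.1 hw.1 y hyx hyP)
        (hsame' z hz.2.2 hz.2.1 hz.1 y hyx hyP)
    have cv := Finset.card_le_card hv1
    have cu := Finset.card_le_card hu1
    rw [Finset.card_singleton] at cu cv
    obtain ⟨t, ht, ht2⟩ := hbig
    by_cases t1 : t = u
    · subst t1; omega
    by_cases t2 : t = v
    · subst t2; omega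
    have h5 := heu t ht t1 t2
    have h6 := Hu v hv
    rw [← h5, Finset.card_insert_of_notMem (hnx t ht t1 t2)] at h6
    omega
  obtain ⟨u, hu⟩ : I.Nonempty := Finset.card_pos.1 (by omega)
  obtain ⟨v, w, z, hvw, hvz, hwz, hI3⟩ := Finset.card_eq_three.1 (show (I.erase u).card = 3 by
    rw [Finset.card_erase_of_mem hu, hI])
  have hv : v ∈ I.erase u := by rw [hI3]; simp
  have hw : w ∈ I.erase u := by rw [hI3]; simp
  have hz : z ∈ I.erase u := by rw [hI3]; simp
  simp only [Finset.mem_erase] at hv hw hz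
  obtain ⟨x, hx⟩ := hne u hu
  obtain ⟨y, hy⟩ := hne w hw.2
  obtain ⟨y', hy'⟩ := hne z hz.2
  have h := H u hu x hx v hv.2
  have h1 : 1 ≤ (I.filter (fun i => x ∈ Q i)).card :=
    Finset.card_pos.2 ⟨u, by simp [hx, hu]⟩
  have h4 : (insert y (insert y' (Q v))).card ≤ (((I.erase u).biUnion Q).erase x).card := by
    apply Finset.card_le_card
    intro t ht
    simp only [Finset.mem_erase, Finset.mem_biUnion]
    simp only [Finset.mem_insert] at ht
    rcases ht with rfl | rfl | ht
    · exact ⟨by rintro rfl; exact hdis u hu w hw.2 hw.1.symm _ hx hy, w, hw, hy⟩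
    · exact ⟨by rintro rfl; exact hdis u hu z hz.2 hz.1.symm _ hx hy', z, hz, hy'⟩
    · exact ⟨by rintro rfl; exact hdis u hu v hv.2 hv.1.symm _ hx ht, v, hv, ht⟩
  have hyv := hdis w hw.2 v hv.2 hvw.symm y hy
  have hyv' := hdis z hz.2 v hv.2 hvz.symm y' hy'
  have hyy : y ≠ y' := by rintro rfl; exact hdis w hw.2 z hz.2 hwz y hy hy'
  rw [Finset.card_insert_of_notMem (by simp [hyy, hyv]), Finset.card_insert_of_notMem hyv'] at h4
  omega

theorem K7 (hE : Ext G T d) (hO : ∀ x, x ∉ T → ∀ t ∈ T, d x ≤ d t) (I : Finset V) (hIT : I ⊆ T)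
    (hd4 : (T.filter (fun t => d t < 4)).card ≤ 2)
    (hI : I.card = 4) (a : ℕ) (ha : ∀ i ∈ I, fdeg G T i = a) (hU : ∀ i ∈ I, (Qs G T i).Nonempty)
    (hJ : ∀ i ∈ I, ∀ j ∈ I, i ≠ j → J G T i j) (ha2 : a ≤ 2) : False := by
  apply four_sets I hI (Qs G T) hU
  · by_contra hcon
    push Not at hcon
    have : I ⊆ T.filter (fun t => d t < 4) := by
      intro i hi
      rw [Finset.mem_filter]
      refine ⟨hIT hi, ?_⟩
      rw [← hE.1 i, dg_eq G T, ha i hi]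
      have := hcon i hi
      omega
    have := Finset.card_le_card this
    omega
  intro u hu x hx z hz
  have h := GI0 hE hO hx (I.erase u) (by
    intro w hw
    rw [Finset.mem_erase] at hw
    exact hJ u hu w hw.2 hw.1.symm) (hIT hz) (I.filter (fun i => x ∈ Qs G T i))
    ((Finset.filter_subset _ _).trans hIT) (by intro i hi; exact (Finset.mem_filter.1 hi).2)
  rw [ha z hz] at h
  omega

theorem countP_le {f : V → ℕ} {as : List V} (h : as.Nodup) {p : ℕ → Bool} {S : Finset V}
    (hS : ∀ x ∈ as, p (f x) = true → x ∈ S) : (as.map f).countP p ≤ S.card := by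
  rw [List.countP_map, List.countP_eq_length_filter,
    ← List.toFinset_card_of_nodup (h.filter _)]
  apply Finset.card_le_card
  intro x hx
  simp only [List.mem_toFinset, List.mem_filter, Function.comp] at hx
  exact hS x hx.1 hx.2

theorem count_ex {f : V → ℕ} {us : List V} (h : us.Nodup) {k a : ℕ}
    (hk : k ≤ (us.map f).count a) :
    ∃ I : Finset V, I.card = k ∧ ∀ i ∈ I, i ∈ us ∧ f i = a := by
  rw [List.count, List.countP_map, List.countP_eq_length_filter,
    ← List.toFinset_card_of_nodup (h.filter _)] at hk
  obtain ⟨I, hI, hc⟩ := Finset.exists_subset_card_eq hk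
  refine ⟨I, hc, fun i hi => ?_⟩
  have := hI hi
  simpa using this

theorem cg_eq {vs : List V} (hvs : vs.Nodup) (hvT : ∀ x, x ∈ vs ↔ x ∈ T) (t : ℕ) :
    cg (vs.map (fdeg G T)) t = (Bs G T t).card := by
  unfold cg Bs
  rw [List.countP_map, List.countP_eq_length_filter,
    ← List.toFinset_card_of_nodup (hvs.filter _)]
  congr 1
  ext x
  simp [hvT]

theorem k4_sound (hE : Ext G T d) (hO : ∀ x, x ∉ T → ∀ t ∈ T, d x ≤ d t)
    {vs : List V} (hvs : vs.Nodup) (hvT : ∀ x, x ∈ vs ↔ x ∈ T) {a b : ℕ}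
    (hNA : ∀ u ∈ T, ∀ v ∈ T, u ≠ v → fdeg G T u = a → fdeg G T v = b → J G T u v)
    {us : List V} (hus : us.Nodup) (hU : ∀ u ∈ us, u ∈ T ∧ (Qs G T u).Nonempty) :
    k4 (vs.map (fdeg G T)) (us.map (fdeg G T)) a b = false := by
  rw [← Bool.not_eq_true]
  intro h
  simp only [k4, Bool.and_eq_true, Nat.ble_eq, cg_eq hvs hvT] at h
  obtain ⟨⟨h1, h2⟩, h3⟩ := h
  have : ∃ u ∈ us, ∃ v ∈ us, u ≠ v ∧ fdeg G T u = a ∧ fdeg G T v = b := by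
    by_cases hab : Nat.beq a b = true
    · rw [if_pos hab, Nat.ble_eq] at h3
      obtain ⟨I, hI, hI2⟩ := count_ex hus h3
      obtain ⟨u, v, huv, rfl⟩ := Finset.card_eq_two.1 hI
      have hab' := Nat.eq_of_beq_eq_true hab
      have e1 := hI2 u (by simp)
      have e2 := hI2 v (by simp)
      exact ⟨u, e1.1, v, e2.1, huv, e1.2, by rw [e2.2, hab']⟩
    · rw [if_neg hab, Bool.and_eq_true, Nat.ble_eq, Nat.ble_eq] at h3
      obtain ⟨I, hI, hI2⟩ := count_ex hus h3.1
      obtain ⟨u, rfl⟩ := Finset.card_eq_one.1 hI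
      obtain ⟨I', hI', hI2'⟩ := count_ex hus h3.2
      obtain ⟨v, rfl⟩ := Finset.card_eq_one.1 hI'
      have e1 := hI2 u (by simp)
      have e2 := hI2' v (by simp)
      refine ⟨u, e1.1, v, e2.1, ?_, e1.2, e2.2⟩
      rintro rfl
      apply hab
      rw [← e1.2, ← e2.2]
      exact Nat.beq_refl _
  obtain ⟨u, hu, v, hv, huv, rfl, rfl⟩ := this
  have := K4 hE hO (hU u hu).1 (hU v hv).1 huv (hU u hu).2
    (hNA u (hU u hu).1 v (hU v hv).1 huv rfl rfl) h1
  omega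

theorem kill_sound (hE : Ext G T d) (hO : ∀ x, x ∉ T → ∀ t ∈ T, d x ≤ d t)
    (hd4 : (T.filter (fun t => d t < 4)).card ≤ 2)
    (hd3 : (T.filter (fun t => d t < 3)).card ≤ 1)
    (hd2 : (T.filter (fun t => d t < 2)).card ≤ 0)
    {vs : List V} (hvs : vs.Nodup) (hvT : ∀ x, x ∈ vs ↔ x ∈ T) {a b : ℕ}
    (hNA : ∀ u ∈ T, ∀ v ∈ T, u ≠ v → fdeg G T u = a → fdeg G T v = b → J G T u v)
    (us as : List V) (hus : us.Nodup) (has : as.Nodup)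
    (hU : ∀ u ∈ us, u ∈ T ∧ (Qs G T u).Nonempty)
    (hA : ∀ u ∈ as, u ∈ T ∧ Qs G T u = ∅) :
    kill (vs.map (fdeg G T)) a b (us.map (fdeg G T)) (as.map (fdeg G T)) = false := by
  have hAd : ∀ u ∈ as, fdeg G T u = d u := by
    intro u hu
    rw [← hE.1 u, dg_eq G T, (hA u hu).2, Finset.card_empty, add_zero]
  rw [← Bool.not_eq_true]
  intro h
  unfold kill at h
  rw [k4_sound hE hO hvs hvT hNA hus hU, k4_sound hE hO hvs hvT
    (fun u hu v hv huv e1 e2 => (hNA v hv u hu huv.symm e2 e1).symm) hus hU] at h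
  simp only [Bool.or_eq_true, Bool.and_eq_true, Nat.ble_eq, cg_eq hvs hvT, Bool.or_false] at h
  have hbud : ∀ k m, (T.filter (fun t => d t < k)).card ≤ m →
      ¬ (m + 1 ≤ (as.map (fdeg G T)).countP (fun x => Nat.ble (x + 1) k)) := by
    intro k m hk hm
    have := countP_le (f := fdeg G T) has (p := fun x => Nat.ble (x + 1) k)
      (S := T.filter (fun t => d t < k)) (by
        intro x hx hp
        rw [Nat.ble_eq, hAd x hx] at hp
        rw [Finset.mem_filter]
        exact ⟨(hA x hx).1, hp⟩)
    omega
  rcases h with (((h | h) | h) | h) | ⟨hab, h⟩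
  · exact hbud 4 2 hd4 h
  · exact hbud 3 1 hd3 h
  · exact hbud 2 0 hd2 h
  · rw [List.any_eq_true] at h
    obtain ⟨n, hn, h⟩ := h
    obtain ⟨u, hu, rfl⟩ := List.mem_map.1 hn
    simp only [Bool.or_eq_true, Nat.ble_eq] at h
    rcases h with h | h
    · have := K2 hE hO (hU u hu).1 (hU u hu).2
      omega
    · rw [List.any_eq_true] at h
      obtain ⟨m, hm, h⟩ := h
      obtain ⟨x, hx, rfl⟩ := List.mem_map.1 hm
      simp only [Bool.or_eq_true, Nat.ble_eq] at h
      have e1 := K1 hE (hU u hu).1 (hA x hx).1 (hU u hu).2 (hA x hx).2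
      have e2 := K6 hE hO (hU u hu).1 (hA x hx).1 (hU u hu).2 (hA x hx).2
      omega
  · have hab' := Nat.eq_of_beq_eq_true hab
    subst hab'
    rcases h with ⟨h, h'⟩ | ⟨h, h'⟩
    · obtain ⟨I, hI, hI2⟩ := count_ex hus h
      have := K5 hE hO I (fun i hi => (hU i (hI2 i hi).1).1) hI a (fun i hi => (hI2 i hi).2)
        (fun i hi => (hU i (hI2 i hi).1).2)
        (fun i hi j hj hij => hNA i (hU i (hI2 i hi).1).1 j (hU j (hI2 j hj).1).1 hij
          (hI2 i hi).2 (hI2 j hj).2)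
      omega
    · obtain ⟨I, hI, hI2⟩ := count_ex hus h
      exact K7 hE hO I (fun i hi => (hU i (hI2 i hi).1).1) hd4 hI a (fun i hi => (hI2 i hi).2)
        (fun i hi => (hU i (hI2 i hi).1).2)
        (fun i hi j hj hij => hNA i (hU i (hI2 i hi).1).1 j (hU j (hI2 j hj).1).1 hij
          (hI2 i hi).2 (hI2 j hj).2) h'

theorem even_sum (G : SimpleGraph V) (T : Finset V) : (∑ t ∈ T, fdeg G T t) % 2 = 0 := by
  have h := (repl ⊥ T G).sum_degrees_eq_twice_card_edges
  have h2 : ∑ v, (repl ⊥ T G).degree v = ∑ t ∈ T, fdeg G T t := by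
    symm
    rw [← Finset.sum_subset (Finset.subset_univ T)]
    · apply Finset.sum_congr rfl
      intro t ht
      rw [← SimpleGraph.card_neighborFinset_eq_degree, fdeg]
      congr 1
      ext x
      rw [SimpleGraph.mem_neighborFinset, Finset.mem_filter]
      simp [repl, ht]
    · intro v _ hv
      rw [← SimpleGraph.card_neighborFinset_eq_degree, Finset.card_eq_zero]
      ext x
      rw [SimpleGraph.mem_neighborFinset]
      simp [repl, hv]
  rw [h2] at h
  omega

theorem eg_split (G : SimpleGraph V) (X Y : Finset V) (hXY : Disjoint X Y) :
    ∑ y ∈ Y, fdeg G (X ∪ Y) y ≤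
      Y.card * (Y.card - 1) + ∑ x ∈ X, min (fdeg G (X ∪ Y) x) Y.card := by
  have h1 : ∀ v, fdeg G (X ∪ Y) v = fdeg G Y v + fdeg G X v := by
    intro v
    unfold fdeg
    rw [Finset.filter_union, Finset.card_union_of_disjoint, add_comm]
    exact Finset.disjoint_filter_filter hXY
  have h2 : ∑ y ∈ Y, fdeg G X y = ∑ x ∈ X, fdeg G Y x := by
    have := Finset.sum_card_bipartiteAbove_eq_sum_card_bipartiteBelow (s := Y) (t := X) G.Adj
    unfold Finset.bipartiteAbove Finset.bipartiteBelow at this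
    unfold fdeg
    rw [this]
    apply Finset.sum_congr rfl
    intro x _
    congr 1
    ext y
    simp [G.adj_comm]
  have h3 : ∑ y ∈ Y, fdeg G (X ∪ Y) y = ∑ y ∈ Y, fdeg G Y y + ∑ x ∈ X, fdeg G Y x := by
    rw [← h2, ← Finset.sum_add_distrib]
    exact Finset.sum_congr rfl (fun y _ => h1 y)
  rw [h3]
  apply Nat.add_le_add
  · rw [← smul_eq_mul]
    apply Finset.sum_le_card_nsmul
    intro y hy
    have := fdeg_lt G hy
    omega
  · apply Finset.sum_le_sum
    intro x _
    rw [h1]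
    apply le_min (Nat.le_add_right _ _)
    exact Finset.card_filter_le _ _

theorem eg_sound {vs : List V} (hvs : vs.Nodup) (hvT : ∀ x, x ∈ vs ↔ x ∈ T) :
    egB (vs.map (fdeg G T)) = true := by
  simp only [egB, List.all_eq_true, List.mem_range, Nat.ble_eq, List.length_map]
  intro k hk
  have hTT : T = (vs.take k).toFinset ∪ (vs.drop k).toFinset := by
    rw [← List.toFinset_append, List.take_append_drop]
    ext x; simp [hvT]
  have hdj : Disjoint (vs.take k).toFinset (vs.drop k).toFinset := by
    rw [List.disjoint_toFinset_iff_disjoint]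
    exact List.disjoint_take_drop hvs le_rfl
  have h := eg_split G _ _ hdj
  rw [← hTT, List.sum_toFinset _ (hvs.sublist (List.drop_sublist k vs)),
    List.sum_toFinset _ (hvs.sublist (List.take_sublist k vs)),
    List.toFinset_card_of_nodup (hvs.sublist (List.drop_sublist k vs)), List.length_drop] at h
  rw [← List.map_drop, ← List.map_take, List.map_map]
  exact h

/-- embedding of the certificate graph -/
def Emb (G : SimpleGraph V) (T : Finset V) (l c : ℕ) (e : Fin l ↪ V) : Prop :=
  Finset.univ.map e = T ∧ ∀ i : Fin l, fdeg G T (e i) = degB l c i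

theorem emb_exists {vs : List V} (hvs : vs.Nodup) (hvT : ∀ x, x ∈ vs ↔ x ∈ T) {l c : ℕ}
    (hp : ((List.range l).map (degB l c)).Perm (vs.map (fdeg G T))) :
    ∃ e : Fin l ↪ V, Emb G T l c e := by
  obtain ⟨ws, h1, h2⟩ := perm_lift (fdeg G T) hp vs rfl
  have hlen : ws.length = l := by
    have := congrArg List.length h2
    simpa using this
  have hnd : ws.Nodup := h1.nodup_iff.2 hvs
  subst hlen
  refine ⟨⟨fun i => ws[i], ?_⟩, ?_, ?_⟩
  · intro i j hij
    exact Fin.ext ((hnd.getElem_inj_iff).1 hij)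
  · ext x
    rw [← hvT, ← h1.mem_iff, Finset.mem_map]
    simp only [Finset.mem_univ, true_and]
    constructor
    · rintro ⟨i, rfl⟩
      exact List.getElem_mem _
    · intro hx
      obtain ⟨i, hi, rfl⟩ := List.getElem_of_mem hx
      exact ⟨⟨i, hi⟩, rfl⟩
  · intro i
    have h3 : (ws.map (fdeg G T))[(i : ℕ)]'(by simp) =
      ((List.range ws.length).map (degB ws.length c))[(i : ℕ)]'(by simp) := by
      simp only [h2]
    simpa using h3

theorem emb_swap {l c : ℕ} {e : Fin l ↪ V} (he : Emb G T l c e) {k : Fin l} {w : V} (hw : w ∈ T)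
    (hf : fdeg G T w = degB l c k) :
    Emb G T l c (e.trans (Equiv.swap (e k) w).toEmbedding) := by
  have hk : e k ∈ T := by rw [← he.1]; simp
  constructor
  · rw [← Finset.map_map, he.1]
    apply Finset.eq_of_subset_of_card_le
    · intro x hx
      rw [Finset.mem_map] at hx
      obtain ⟨y, hy, rfl⟩ := hx
      simp only [Equiv.coe_toEmbedding]
      rw [Equiv.swap_apply_def]
      split_ifs <;> assumption
    · rw [Finset.card_map]
  · intro i
    rw [← he.2 i]
    simp only [Function.Embedding.trans_apply, Equiv.coe_toEmbedding]
    rw [Equiv.swap_apply_def]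
    split_ifs with e1 e2
    · rw [hf, e1, he.2 k]
    · rw [he.2 k, ← hf, e2]
    · rfl

theorem emb_two {l c : ℕ} {e : Fin l ↪ V} (he : Emb G T l c e) {i j : Fin l} (hij : i ≠ j) {u v : V}
    (hu : u ∈ T) (hv : v ∈ T) (huv : u ≠ v)
    (hfu : fdeg G T u = degB l c i) (hfv : fdeg G T v = degB l c j) :
    ∃ e' : Fin l ↪ V, Emb G T l c e' ∧ e' i = u ∧ e' j = v := by
  have h1 := emb_swap he hu hfu
  have hi : (e.trans (Equiv.swap (e i) u).toEmbedding) i = u := by simp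
  revert h1 hi
  generalize e.trans (Equiv.swap (e i) u).toEmbedding = e1
  intro h1 hi
  refine ⟨_, emb_swap h1 hv hfv, ?_, by simp⟩
  simp only [Function.Embedding.trans_apply, Equiv.coe_toEmbedding, hi]
  apply Equiv.swap_apply_of_ne_of_ne _ huv
  intro h
  exact hij (e1.injective (hi.trans h))

theorem emb_fdeg {l c : ℕ} {e : Fin l ↪ V} (he : Emb G T l c e) :
    ∀ t ∈ T, fdeg ((cgraph l c).map e) T t = fdeg G T t := by
  intro t ht
  have ht' := ht
  rw [← he.1, Finset.mem_map] at ht'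
  obtain ⟨i, _, rfl⟩ := ht'
  have key : ∀ j, ((cgraph l c).map e).Adj (e i) (e j) ↔ (cgraph l c).Adj i j :=
    fun j => SimpleGraph.map_adj_apply
  generalize (cgraph l c).map e = M at key ⊢
  rw [he.2 i, ← degB_eq, fdeg, ← Finset.card_map e]
  congr 1
  ext x
  rw [Finset.mem_filter, Finset.mem_map, ← he.1, Finset.mem_map]
  constructor
  · rintro ⟨⟨j, _, rfl⟩, h⟩
    exact ⟨j, by simpa using (key j).1 h, rfl⟩
  · rintro ⟨j, hj, rfl⟩
    exact ⟨⟨j, by simp, rfl⟩, (key j).2 (by simpa using hj)⟩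

theorem emb_NA (hE : Ext G T d) {l c : ℕ} {e : Fin l ↪ V} (he : Emb G T l c e) {i j : Fin l}
    (hij : i ≠ j) (hadj : ¬ (cgraph l c).Adj i j) :
    ∀ u ∈ T, ∀ v ∈ T, u ≠ v → fdeg G T u = degB l c i → fdeg G T v = degB l c j → J G T u v := by
  intro u hu v hv huv hfu hfv
  obtain ⟨e', he', h1, h2⟩ := emb_two he hij hu hv huv hfu hfv
  have hE' := repl_ext hE _ (emb_fdeg he')
  intro x hx y hy hxy
  have hna : ¬ (repl G T ((cgraph l c).map e')).Adj u v := by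
    simp only [repl, hu, hv, true_and, not_true, false_and, or_false]
    rw [← h1, ← h2, SimpleGraph.map_adj_apply]
    exact hadj
  have h := M1 hE' hu hv huv hna (by rw [repl_Qs]; exact hx) (by rw [repl_Qs]; exact hy) hxy
  have hxT := (mem_Qs.1 hx).1
  simpa [repl, hxT] using h

theorem main_graph (l : ℕ) (hl8 : l ≤ 8)
    (hfin : ∀ L : List ℕ, L.length = l → L.Pairwise (· ≤ ·) → (∀ x ∈ L, x < l) →
      pre L = true ∨ ∃ c, okc l L c = true)
    (T : Finset V) (hT : T.card = l) (d : V → ℕ)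
    (hG : ∃ G : SimpleGraph V, ∀ v, dg G v = d v)
    (hO : ∀ x, x ∉ T → ∀ t ∈ T, d x ≤ d t)
    (hd4 : (T.filter (fun t => d t < 4)).card ≤ 2)
    (hd3 : (T.filter (fun t => d t < 3)).card ≤ 1)
    (hd2 : (T.filter (fun t => d t < 2)).card ≤ 0) :
    ∃ G : SimpleGraph V, (∀ v, dg G v = d v) ∧ ∀ r, 3 ≤ r → r ≤ l →
      (SimpleGraph.cycleGraph r).IsContained (G.induce (T : Set V)) := by
  obtain ⟨G0, hG0⟩ := hG
  obtain ⟨G, hE⟩ := exists_ext T d G0 hG0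
  obtain ⟨vs, hvp, hvL⟩ := perm_lift (fdeg G T)
    (List.perm_insertionSort (· ≤ ·) (T.toList.map (fdeg G T))) T.toList rfl
  have hvs : vs.Nodup := hvp.nodup_iff.2 T.nodup_toList
  have hvT : ∀ x, x ∈ vs ↔ x ∈ T := fun x => by rw [hvp.mem_iff, Finset.mem_toList]
  have hlt : ∀ t ∈ T, fdeg G T t < l := fun t ht => hT ▸ fdeg_lt G ht
  have hsearch : ∀ a b, (∀ u ∈ T, ∀ v ∈ T, u ≠ v → fdeg G T u = a → fdeg G T v = b → J G T u v) →
      search (vs.map (fdeg G T)) a b (vs.map (fdeg G T)) [] [] = false := by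
    intro a b hNA
    exact search_sound (fdeg G T) (fun u => u ∈ T ∧ (Qs G T u).Nonempty)
      (fun u => u ∈ T ∧ Qs G T u = ∅) _ a b
      (kill_sound hE hO hd4 hd3 hd2 hvs hvT hNA) vs [] []
      (by
        intro v hv
        rw [hvT] at hv
        rcases Finset.eq_empty_or_nonempty (Qs G T v) with h | h
        · exact Or.inr ⟨hv, h⟩
        · exact Or.inl ⟨hv, h⟩)
      (by simpa using hvs) (by simpa using hvs) (by simp) (by simp)
  rcases hfin (vs.map (fdeg G T)) (by rw [List.length_map, hvp.length_eq, Finset.length_toList, hT])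
    (by rw [hvL]; exact List.pairwise_insertionSort _ _)
    (by
      intro x hx
      obtain ⟨t, ht, rfl⟩ := List.mem_map.1 hx
      exact hlt t ((hvT t).1 ht)) with h | ⟨c, h⟩
  · exfalso
    simp only [pre, eg_sound hvs hvT, Bool.or_eq_true, Bool.not_true, Bool.false_eq_true,
      or_false] at h
    rcases h with h | h
    · have h := Nat.eq_of_beq_eq_true h
      rw [← List.sum_toFinset _ hvs] at h
      have : vs.toFinset = T := by ext x; simp [hvT]
      rw [this, even_sum] at h
      omega
    · rw [hsearch 100 100 (by
        intro u hu v _ _ e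
        have := hlt u hu
        omega)] at h
      simp at h
  · simp only [okc, Bool.and_eq_true, Bool.or_eq_true] at h
    obtain ⟨hp, h⟩ := h
    rw [List.isPerm_iff] at hp
    obtain ⟨e, he⟩ := emb_exists hvs hvT hp
    rcases h with h | ⟨⟨⟨⟨h1, h2⟩, h3⟩, h4⟩, h5⟩
    · refine ⟨repl G T ((cgraph l c.1).map e), (repl_ext hE _ (emb_fdeg he)).1, ?_⟩
      intro r hr hrl
      refine (good_sound h hr hrl).trans ⟨⟨⟨fun i => ⟨e i, ?_⟩, ?_⟩, ?_⟩⟩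
      · rw [← he.1]; simp
      · intro i j hij
        have hi : ∀ i, e i ∈ T := fun i => by rw [← he.1]; simp
        simp only [SimpleGraph.comap_adj, Function.Embedding.subtype_apply, repl, hi, true_and,
          not_true, false_and, or_false]
        rw [SimpleGraph.map_adj_apply]
        exact hij
      · intro i j hij
        apply e.injective
        simpa using hij
    · exfalso
      rw [Nat.ble_eq] at h1 h2
      have hne : (⟨c.2.1, h1⟩ : Fin l) ≠ ⟨c.2.2, h2⟩ := by
        intro hh
        rw [Fin.mk.injEq] at hh
        rw [hh] at h3
        simp at h3
      have := hsearch _ _ (emb_NA hE he hne (by simpa [cgraph] using h4))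
      rw [this] at h5
      simp at h5

end graph

/-- the finite verification for both values of `ℓ` -/
theorem fin_check (l : ℕ) (hl : l = 7 ∨ l = 8) (L : List ℕ) (hL : L.length = l)
    (hs : L.Pairwise (· ≤ ·)) (hb : ∀ x ∈ L, x < l) : pre L = true ∨ ∃ c, okc l L c = true := by
  have hm := asc_mem l l 0 L hL hs (fun x hx => ⟨Nat.zero_le _, hb x hx⟩)
  rcases hl with rfl | rfl
  · exact go_sound 7 _ _ check7 L hm
  · exact go_sound 8 _ _ check8 L hm

theorem budget {n : ℕ} (l m k : ℕ) (hn : l ≤ n) (hm : m < l) (d : Fin n → ℕ) (hanti : Antitone d)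
    (h : k ≤ d ⟨m, by omega⟩) (T : Finset (Fin n)) (hT : ∀ i, i ∈ T → (i : ℕ) < l)
    [DecidablePred fun t => d t < k] :
    (T.filter (fun t => d t < k)).card ≤ l - 1 - m := by
  have : ((T.filter (fun t => d t < k)).map Fin.valEmbedding) ⊆ Finset.Ioo m l := by
    intro x hx
    rw [Finset.mem_map] at hx
    obtain ⟨t, ht, rfl⟩ := hx
    rw [Finset.mem_filter] at ht
    rw [Finset.mem_Ioo]
    refine ⟨?_, hT t ht.1⟩
    by_contra hcon
    have : d ⟨m, by omega⟩ ≤ d t := hanti (by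
      rw [Fin.le_def]
      simpa using hcon)
    omega
  have := Finset.card_le_card this
  rw [Finset.card_map, Nat.card_Ioo] at this
  omega

end L27

/-- **Lemma 2.7.** Let `ℓ ∈ {7,8}`, `n ≥ ℓ` and let `π = (d₁,…,dₙ)` be a non-increasing
graphic sequence with `d_{ℓ-2} ≥ 4`, `d_{ℓ-1} ≥ 3` and `d_ℓ ≥ 2`. Then `π` has a
realization containing `C₃, …, C_ℓ` on those vertices with degrees `d₁, …, d_ℓ`. -/
theorem lemma27 (ℓ n : ℕ) (hl : ℓ = 7 ∨ ℓ = 8) (hn : ℓ ≤ n) (d : Fin n → ℕ)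
    (hanti : Antitone d) (hgr : Graphic d)
    (h1 : 4 ≤ d ⟨ℓ - 3, by omega⟩) (h2 : 3 ≤ d ⟨ℓ - 2, by omega⟩)
    (h3 : 2 ≤ d ⟨ℓ - 1, by omega⟩) :
    RealizationWithCyclesOn ℓ d := by
  
  classical
  obtain ⟨G0, hG0⟩ := hgr
  have hdg : ∀ (G : SimpleGraph (Fin n)) (v : Fin n), (G.neighborSet v).ncard = L27.dg G v := by
    intro G v
    rw [L27.dg, ← Set.ncard_coe_finset]
    congr 1
    ext x
    simp
  set T : Finset (Fin n) := Finset.univ.filter (fun i : Fin n => (i : ℕ) < ℓ) with hTdef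
  have hmem : ∀ i, i ∈ T ↔ (i : ℕ) < ℓ := fun i => by simp [hTdef]
  have hcard : T.card = ℓ := by
    have : T.map Fin.valEmbedding = Finset.range ℓ := by
      ext x
      rw [Finset.mem_map, Finset.mem_range]
      constructor
      · rintro ⟨i, hi, rfl⟩
        exact (hmem i).1 hi
      · intro hx
        exact ⟨⟨x, by omega⟩, (hmem _).2 hx, rfl⟩
    rw [← Finset.card_map Fin.valEmbedding, this, Finset.card_range]
  have b4 := L27.budget ℓ (ℓ - 3) 4 hn (by omega) d hanti h1 T (fun i hi => (hmem i).1 hi)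
  have b3 := L27.budget ℓ (ℓ - 2) 3 hn (by omega) d hanti h2 T (fun i hi => (hmem i).1 hi)
  have b2 := L27.budget ℓ (ℓ - 1) 2 hn (by omega) d hanti h3 T (fun i hi => (hmem i).1 hi)
  obtain ⟨G, hG, hcyc⟩ := L27.main_graph ℓ (by omega) (L27.fin_check ℓ hl) T hcard d
    ⟨G0, fun v => by rw [← hdg]; exact hG0 v⟩
    (by
      intro x hx t ht
      rw [hmem] at hx ht
      exact hanti (by rw [Fin.le_def]; omega))
    (by convert b4.trans (show ℓ - 1 - (ℓ - 3) ≤ 2 by omega))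
    (by convert b3.trans (show ℓ - 1 - (ℓ - 2) ≤ 1 by omega))
    (by convert b2.trans (show ℓ - 1 - (ℓ - 1) ≤ 0 by omega))
  refine ⟨G, T, fun i => by rw [hdg]; exact hG i, hcard, rfl, ?_⟩
  intro r hr hrl
  exact (SimpleGraph.cycleGraph_isContained_iff (by omega)).1 (hcyc r hr hrl)
end
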